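/- Let 1<p<∞, ω a Muckenhoupt A_p weight on ℝⁿ, T a θ-type Calderón–Zygmund operator with kernel K and θ satisfying the Dini condition, and b ∈ BMO(ℝⁿ). Then there is a constant C (independent of b and f) such that ‖[b,T*]f‖_{L^p(ω)} ≤ C ‖b‖_BMO ‖f‖_{L^p(ω)} for all f ∈ L^p(ω), where [b,T*]f(x) = sup_{ε>0} |∫_{|x−y|≥ε} (b(x)−b(y))K(x,y)f(y)dy|. -/

import Mathlib

open MeasureTheory Metric Filter Set
open scoped ENNReal Topology

noncomputable section

abbrev Rn (n : ℕ) := EuclideanSpace ℝ (Fin n)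

/-- θ is a modulus of continuity as in the paper: continuous, increasing,
subadditive on `[0,1]`, nonnegative, with `θ 0 = 0`. -/
def IsModulus (θ : ℝ → ℝ) : Prop :=
  ContinuousOn θ (Icc 0 1) ∧ MonotoneOn θ (Icc 0 1) ∧
    (∀ s t : ℝ, 0 ≤ s → 0 ≤ t → s + t ≤ 1 → θ (s + t) ≤ θ s + θ t) ∧
    θ 0 = 0 ∧ ∀ t ∈ Icc (0:ℝ) 1, 0 ≤ θ t

/-- The Dini condition `∫₀¹ θ(t)/t dt < ∞`. -/
def DiniCondition (θ : ℝ → ℝ) : Prop :=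
  IntegrableOn (fun t => θ t / t) (Ioc (0:ℝ) 1)

/-- `K` is a θ-type kernel with size constant `C₀`. -/
def IsThetaKernel (n : ℕ) (θ : ℝ → ℝ) (C₀ : ℝ) (K : Rn n → Rn n → ℝ) : Prop :=
  (∀ x y : Rn n, x ≠ y → |K x y| ≤ C₀ / ‖x - y‖ ^ n) ∧
    ∀ x x' y : Rn n, x ≠ y → 2 * ‖x - x'‖ ≤ ‖x - y‖ →
      |K x y - K x' y| + |K y x - K y x'| ≤ θ (‖x - x'‖ / ‖x - y‖) / ‖x - y‖ ^ n

/-- The open cube centered at `c` with sidelength `r`. -/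
def cube {n : ℕ} (c : Rn n) (r : ℝ) : Set (Rn n) := {x | ∀ i, |x i - c i| < r / 2}

/-- `ω` is a Muckenhoupt `A_p` weight (over cubes). -/
def IsAp (n : ℕ) (p : ℝ) (ω : Rn n → ℝ) : Prop :=
  (∀ᵐ x : Rn n, 0 < ω x) ∧ LocallyIntegrable ω volume ∧
    ∃ A : ℝ≥0∞, A ≠ ⊤ ∧ ∀ (c : Rn n) (r : ℝ), 0 < r →
      ((∫⁻ x in cube c r, ENNReal.ofReal (ω x)) / ENNReal.ofReal (r ^ n)) *
        (((∫⁻ x in cube c r, ENNReal.ofReal (ω x ^ (1 - p / (p - 1)))) /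
          ENNReal.ofReal (r ^ n)) ^ (p - 1)) ≤ A

/-- The measure `ω(x) dx`. -/
def wMeasure (n : ℕ) (ω : Rn n → ℝ) : Measure (Rn n) :=
  (volume : Measure (Rn n)).withDensity fun x => ENNReal.ofReal (ω x)

/-- Hardy–Littlewood maximal function, `ℝ≥0∞`-valued. -/
def maximal {n : ℕ} (f : Rn n → ℝ) (x : Rn n) : ℝ≥0∞ :=
  ⨆ (r : ℝ) (_ : 0 < r),
    (volume (ball x r))⁻¹ * ∫⁻ y in ball x r, ENNReal.ofReal |f y|

/-- Mean oscillation of `b` over the ball `B(c,r)`. -/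
def oscBall {n : ℕ} (b : Rn n → ℝ) (c : Rn n) (r : ℝ) : ℝ :=
  ⨍ x in ball c r, |b x - ⨍ y in ball c r, b y|

/-- `b ∈ BMO(ℝⁿ)`. -/
def IsBMO {n : ℕ} (b : Rn n → ℝ) : Prop :=
  LocallyIntegrable b volume ∧ ∃ C : ℝ, ∀ c r, 0 < r → oscBall b c r ≤ C

/-- The BMO norm of `b`. -/
def bmoNorm {n : ℕ} (b : Rn n → ℝ) : ℝ :=
  ⨆ c : Rn n, ⨆ r : {r : ℝ // 0 < r}, oscBall b c r.1

/-- `b ∈ VMO(ℝⁿ)`: `b ∈ BMO` and its oscillation over balls of a fixed size tends to `0`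
both as the size tends to `0` and as it tends to `∞`. -/
def IsVMO {n : ℕ} (b : Rn n → ℝ) : Prop :=
  IsBMO b ∧
    Tendsto (fun r : ℝ => ⨆ c : Rn n, oscBall b c r) (𝓝[>] 0) (𝓝 0) ∧
    Tendsto (fun r : ℝ => ⨆ c : Rn n, oscBall b c r) atTop (𝓝 0)

/-- `T` is an operator, bounded on `L²`, associated with the kernel `K`:
for smooth compactly supported `f` and a.e. `x` outside the support of `f`,
`T f x = ∫ K x y * f y dy`. -/
def IsCZO (n : ℕ) (K : Rn n → Rn n → ℝ)
    (T : Lp ℝ 2 (volume : Measure (Rn n)) →L[ℝ] Lp ℝ 2 (volume : Measure (Rn n))) : Prop :=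
  ∀ (f : Rn n → ℝ) (hf : MemLp f 2 (volume : Measure (Rn n))),
    ContDiff ℝ (⊤ : ℕ∞) f → HasCompactSupport f →
      ∀ᵐ x : Rn n, x ∉ tsupport f → (T (hf.toLp f) : Rn n → ℝ) x = ∫ y, K x y * f y

/-- Properties of the smooth truncation function `ψ`. -/
def PsiCond (ψ : ℝ → ℝ) (C₁ : ℝ) : Prop :=
  (∀ t, 0 ≤ ψ t ∧ ψ t ≤ 1) ∧ (∀ t ≤ (1:ℝ)/2, ψ t = 0) ∧ (∀ t, 1 ≤ t → ψ t = 1) ∧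
    ∀ t ∈ Ioo ((1:ℝ)/2) 1, |deriv ψ t| ≤ C₁

/-- The maximal commutator `[b,T*] f (x)`. -/
def maxComm {n : ℕ} (K : Rn n → Rn n → ℝ) (b f : Rn n → ℝ) (x : Rn n) : ℝ≥0∞ :=
  ⨆ (ε : ℝ) (_ : 0 < ε),
    ENNReal.ofReal |∫ y in {y : Rn n | ε ≤ dist x y}, (b x - b y) * K x y * f y|

/-- The maximal truncated singular integral `T* f (x)`. -/
def truncT {n : ℕ} (K : Rn n → Rn n → ℝ) (f : Rn n → ℝ) (x : Rn n) : ℝ≥0∞ :=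
  ⨆ (ε : ℝ) (_ : 0 < ε),
    ENNReal.ofReal |∫ y in {y : Rn n | ε ≤ dist x y}, K x y * f y|

/-- Weighted `L^p` "norm" of an `ℝ≥0∞`-valued function. -/
def wLpNorm {n : ℕ} (p : ℝ) (μ : Measure (Rn n)) (g : Rn n → ℝ≥0∞) : ℝ≥0∞ :=
  (∫⁻ x, g x ^ p ∂μ) ^ (1 / p)

/-- `‖∇b‖_∞`. -/
def gradSup {n : ℕ} (b : Rn n → ℝ) : ℝ := ⨆ x : Rn n, ‖fderiv ℝ b x‖

/-- The maximal operator `M_b`. -/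
def Mb {n : ℕ} (b f : Rn n → ℝ) (x : Rn n) : ℝ≥0∞ :=
  ⨆ (r : ℝ) (_ : 0 < r),
    (ENNReal.ofReal (r ^ n))⁻¹ * ∫⁻ y in ball x r, ENNReal.ofReal (|b x - b y| * |f y|)

section P1
variable {n : ℕ}

def dy (k : ℤ) (x : Rn n) : Set (Rn n) := {y | ∀ i, ⌊(2:ℝ) ^ k * y i⌋ = ⌊(2:ℝ) ^ k * x i⌋}

def ctr (k : ℤ) (x : Rn n) : Rn n := WithLp.toLp 2 (fun i => (2:ℝ) ^ (-k) * ⌊(2:ℝ) ^ k * x i⌋)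

def rad (n : ℕ) (k : ℤ) : ℝ := √n * (2:ℝ) ^ (-k)

def BB (k : ℤ) (x : Rn n) : Set (Rn n) := ball (ctr k x) (4 * rad n k)

lemma rad_pos [NeZero n] (k : ℤ) : 0 < rad n k := by
  have : (0:ℝ) < n := by exact_mod_cast Nat.pos_of_ne_zero (NeZero.ne n)
  unfold rad; positivity

lemma rad_anti {k l : ℤ} (h : k < l) : 2 * rad n l ≤ rad n k := by
  unfold rad
  have : (2:ℝ) * 2 ^ (-l) ≤ 2 ^ (-k) := by
    rw [← zpow_one_add₀ (by norm_num)]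
    exact zpow_le_zpow_right₀ (by norm_num) (by omega)
  nlinarith [Real.sqrt_nonneg (n:ℝ)]

lemma mem_dy (k : ℤ) (x : Rn n) : x ∈ dy k x := fun _ => rfl

lemma dy_eq {k : ℤ} {x y : Rn n} (h : y ∈ dy k x) : dy k y = dy k x := by
  ext z; simp only [dy, mem_ofPred_eq] at *; simp [h]

lemma ctr_eq {k : ℤ} {x y : Rn n} (h : y ∈ dy k x) : ctr k y = ctr k x := by
  unfold ctr; congr; ext i; rw [h i]

lemma BB_eq {k : ℤ} {x y : Rn n} (h : y ∈ dy k x) : BB k y = BB k x := by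
  unfold BB; rw [ctr_eq h]

lemma dy_succ (k : ℤ) (x : Rn n) : dy (k + 1) x ⊆ dy k x := by
  have key : ∀ t : ℝ, ⌊(2:ℝ) ^ k * t⌋ = ⌊(2:ℝ) ^ (k+1) * t⌋ / 2 := by
    intro t
    have := Int.floor_div_natCast ((2:ℝ) ^ (k+1) * t) 2
    rw [zpow_add_one₀ (by norm_num)] at *
    push_cast at this
    rw [← this]; congr 1; ring
  intro y hy i
  rw [key, key, hy i]

lemma dy_anti {k l : ℤ} (h : k ≤ l) (x : Rn n) : dy l x ⊆ dy k x := by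
  obtain ⟨m, rfl⟩ := Int.le.dest h
  clear h
  induction m with
  | zero => simp
  | succ m ih =>
    refine Subset.trans ?_ ih
    have := dy_succ (k + m) x
    push_cast
    rwa [← add_assoc]

lemma dy_preimage (k : ℤ) (x : Rn n) : dy k x = (WithLp.ofLp : Rn n → Fin n → ℝ) ⁻¹'
    (univ.pi fun i => Ico ((2:ℝ) ^ (-k) * ⌊(2:ℝ) ^ k * x i⌋)
      ((2:ℝ) ^ (-k) * ⌊(2:ℝ) ^ k * x i⌋ + (2:ℝ) ^ (-k))) := by
  ext y
  simp only [dy, mem_ofPred_eq, mem_preimage, mem_univ_pi, mem_Ico]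
  refine forall_congr' fun i => ?_
  rw [Int.floor_eq_iff]
  have h2 : (0:ℝ) < 2 ^ k := by positivity
  rw [zpow_neg, ← div_eq_inv_mul, div_le_iff₀' h2,
    show (⌊(2:ℝ)^k * x i⌋:ℝ) / 2 ^ k + (2 ^ k)⁻¹ = ((⌊(2:ℝ)^k * x i⌋:ℝ) + 1) / 2 ^ k by ring,
    lt_div_iff₀' h2]

lemma dy_meas (k : ℤ) (x : Rn n) : MeasurableSet (dy k x) := by
  rw [dy_preimage]
  exact (PiLp.volume_preserving_ofLp (Fin n)).measurable
    (MeasurableSet.univ_pi fun i => measurableSet_Ico)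

lemma vol_dy (k : ℤ) (x : Rn n) : volume (dy k x) = ENNReal.ofReal ((2:ℝ) ^ (-k)) ^ n := by
  rw [dy_preimage, (PiLp.volume_preserving_ofLp (Fin n)).measure_preimage
    (MeasurableSet.univ_pi fun i => measurableSet_Ico).nullMeasurableSet, Real.volume_pi_Ico]
  simp

lemma vol_dy_pos (k : ℤ) (x : Rn n) : volume (dy k x) ≠ 0 := by
  rw [vol_dy]; have : (0:ℝ) < 2 ^ (-k) := by positivity
  exact pow_ne_zero _ (by rwa [ne_eq, ENNReal.ofReal_eq_zero, not_le])

lemma vol_dy_top (k : ℤ) (x : Rn n) : volume (dy k x) ≠ ⊤ := by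
  rw [vol_dy]; finiteness

lemma vol_dy_succ (k : ℤ) (x : Rn n) : volume (dy k x) = 2 ^ n * volume (dy (k+1) x) := by
  rw [vol_dy, vol_dy, ← mul_pow, ← ENNReal.ofReal_ofNat, ← ENNReal.ofReal_mul (by norm_num),
    ← zpow_one_add₀ (by norm_num)]
  congr 3; omega

lemma dist_ctr (k : ℤ) (x : Rn n) : dist x (ctr k x) ≤ rad n k := by
  rw [EuclideanSpace.dist_eq, rad]
  refine (Real.sqrt_le_sqrt (Finset.sum_le_sum (g := fun _ => ((2:ℝ) ^ (-k)) ^ 2) fun i _ => ?_)).trans ?_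
  · have : x ∈ dy k x := mem_dy k x
    rw [dy_preimage] at this
    have h := this i (mem_univ _)
    simp only [ctr, Real.dist_eq, sq_abs] 
    have h1 := h.1; have h2 := h.2
    apply pow_le_pow_left₀ <;> linarith
  · simp only [Finset.sum_const, Finset.card_univ, Fintype.card_fin, nsmul_eq_mul]
    rw [Real.sqrt_mul (by positivity), Real.sqrt_sq (by positivity)]

lemma dist_dy {k : ℤ} {x y : Rn n} (h : y ∈ dy k x) : dist y x ≤ rad n k := by
  rw [EuclideanSpace.dist_eq, rad]
  refine (Real.sqrt_le_sqrt (Finset.sum_le_sum (g := fun _ => ((2:ℝ) ^ (-k)) ^ 2) fun i _ => ?_)).trans ?_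
  · have hx : x ∈ dy k x := mem_dy k x
    rw [dy_preimage] at h hx
    have h := h i (mem_univ _); have hx := hx i (mem_univ _)
    simp only [Real.dist_eq] 
    have h1 := h.1; have h2 := h.2; have h3 := hx.1; have h4 := hx.2
    apply pow_le_pow_left₀ (abs_nonneg _)
    rw [abs_le]; constructor <;> linarith
  · simp only [Finset.sum_const, Finset.card_univ, Fintype.card_fin, nsmul_eq_mul]
    rw [Real.sqrt_mul (by positivity), Real.sqrt_sq (by positivity)]

lemma dist_dy_ctr {k : ℤ} {x y : Rn n} (h : y ∈ dy k x) : dist y (ctr k x) ≤ rad n k := by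
  rw [← ctr_eq h]; exact dist_ctr k y

lemma dy_sub_BB [NeZero n] (k : ℤ) (x : Rn n) : dy k x ⊆ BB k x := fun y hy => by
  rw [BB, mem_ball]; linarith [dist_dy_ctr hy, rad_pos (n := n) k]

lemma BB_sub [NeZero n] {k l : ℤ} (h : k < l) {x y : Rn n} (hy : y ∈ dy k x) : BB l y ⊆ BB k x := by
  intro z hz
  rw [BB, mem_ball] at *
  have h1 := dist_dy_ctr hy
  have h2 := dist_ctr l y
  have h3 := rad_anti (n := n) h
  have := dist_triangle4 z (ctr l y) y (ctr k x)
  rw [dist_comm y (ctr l y)] at *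
  linarith [rad_pos (n := n) k]

lemma vol_ball (c : Rn n) {r : ℝ} (hr : 0 < r) :
    volume (ball c r) = ENNReal.ofReal r ^ n * volume (ball (0 : Rn n) 1) := by
  rw [Measure.addHaar_ball_of_pos _ _ hr]; simp [ENNReal.ofReal_pow hr.le]

def cB (n : ℕ) : ℝ≥0∞ := ENNReal.ofReal (4 * √n) ^ n * volume (ball (0 : Rn n) 1)

lemma cB_top : cB n ≠ ⊤ := by unfold cB; finiteness

lemma vol_BB [NeZero n] (k : ℤ) (x : Rn n) : volume (BB k x) = cB n * volume (dy k x) := by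
  rw [BB, vol_ball _ (by linarith [rad_pos (n := n) k]), vol_dy, cB, rad, ← mul_assoc,
    ENNReal.ofReal_mul (by positivity)]
  ring

lemma dy_countable : {R : Set (Rn n) | ∃ k x, R = dy k x}.Countable := by
  have : {R : Set (Rn n) | ∃ k x, R = dy k x} ⊆ Set.range
      (fun q : ℤ × (Fin n → ℤ) => {y : Rn n | ∀ i, ⌊(2:ℝ) ^ q.1 * y i⌋ = q.2 i}) := by
    rintro R ⟨k, x, rfl⟩
    exact ⟨(k, fun i => ⌊(2:ℝ) ^ k * x i⌋), rfl⟩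
  exact (countable_range _).mono this

/-- dyadic Lebesgue differentiation -/
lemma dy_diff [NeZero n] (g : Rn n → ℝ≥0∞) (hg : Measurable g) (hfin : ∫⁻ x, g x ≠ ⊤) (l : ℝ≥0∞)
    (k0 : ℤ) : ∀ᵐ x : Rn n, (∀ k, k0 < k → ∫⁻ y in dy k x, g y ≤ l * volume (dy k x)) → g x ≤ l := by
  have hgt : ∀ᵐ x, g x < ⊤ := ae_lt_top hg hfin
  have hint : Integrable (fun x => (g x).toReal) := integrable_toReal_of_lintegral_ne_top hg.aemeasurable hfin
  filter_upwards [hgt, IsUnifLocDoublingMeasure.ae_tendsto_average_norm_sub volume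
    hint.locallyIntegrable 1] with x hx hlim h
  rcases eq_or_ne l ⊤ with rfl | hl
  · exact le_top
  have hr : Tendsto (fun m : ℕ => 4 * rad n (m:ℤ)) atTop (𝓝[>] 0) := by
    rw [tendsto_nhdsWithin_iff]
    refine ⟨?_, Eventually.of_forall fun m => ?_⟩
    · have : Tendsto (fun m : ℕ => 4 * (√n * ((1/2:ℝ) ^ m))) atTop (𝓝 (4 * (√n * 0))) :=
        ((tendsto_pow_atTop_nhds_zero_of_lt_one (by norm_num) (by norm_num)).const_mul _).const_mul _
      simpa [rad] using this
    · have := rad_pos (n := n) (m:ℤ); simp [this]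
  have h2 := hlim (fun m : ℕ => x) (fun m : ℕ => 4 * rad n (m:ℤ)) hr
    (Eventually.of_forall fun m => by
      have := (rad_pos (n := n) (m:ℤ)).le
      simp [this])
  have hle : ∀ᶠ m : ℕ in atTop, (g x).toReal ≤ (cB n).toReal *
      (⨍ y in closedBall x (4 * rad n (m:ℤ)), ‖(g y).toReal - (g x).toReal‖) + l.toReal := by
    filter_upwards [eventually_gt_atTop k0.toNat] with m hm
    have hk := h (m:ℤ) (by omega)
    set Q := dy (m:ℤ) x
    set B := closedBall x (4 * rad n (m:ℤ))
    have hQB : Q ⊆ B := fun y hy => by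
      have := dist_dy hy; have := rad_pos (n := n) (m:ℤ); simp only [B, mem_closedBall]; linarith
    have hvB : volume.real B = (cB n).toReal * volume.real Q := by
      rw [measureReal_def, Measure.addHaar_closedBall _ _ (by linarith [rad_pos (n := n) (m:ℤ)]),
        ← Measure.addHaar_ball_of_pos _ (ctr (m:ℤ) x) (by linarith [rad_pos (n := n) (m:ℤ)])]
      change (volume (BB (m:ℤ) x)).toReal = _
      rw [vol_BB, ENNReal.toReal_mul]; rfl
    have hQp : 0 < volume.real Q := ENNReal.toReal_pos (vol_dy_pos _ _) (vol_dy_top _ _)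
    have hBp : 0 < volume.real B := hQp.trans_le (measureReal_mono hQB (by
      simp only [B]; exact measure_closedBall_lt_top.ne))
    have hiB : IntegrableOn (fun y => ‖(g y).toReal - (g x).toReal‖) B := by
      refine (hint.integrableOn.sub ?_).norm
      exact (integrableOn_const_iff).2 (Or.inr measure_closedBall_lt_top)
    have e1 : ∫ y in Q, (g y).toReal ≤ l.toReal * volume.real Q := by
      rw [integral_toReal hg.aemeasurable (ae_restrict_of_ae hgt), measureReal_def, ← ENNReal.toReal_mul]
      exact ENNReal.toReal_mono (ENNReal.mul_ne_top hl (vol_dy_top _ _)) hk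
    have e2 : (g x).toReal * volume.real Q ≤
        ∫ y in Q, (‖(g y).toReal - (g x).toReal‖ + (g y).toReal) := by
      have : (g x).toReal * volume.real Q = ∫ y in Q, (g x).toReal := by
        simp [mul_comm]
      rw [this]
      refine setIntegral_mono ?_ ((hiB.mono_set hQB).add hint.integrableOn) fun y => ?_
      · exact (integrableOn_const_iff).2 (Or.inr (vol_dy_top _ _).lt_top)
      · simp only [Real.norm_eq_abs]; linarith [neg_abs_le ((g y).toReal - (g x).toReal)]
    rw [integral_add (hiB.mono_set hQB) hint.integrableOn] at e2
    have e3 : ∫ y in Q, ‖(g y).toReal - (g x).toReal‖ ≤ ∫ y in B, ‖(g y).toReal - (g x).toReal‖ :=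
      setIntegral_mono_set hiB (Eventually.of_forall fun _ => norm_nonneg _) hQB.eventuallyLE
    rw [setAverage_eq, smul_eq_mul]
    have e4 : (cB n).toReal * ((volume.real B)⁻¹ * ∫ y in B, ‖(g y).toReal - (g x).toReal‖)
       = (∫ y in B, ‖(g y).toReal - (g x).toReal‖) / volume.real Q := by
      rw [hvB]
      have : (cB n).toReal ≠ 0 := fun h0 => by rw [hvB, h0] at hBp; simp at hBp
      field_simp
    rw [e4, ← sub_le_iff_le_add, le_div_iff₀ hQp]
    linarith
  have h3 := ge_of_tendsto ((h2.const_mul (cB n).toReal).add_const l.toReal) hle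
  simp only [mul_zero, zero_add] at h3
  exact (ENNReal.toReal_le_toReal hx.ne hl).1 h3

lemma lintegral_sUnion' {α : Type*} [MeasurableSpace α] {μ : Measure α} {S : Set (Set α)}
    (hc : S.Countable) (hm : ∀ P ∈ S, MeasurableSet P) (hd : S.PairwiseDisjoint id) (f : α → ℝ≥0∞) :
    ∫⁻ x in ⋃₀ S, f x ∂μ = ∑' P : S, ∫⁻ x in (P : Set α), f x ∂μ := by
  rw [sUnion_eq_biUnion]; exact lintegral_biUnion hc hm hd f

/-- stopping cubes -/
lemma stopping [NeZero n] (D : Set (Rn n)) (k0 : ℤ) (g : Rn n → ℝ≥0∞) (hg : Measurable g)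
    (hfin : ∫⁻ x, g x ≠ ⊤) (l : ℝ≥0∞)
    (h0 : ∀ x ∈ D, ∫⁻ y in dy k0 x, g y ≤ l * volume (dy k0 x)) :
    ∃ S : Set (Set (Rn n)), S.Countable ∧ S.PairwiseDisjoint id ∧
      (∀ P ∈ S, ∃ k x, k0 < k ∧ x ∈ D ∧ P = dy k x ∧ ∫⁻ y in P, g y ≤ 2 ^ n * l * volume P) ∧
      (∀ P ∈ S, MeasurableSet P) ∧
      l * volume (⋃₀ S) ≤ ∫⁻ y in ⋃₀ S, g y ∧
      (∀ᵐ x, x ∈ D → x ∉ ⋃₀ S → g x ≤ l) := by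
  let ov : ℤ → Rn n → Prop := fun k x => l * volume (dy k x) < ∫⁻ y in dy k x, g y
  let S : Set (Set (Rn n)) := {P | ∃ k x, k0 < k ∧ x ∈ D ∧ P = dy k x ∧ ov k x ∧
    ∀ j, k0 < j → j < k → ¬ ov j x}
  have hSc : S.Countable := dy_countable.mono (by rintro P ⟨k, x, -, -, h, -⟩; exact ⟨k, x, h⟩)
  have ovc : ∀ {k x y}, y ∈ dy k x → (ov k y ↔ ov k x) := by
    intro k x y h; simp only [ov, dy_eq h]
  have hSm : ∀ P ∈ S, MeasurableSet P := by
    rintro P ⟨k, x, -, -, rfl, -⟩; exact dy_meas _ _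
  have hSd : S.PairwiseDisjoint id := by
    have aux : ∀ k x k' x' z, k0 < k → ov k x → (∀ j, k0 < j → j < k' → ¬ ov j x') →
        z ∈ dy k x → z ∈ dy k' x' → ¬ k < k' := by
      intro k x k' x' z hk ho hn' hz hz' hlt
      refine hn' k hk hlt ?_
      rw [← ovc (dy_anti hlt.le _ hz'), ovc hz]; exact ho
    rintro P ⟨k, x, hk, -, rfl, ho, hm⟩ P' ⟨k', x', hk', -, rfl, ho', hm'⟩ hne
    by_contra hcon
    obtain ⟨z, hz, hz'⟩ := Set.not_disjoint_iff.1 hcon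
    have : k = k' := le_antisymm (not_lt.1 (aux _ _ _ _ z hk' ho' hm hz' hz))
      (not_lt.1 (aux _ _ _ _ z hk ho hm' hz hz'))
    subst this
    exact hne (by rw [← dy_eq hz, ← dy_eq hz'])
  refine ⟨S, hSc, hSd, ?_, hSm, ?_, ?_⟩
  · rintro P ⟨k, x, hk, hx, rfl, ho, hm⟩
    refine ⟨k, x, hk, hx, rfl, ?_⟩
    have hpar : ∫⁻ y in dy (k-1) x, g y ≤ l * volume (dy (k-1) x) := by
      rcases (show k - 1 = k0 ∨ k0 < k - 1 by omega) with h | h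
      · rw [h]; exact h0 x hx
      · exact not_lt.1 (hm _ h (by omega))
    have hs : dy k x ⊆ dy (k-1) x := dy_anti (by omega) _
    refine (lintegral_mono_set hs).trans (hpar.trans ?_)
    rw [vol_dy_succ (k-1) x, sub_add_cancel]
    exact le_of_eq (by ring)
  · rw [measure_sUnion hSc (fun a ha b hb => hSd ha hb) hSm, lintegral_sUnion' hSc hSm hSd,
      ← ENNReal.tsum_mul_left]
    refine ENNReal.tsum_le_tsum ?_
    rintro ⟨P, k, x, -, -, rfl, ho, -⟩
    exact ho.le
  · filter_upwards [dy_diff g hg hfin l k0] with x hx hxD hxS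
    refine hx fun k hk => ?_
    by_contra hcon
    have hex : ∃ m : ℕ, ov (k0 + 1 + m) x := ⟨(k - k0 - 1).toNat, by
      rw [show k0 + 1 + ((k - k0 - 1).toNat : ℤ) = k by omega]; exact not_le.1 hcon⟩
    classical
    refine hxS ⟨dy (k0 + 1 + Nat.find hex) x, ⟨k0 + 1 + Nat.find hex, x, by omega, hxD, rfl,
      Nat.find_spec hex, ?_⟩, mem_dy _ _⟩
    intro j hj hjk ho
    refine Nat.find_min hex (m := (j - k0 - 1).toNat) (by omega) ?_
    rw [show k0 + 1 + ((j - k0 - 1).toNat : ℤ) = j by omega]; exact ho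

end P1

section P2
open scoped NNReal
variable {n : ℕ}

def MM (μ : Measure (Rn n)) (g : Rn n → ℝ≥0∞) (x : Rn n) : ℝ≥0∞ :=
  ⨆ (c : Rn n) (r : ℝ) (_ : x ∈ ball c r), (μ (ball c r))⁻¹ * ∫⁻ y in ball c r, g y ∂μ

def AI (μ : Measure (Rn n)) : Prop := (∀ c r, μ (ball c r) ≠ ⊤) ∧ ∀ L : ℝ≥0, ∃ C : ℝ≥0, ∀ c r, 0 < r →
  ∀ E ⊆ ball c r, MeasurableSet E → volume (ball c r) ≤ L * volume E → μ (ball c r) ≤ C * μ E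

lemma AI_vol : AI (volume : Measure (Rn n)) :=
  ⟨fun _ _ => measure_ball_lt_top.ne, fun L => ⟨L, fun _ _ _ _ _ _ h => h⟩⟩

lemma AI.dbl {μ : Measure (Rn n)} (h : AI μ) (t : ℝ≥0) (ht : 1 ≤ t) :
    ∃ C : ℝ≥0, ∀ c r, 0 < r → μ (ball c (t * r)) ≤ C * μ (ball c r) := by
  obtain ⟨C, hC⟩ := h.2 (t ^ n)
  refine ⟨C, fun c r hr => hC c _ (by positivity) _ (ball_subset_ball ?_) measurableSet_ball ?_⟩
  · have : (1:ℝ) ≤ t := ht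
    nlinarith
  · rw [vol_ball _ (by positivity), vol_ball _ hr, ENNReal.ofReal_mul (by positivity)]
    simp only [ENNReal.ofReal_coe_nnreal, ENNReal.coe_pow]
    exact le_of_eq (by ring)

lemma le_MM {μ : Measure (Rn n)} (g : Rn n → ℝ≥0∞) {x c : Rn n} {r : ℝ} (h : x ∈ ball c r) :
    (μ (ball c r))⁻¹ * ∫⁻ y in ball c r, g y ∂μ ≤ MM μ g x :=
  le_iSup₂_of_le c r (le_iSup_of_le h le_rfl)

lemma setI_le_MM {μ : Measure (Rn n)} (hμ : ∀ c r, μ (ball c r) ≠ ⊤) (g : Rn n → ℝ≥0∞)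
    {x c : Rn n} {r : ℝ} (h : x ∈ ball c r) :
    ∫⁻ y in ball c r, g y ∂μ ≤ μ (ball c r) * MM μ g x := by
  rcases eq_or_ne (μ (ball c r)) 0 with h0 | h0
  · rw [Measure.restrict_eq_zero.2 h0]; simp
  · refine le_trans ?_ (mul_le_mul_right (le_MM g h) _)
    rw [← mul_assoc, ENNReal.mul_inv_cancel h0 (hμ _ _), one_mul]

lemma MM_meas (μ : Measure (Rn n)) (g : Rn n → ℝ≥0∞) : Measurable (MM μ g) := by
  refine measurable_of_Ioi fun l => IsOpen.measurableSet ?_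
  rw [isOpen_iff_mem_nhds]
  intro x hx
  simp only [mem_preimage, mem_Ioi, MM, lt_iSup_iff] at hx
  obtain ⟨c, r, hxc, hlt⟩ := hx
  filter_upwards [isOpen_ball.mem_nhds hxc] with y hy
  exact hlt.trans_le (le_MM g hy)

lemma MM_weak {μ : Measure (Rn n)} (h : AI μ) : ∃ C : ℝ≥0, ∀ (g : Rn n → ℝ≥0∞) (l : ℝ≥0∞),
    l * μ {x | l < MM μ g x} ≤ C * ∫⁻ y, g y ∂μ := by
  obtain ⟨C, hC⟩ := h.dbl 5 (by norm_num)
  refine ⟨C, fun g l => ?_⟩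
  let av : Rn n × ℝ → ℝ≥0∞ := fun q => (μ (ball q.1 q.2))⁻¹ * ∫⁻ y in ball q.1 q.2, g y ∂μ
  let t : ℕ → Set (Rn n × ℝ) := fun R => {q | 0 < q.2 ∧ q.2 ≤ R ∧ l < av q}
  have key : ∀ R, l * μ (⋃ q ∈ t R, ball q.1 q.2) ≤ C * ∫⁻ y, g y ∂μ := by
    intro R
    obtain ⟨u, hut, hud, huc⟩ := Vitali.exists_disjoint_subfamily_covering_enlargement_ball (t R)
      (fun q => q.1) (fun q => q.2) R (fun q hq => hq.2.1) 5 (by norm_num)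
    have hcount : u.Countable := hud.countable_of_isOpen (fun _ _ => isOpen_ball)
      (fun q hq => nonempty_ball.2 (hut hq).1)
    have h1 : (⋃ q ∈ t R, ball q.1 q.2) ⊆ ⋃ q ∈ u, ball q.1 (5 * q.2) := by
      intro x hx
      simp only [mem_iUnion] at hx ⊢
      obtain ⟨q, hq, hx⟩ := hx
      obtain ⟨b, hb, hs⟩ := huc q hq
      exact ⟨b, hb, hs hx⟩
    calc l * μ (⋃ q ∈ t R, ball q.1 q.2) ≤ l * ∑' q : u, μ (ball q.1.1 (5 * q.1.2)) := by
          gcongr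
          exact (measure_mono h1).trans (measure_biUnion_le _ hcount _)
      _ ≤ ∑' q : u, C * ∫⁻ y in ball q.1.1 q.1.2, g y ∂μ := by
          rw [← ENNReal.tsum_mul_left]
          refine ENNReal.tsum_le_tsum fun q => ?_
          have hq := hut q.2
          have h2 := hC q.1.1 q.1.2 hq.1
          have h3 : l * μ (ball q.1.1 q.1.2) ≤ ∫⁻ y in ball q.1.1 q.1.2, g y ∂μ := by
            rcases eq_or_ne (μ (ball q.1.1 q.1.2)) 0 with h0 | h0
            · simp [h0]
            · have := mul_le_mul_left hq.2.2.le (μ (ball q.1.1 q.1.2))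
              refine this.trans (le_of_eq ?_)
              simp only [av]
              rw [mul_right_comm, ENNReal.inv_mul_cancel h0 (h.1 _ _), one_mul]
          calc l * μ (ball q.1.1 (5 * q.1.2)) ≤ l * (C * μ (ball q.1.1 q.1.2)) := by
                gcongr; simpa using h2
            _ = C * (l * μ (ball q.1.1 q.1.2)) := by ring
            _ ≤ _ := by gcongr
      _ = C * ∫⁻ y in ⋃ q ∈ u, ball q.1 q.2, g y ∂μ := by
          rw [ENNReal.tsum_mul_left, lintegral_biUnion hcount (fun _ _ => measurableSet_ball) hud]
      _ ≤ _ := by exact mul_le_mul_right (setLIntegral_le_lintegral _ _) _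
  have hset : {x | l < MM μ g x} ⊆ ⋃ R, ⋃ q ∈ t R, ball q.1 q.2 := by
    intro x hx
    simp only [mem_ofPred_eq, MM, lt_iSup_iff] at hx
    obtain ⟨c, r, hxc, hlt⟩ := hx
    simp only [mem_iUnion]
    exact ⟨⌈r⌉₊, (c, r), ⟨pos_of_mem_ball hxc, Nat.le_ceil r, hlt⟩, hxc⟩
  have hmono : Monotone fun R => ⋃ q ∈ t R, ball q.1 q.2 := by
    intro R R' hR
    refine biUnion_subset_biUnion_left fun q hq => ⟨hq.1, hq.2.1.trans (by exact_mod_cast hR), hq.2.2⟩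
  calc l * μ {x | l < MM μ g x} ≤ l * μ (⋃ R, ⋃ q ∈ t R, ball q.1 q.2) := by gcongr
    _ ≤ _ := by
      rw [hmono.measure_iUnion, ENNReal.mul_iSup]
      exact iSup_le key

lemma MM_mono {μ : Measure (Rn n)} {f g : Rn n → ℝ≥0∞} (h : ∀ x, f x ≤ g x) (x : Rn n) :
    MM μ f x ≤ MM μ g x := by
  refine iSup_mono fun c => iSup_mono fun r => iSup_mono fun _ => ?_
  gcongr; exact h _

lemma layer (s : ℝ) (hs : 0 < s) (a : ℝ≥0∞) :
    ENNReal.ofReal s * ∫⁻ t in Ioi (0:ℝ), {t : ℝ | ENNReal.ofReal t < a}.indicator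
      (fun t => ENNReal.ofReal (t ^ (s-1))) t = a ^ s := by
  have fin : ∀ a : ℝ≥0, ENNReal.ofReal s * ∫⁻ t in Ioi (0:ℝ), {t : ℝ | ENNReal.ofReal t < a}.indicator
      (fun t => ENNReal.ofReal (t ^ (s-1))) t = (a:ℝ≥0∞) ^ s := by
    intro a
    have hm : MeasurableSet {t : ℝ | ENNReal.ofReal t < a} :=
      measurableSet_lt ENNReal.measurable_ofReal measurable_const
    rw [lintegral_indicator hm, Measure.restrict_restrict hm]
    have : {t : ℝ | ENNReal.ofReal t < a} ∩ Ioi 0 = Ioo 0 (a:ℝ) := by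
      ext t; simp only [mem_inter_iff, mem_ofPred_eq, mem_Ioi, mem_Ioo]
      constructor
      · rintro ⟨h1, h2⟩
        refine ⟨h2, ?_⟩
        have := (ENNReal.ofReal_lt_iff_lt_toReal h2.le ENNReal.coe_ne_top).1 h1
        simpa using this
      · rintro ⟨h1, h2⟩
        exact ⟨(ENNReal.ofReal_lt_iff_lt_toReal h1.le ENNReal.coe_ne_top).2 (by simpa using h2), h1⟩
    rw [this, setLIntegral_congr Ioo_ae_eq_Ioc, ← ofReal_integral_eq_lintegral_ofReal]
    · rw [← intervalIntegral.integral_of_le a.coe_nonneg, integral_rpow (Or.inl (by linarith))]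
      rw [← ENNReal.ofReal_mul hs.le, sub_add_cancel, Real.zero_rpow hs.ne', sub_zero, mul_div_cancel₀ _ hs.ne',
        ← ENNReal.ofReal_rpow_of_nonneg a.coe_nonneg hs.le]
      simp
    · exact (intervalIntegral.intervalIntegrable_rpow' (by linarith)).1
    · filter_upwards [ae_restrict_mem measurableSet_Ioc] with t ht
      exact Real.rpow_nonneg ht.1.le _
  induction a with
  | coe a => exact fin a
  | top =>
    rw [ENNReal.top_rpow_of_pos hs]
    rw [eq_top_iff]
    refine le_of_forall_lt fun c hc => ?_
    obtain ⟨N, hN⟩ := ENNReal.exists_nat_gt (ENNReal.rpow_lt_top_of_nonneg (y := s⁻¹) (by positivity) hc.ne).ne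
    have h1 : c < ((N:ℝ≥0):ℝ≥0∞) ^ s := by
      have := ENNReal.rpow_lt_rpow hN hs
      rw [← ENNReal.rpow_mul, inv_mul_cancel₀ hs.ne', ENNReal.rpow_one] at this
      simpa using this
    refine h1.trans_le ?_
    rw [← fin N]
    gcongr
    exact le_top

lemma MM_strong {μ : Measure (Rn n)} [SFinite μ] (h : AI μ) (q : ℝ) (hq : 1 < q) :
    ∃ C : ℝ≥0, ∀ g : Rn n → ℝ≥0∞, Measurable g → ∫⁻ x, MM μ g x ^ q ∂μ ≤ C * ∫⁻ x, g x ^ q ∂μ := by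
  obtain ⟨C, hC⟩ := MM_weak h
  refine ⟨2 * C * q.toNNReal * (q-1).toNNReal⁻¹ * 2 ^ (q-1), fun g hg => ?_⟩
  have hq0 : 0 < q := by linarith
  have hF := MM_meas μ g
  have sw : ∀ (F : Rn n → ℝ≥0∞) (hF : Measurable F) (w : Rn n → ℝ≥0∞) (hw : Measurable w) (s : ℝ),
      ∫⁻ x, w x * (∫⁻ t in Ioi (0:ℝ), {t : ℝ | ENNReal.ofReal t < F x}.indicator
      (fun t => ENNReal.ofReal (t ^ (s-1))) t) ∂μ = ∫⁻ t in Ioi (0:ℝ), ENNReal.ofReal (t ^ (s-1)) *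
        ∫⁻ x in {x | ENNReal.ofReal t < F x}, w x ∂μ := by
    intro F hF w hw s
    have hm : MeasurableSet {z : Rn n × ℝ | ENNReal.ofReal z.2 < F z.1} :=
      measurableSet_lt (ENNReal.measurable_ofReal.comp measurable_snd) (hF.comp measurable_fst)
    have hm2 : Measurable fun z : Rn n × ℝ => w z.1 * {z : Rn n × ℝ | ENNReal.ofReal z.2 < F z.1}.indicator
        (fun z => ENNReal.ofReal (z.2 ^ (s-1))) z :=
      (hw.comp measurable_fst).mul (Measurable.indicator (by fun_prop) hm)
    have : ∀ x, w x * ∫⁻ t in Ioi (0:ℝ), {t : ℝ | ENNReal.ofReal t < F x}.indicator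
      (fun t => ENNReal.ofReal (t ^ (s-1))) t = ∫⁻ t in Ioi (0:ℝ), w x * {t : ℝ | ENNReal.ofReal t < F x}.indicator
      (fun t => ENNReal.ofReal (t ^ (s-1))) t := by
      intro x
      rw [lintegral_const_mul]
      exact Measurable.indicator (by fun_prop) (measurableSet_lt ENNReal.measurable_ofReal measurable_const)
    simp_rw [this]
    rw [lintegral_lintegral_swap (f := fun x t => w x * {t : ℝ | ENNReal.ofReal t < F x}.indicator
      (fun t => ENNReal.ofReal (t ^ (s-1))) t) hm2.aemeasurable]
    refine lintegral_congr fun t => ?_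
    rw [← lintegral_indicator (measurableSet_lt measurable_const hF), ← lintegral_const_mul]
    · refine lintegral_congr fun x => ?_
      by_cases hx : ENNReal.ofReal t < F x <;> simp [indicator, hx, mul_comm]
    · exact hw.indicator (measurableSet_lt measurable_const hF)
  have e1 : ∫⁻ x, MM μ g x ^ q ∂μ = ENNReal.ofReal q * ∫⁻ t in Ioi (0:ℝ), ENNReal.ofReal (t ^ (q-1)) *
        μ {x | ENNReal.ofReal t < MM μ g x} := by
    have := sw (MM μ g) hF (fun _ => 1) measurable_const q
    simp only [one_mul, lintegral_const, MeasurableSet.univ, Measure.restrict_apply, univ_inter] at this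
    rw [← this, ← lintegral_const_mul']
    · simp_rw [layer q hq0]
    · finiteness
  have e2 : ∀ t ∈ Ioi (0:ℝ), ENNReal.ofReal (t ^ (q-1)) * μ {x | ENNReal.ofReal t < MM μ g x} ≤
      2 * C * (ENNReal.ofReal (t ^ ((q - 1) -1)) * ∫⁻ x in {x | ENNReal.ofReal t < 2 * g x}, g x ∂μ) := by
    intro t ht
    have ht : 0 < t := ht
    set g1 := {x | ENNReal.ofReal t < 2 * g x}.indicator g
    have hms : MeasurableSet {x | ENNReal.ofReal t < 2 * g x} := measurableSet_lt measurable_const (hg.const_mul 2)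
    have hsub : {x | ENNReal.ofReal t < MM μ g x} ⊆ {x | ENNReal.ofReal (t/2) < MM μ g1 x} := by
      intro x hx
      simp only [mem_ofPred_eq] at *
      by_contra hcon
      refine absurd hx (not_lt.2 ?_)
      refine iSup_le fun c => iSup_le fun r => iSup_le fun hxc => ?_
      have hle : ∀ y, g y ≤ g1 y + ENNReal.ofReal (t/2) := by
        intro y
        by_cases hy : ENNReal.ofReal t < 2 * g y
        · simp [g1, indicator, hy]
        · simp only [g1, indicator, mem_ofPred_eq, hy, if_false, zero_add]
          have h2 : (2:ℝ≥0∞) * g y ≤ 2 * ENNReal.ofReal (t/2) := by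
            rw [← ENNReal.ofReal_ofNat, ← ENNReal.ofReal_mul (by norm_num),
              show 2 * (t/2) = t by ring]; simpa using hy
          exact (ENNReal.mul_le_mul_iff_right (by norm_num) (by norm_num)).1 h2
      calc (μ (ball c r))⁻¹ * ∫⁻ y in ball c r, g y ∂μ ≤ (μ (ball c r))⁻¹ * ∫⁻ y in ball c r, (g1 y + ENNReal.ofReal (t/2)) ∂μ := by
            gcongr; exact hle _
        _ = (μ (ball c r))⁻¹ * (∫⁻ y in ball c r, g1 y ∂μ) + ENNReal.ofReal (t/2) * ((μ (ball c r))⁻¹ * μ (ball c r)) := by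
            rw [lintegral_add_right _ measurable_const, mul_add]; simp; ring
        _ ≤ ENNReal.ofReal (t/2) + ENNReal.ofReal (t/2) * 1 := by
            gcongr
            · exact (le_MM g1 hxc).trans (not_lt.1 hcon)
            · exact ENNReal.inv_mul_le_one _
        _ = ENNReal.ofReal t := by rw [mul_one, ← ENNReal.ofReal_add (by positivity) (by positivity)]; ring_nf
    have hw := hC g1 (ENNReal.ofReal (t/2))
    rw [lintegral_indicator hms] at hw
    have ht2 : ENNReal.ofReal (t ^ (q-1)) = 2 * ENNReal.ofReal (t ^ ((q-1)-1)) * ENNReal.ofReal (t/2) := by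
      rw [← ENNReal.ofReal_ofNat, ← ENNReal.ofReal_mul (by norm_num), ← ENNReal.ofReal_mul (by positivity)]
      congr 1
      have := Real.rpow_sub_one ht.ne' (q-1)
      rw [this]; field_simp
    calc _ ≤ ENNReal.ofReal (t ^ (q-1)) * μ {x | ENNReal.ofReal (t/2) < MM μ g1 x} := by gcongr
      _ = 2 * ENNReal.ofReal (t ^ ((q-1)-1)) * (ENNReal.ofReal (t/2) * μ {x | ENNReal.ofReal (t/2) < MM μ g1 x}) := by
          rw [ht2]; ring
      _ ≤ 2 * ENNReal.ofReal (t ^ ((q-1)-1)) * (C * ∫⁻ x in {x | ENNReal.ofReal t < 2 * g x}, g x ∂μ) := by gcongr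
      _ = _ := by ring
  have e3 := sw (fun x => 2 * g x) (hg.const_mul 2) g hg (q-1)
  have e4 : ∫⁻ t in Ioi (0:ℝ), ENNReal.ofReal (t ^ (q-1)) * μ {x | ENNReal.ofReal t < MM μ g x} ≤
      2 * C * ∫⁻ t in Ioi (0:ℝ), (ENNReal.ofReal (t ^ ((q - 1) -1)) * ∫⁻ x in {x | ENNReal.ofReal t < 2 * g x}, g x ∂μ) := by
    rw [← lintegral_const_mul' _ _ (by finiteness)]
    exact setLIntegral_mono' measurableSet_Ioi e2
  rw [← e3] at e4
  have e5 : ∀ x, (g x * ∫⁻ t in Ioi (0:ℝ), {t : ℝ | ENNReal.ofReal t < 2 * g x}.indicator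
      (fun t => ENNReal.ofReal (t ^ ((q-1)-1))) t) = (ENNReal.ofReal (q-1))⁻¹ * 2 ^ (q-1) * g x ^ q := by
    intro x
    have := layer (q-1) (by linarith) (2 * g x)
    rw [ENNReal.mul_rpow_of_nonneg _ _ (by linarith)] at this
    have hne : ENNReal.ofReal (q-1) ≠ 0 := (ENNReal.ofReal_pos.2 (by linarith)).ne'
    have e : g x ^ q = g x ^ (q-1) * g x := by
      have := ENNReal.rpow_add_of_nonneg (x := g x) (q-1) 1 (by linarith) zero_le_one
      rwa [sub_add_cancel, ENNReal.rpow_one] at this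
    rw [e, show (ENNReal.ofReal (q-1))⁻¹ * 2 ^ (q-1) * (g x ^ (q-1) * g x) =
      (ENNReal.ofReal (q-1))⁻¹ * (2 ^ (q-1) * g x ^ (q-1)) * g x by ring, ← this, ← mul_assoc,
      ENNReal.inv_mul_cancel hne (by finiteness), one_mul, mul_comm]
  simp_rw [e5] at e4
  rw [lintegral_const_mul' _ _ (by
    refine ENNReal.mul_ne_top (ENNReal.inv_ne_top.2 (ENNReal.ofReal_pos.2 (by linarith)).ne') (by finiteness))] at e4
  rw [e1]
  refine (mul_le_mul_right e4 _).trans (le_of_eq ?_)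
  have hne : (q-1).toNNReal ≠ 0 := (Real.toNNReal_pos.2 (by linarith)).ne'
  push_cast [ENNReal.coe_inv hne, ENNReal.ofReal]
  rw [ENNReal.coe_rpow_of_ne_zero (by norm_num)]
  push_cast
  ring

end P2

section P3
open scoped NNReal
variable {n : ℕ}

structure GK (C₀ : ℝ) (Cr : ℝ≥0) (K : Rn n → Rn n → ℝ) : Prop where
  meas : Measurable (fun z : Rn n × Rn n => K z.1 z.2)
  c0 : 0 ≤ C₀
  size : ∀ x y, |K x y| ≤ C₀ / dist x y ^ n
  reg1 : ∀ (x z u : Rn n) (δ : ℝ) (g : Rn n → ℝ≥0∞), 0 < δ → dist x z ≤ δ → u ∈ ball x (4 * δ) →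
    AEMeasurable g → ∫⁻ y in {y | 2 * δ ≤ dist x y}, ENNReal.ofReal |K x y - K z y| * g y ≤
      Cr * MM volume g u
  reg2 : ∀ (x z : Rn n) (δ : ℝ), 0 < δ → dist x z ≤ δ →
    ∫⁻ y in {y | 2 * δ ≤ dist x y}, ENNReal.ofReal |K y x - K y z| ≤ Cr

lemma dini_sum {θ : ℝ → ℝ} (hθ : IsModulus θ) (hD : DiniCondition θ) :
    ∑' j : ℕ, ENNReal.ofReal (θ ((1/2:ℝ) ^ (j+1))) ≠ ⊤ := by
  obtain ⟨-, hm, -, -, hnn⟩ := hθ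
  have h1 : ∀ j : ℕ, ENNReal.ofReal (θ ((1/2:ℝ) ^ (j+1))) ≤
      2 * ∫⁻ t in Ioc ((1/2:ℝ)^(j+1)) ((1/2)^j), ENNReal.ofReal (θ t / t) := by
    intro j
    set a : ℝ := (1/2)^(j+1) with ha
    have ha0 : 0 < a := by positivity
    have haj : (1/2:ℝ)^j = 2 * a := by rw [ha, pow_succ]; ring
    have hj1 : 2 * a ≤ 1 := by rw [← haj]; exact pow_le_one₀ (by norm_num) (by norm_num)
    have ht : 0 ≤ θ a := hnn a ⟨ha0.le, by linarith⟩
    rw [haj]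
    calc ENNReal.ofReal (θ a) = 2 * ∫⁻ t in Ioc a (2*a), ENNReal.ofReal (θ a / (2 * a)) := by
          rw [lintegral_const, Measure.restrict_apply_univ, Real.volume_Ioc, ← ENNReal.ofReal_mul (by positivity),
            ← ENNReal.ofReal_ofNat, ← ENNReal.ofReal_mul (by norm_num)]
          congr 1; field_simp; ring
      _ ≤ _ := by
          gcongr 2 * ?_
          refine setLIntegral_mono' measurableSet_Ioc fun t ht' => ENNReal.ofReal_le_ofReal ?_
          have : θ a ≤ θ t := hm ⟨ha0.le, by linarith⟩ ⟨by linarith [ht'.1], by linarith [ht'.2]⟩ ht'.1.le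
          have h0 : 0 < t := ha0.trans ht'.1
          exact div_le_div₀ (ht.trans this) this h0 ht'.2
  have hdisj : Pairwise (Function.onFun Disjoint fun j : ℕ => Ioc ((1/2:ℝ)^(j+1)) ((1/2)^j)) := by
    have key : ∀ i j : ℕ, i < j → Disjoint (Ioc ((1/2:ℝ)^(i+1)) ((1/2)^i)) (Ioc ((1/2:ℝ)^(j+1)) ((1/2)^j)) := by
      intro i j hij
      rw [Set.disjoint_left]
      intro t h1 h2
      have : (1/2:ℝ)^j ≤ (1/2)^(i+1) := pow_le_pow_of_le_one (by norm_num) (by norm_num) hij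
      exact absurd (h2.2.trans this) (not_le.2 h1.1)
    intro i j hij
    rcases lt_or_gt_of_ne hij with h | h
    · exact key i j h
    · exact (key j i h).symm
  refine ne_top_of_le_ne_top ?_ (ENNReal.tsum_le_tsum h1)
  rw [ENNReal.tsum_mul_left, ← lintegral_iUnion (fun _ => measurableSet_Ioc) hdisj]
  refine ENNReal.mul_ne_top (by norm_num) (ne_top_of_le_ne_top hD.2.ne ?_)
  refine (lintegral_mono_set (t := Ioc (0:ℝ) 1) (iUnion_subset fun j t ht => ⟨lt_trans (by positivity) ht.1,
    ht.2.trans (pow_le_one₀ (by norm_num) (by norm_num))⟩)).trans ?_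
  refine lintegral_mono fun t => ?_
  rw [← ofReal_norm]
  exact ENNReal.ofReal_le_ofReal (le_abs_self _)

lemma MM_one (u : Rn n) : MM volume (fun _ => 1) u ≤ 1 := by
  refine iSup_le fun c => iSup_le fun r => iSup_le fun _ => ?_
  rw [lintegral_const, one_mul, Measure.restrict_apply_univ]
  exact ENNReal.inv_mul_le_one _

lemma reg_core {θ : ℝ → ℝ} (hθ : IsModulus θ) (L : Rn n → Rn n → ℝ)
    (hL : ∀ x x' y : Rn n, x ≠ y → 2 * ‖x - x'‖ ≤ ‖x - y‖ →
      |L x y - L x' y| ≤ θ (‖x - x'‖ / ‖x - y‖) / ‖x - y‖ ^ n)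
    (x z u : Rn n) (δ : ℝ) (g : Rn n → ℝ≥0∞) (hδ : 0 < δ) (hxz : dist x z ≤ δ) (hu : u ∈ ball x (4 * δ))
    (hg : AEMeasurable g) :
    ∫⁻ y in {y | 2 * δ ≤ dist x y}, ENNReal.ofReal |L x y - L z y| * g y ≤
      (2 ^ n * volume (ball (0 : Rn n) 1) * ∑' j : ℕ, ENNReal.ofReal (θ ((1/2:ℝ) ^ (j+1)))) * MM volume g u := by
  obtain ⟨-, hm, -, -, hnn⟩ := hθ
  have hS : MeasurableSet {y : Rn n | 2 * δ ≤ dist x y} :=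
    (isClosed_le continuous_const (by fun_prop)).measurableSet
  have pt : ∀ y ∈ {y : Rn n | 2 * δ ≤ dist x y}, ENNReal.ofReal |L x y - L z y| * g y ≤
      ∑' j : ℕ, (ENNReal.ofReal (θ ((1/2:ℝ) ^ (j+1))) * ENNReal.ofReal (((2:ℝ)^(j+1)*δ)^n)⁻¹) *
        (ball x ((2:ℝ)^(j+2)*δ)).indicator g y := by
    intro y hy
    have hy : 2 * δ ≤ dist x y := hy
    obtain ⟨j, hj1, hj2⟩ : ∃ j : ℕ, (2:ℝ)^j ≤ dist x y / (2*δ) ∧ dist x y / (2*δ) < (2:ℝ)^(j+1) :=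
      exists_nat_pow_near (by rw [le_div_iff₀ (by positivity)]; linarith) (by norm_num)
    rw [le_div_iff₀ (by positivity)] at hj1
    rw [div_lt_iff₀ (by positivity)] at hj2
    have hj1' : (2:ℝ)^(j+1) * δ ≤ dist x y := by rw [pow_succ]; linarith
    have hj2' : dist x y < (2:ℝ)^(j+2) * δ := by rw [pow_succ (2:ℝ) (j+1)]; linarith
    refine le_trans ?_ (ENNReal.le_tsum j)
    rw [indicator_of_mem (by rwa [mem_ball'])]
    gcongr
    have hd : 0 < dist x y := by linarith
    rw [← ENNReal.ofReal_mul (hnn _ ⟨by positivity, pow_le_one₀ (by norm_num) (by norm_num)⟩)]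
    refine ENNReal.ofReal_le_ofReal ((hL x z y (dist_pos.1 hd) ?_).trans ?_)
    · rw [← dist_eq_norm, ← dist_eq_norm]; linarith
    · rw [← dist_eq_norm, ← dist_eq_norm, ← div_eq_mul_inv]
      have h2 : dist x z / dist x y ≤ (1/2:ℝ)^(j+1) := by
        rw [div_le_iff₀ hd, one_div, inv_pow, inv_mul_eq_div, le_div_iff₀ (by positivity)]
        nlinarith [show (0:ℝ) < 2^(j+1) by positivity]
      have h3 : (1/2:ℝ)^(j+1) ≤ 1 := pow_le_one₀ (by norm_num) (by norm_num)
      have h4 := hm ⟨by positivity, h2.trans h3⟩ ⟨by positivity, h3⟩ h2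
      refine div_le_div₀ (hnn _ ⟨by positivity, h3⟩) h4 (by positivity) ?_
      gcongr
  calc _ ≤ ∫⁻ y, ∑' j : ℕ, (ENNReal.ofReal (θ ((1/2:ℝ) ^ (j+1))) * ENNReal.ofReal (((2:ℝ)^(j+1)*δ)^n)⁻¹) *
        (ball x ((2:ℝ)^(j+2)*δ)).indicator g y :=
        (setLIntegral_mono' hS pt).trans (setLIntegral_le_lintegral _ _)
    _ = ∑' j : ℕ, (ENNReal.ofReal (θ ((1/2:ℝ) ^ (j+1))) * ENNReal.ofReal (((2:ℝ)^(j+1)*δ)^n)⁻¹) *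
        ∫⁻ y in ball x ((2:ℝ)^(j+2)*δ), g y := by
        rw [lintegral_tsum fun j => (hg.indicator measurableSet_ball).const_mul _]
        refine tsum_congr fun j => ?_
        rw [lintegral_const_mul'' _ (hg.indicator measurableSet_ball), lintegral_indicator measurableSet_ball]
    _ ≤ ∑' j : ℕ, ENNReal.ofReal (θ ((1/2:ℝ) ^ (j+1))) * (2 ^ n * volume (ball (0 : Rn n) 1) * MM volume g u) := by
        refine ENNReal.tsum_le_tsum fun j => ?_
        rw [mul_assoc]
        refine mul_le_mul_right ?_ _
        have hu' : u ∈ ball x ((2:ℝ)^(j+2)*δ) := by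
          refine ball_subset_ball ?_ hu
          have : (1:ℝ) ≤ 2^j := one_le_pow₀ (by norm_num)
          rw [pow_add]; nlinarith
        refine (mul_le_mul_right (setI_le_MM AI_vol.1 g hu') _).trans (le_of_eq ?_)
        rw [vol_ball _ (by positivity), ← ENNReal.ofReal_pow (by positivity), ← mul_assoc, ← mul_assoc,
          ← ENNReal.ofReal_mul (by positivity)]
        congr 2
        rw [show (2:ℝ≥0∞)^n = ENNReal.ofReal (2^n) by rw [ENNReal.ofReal_pow (by norm_num)]; simp]
        congr 1
        rw [pow_succ (2:ℝ) (j+1), mul_pow, mul_pow, mul_pow]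
        field_simp
    _ = _ := by rw [ENNReal.tsum_mul_right]; ring

lemma K_cont {θ : ℝ → ℝ} (hθ : IsModulus θ) {C₀ : ℝ} {K : Rn n → Rn n → ℝ} (hK : IsThetaKernel n θ C₀ K) :
    ContinuousOn (fun z : Rn n × Rn n => K z.1 z.2) {z | z.1 ≠ z.2} := by
  obtain ⟨hc, hm, -, h0, hnn⟩ := hθ
  rintro ⟨x, y⟩ hxy
  have hxy : x ≠ y := hxy
  refine ContinuousAt.continuousWithinAt ?_
  have hd : 0 < ‖x - y‖ := norm_pos_iff.2 (sub_ne_zero.2 hxy)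
  have lim0 : ∀ F : Rn n × Rn n → ℝ, (∀ᶠ z in 𝓝 (x, y), F z ∈ Icc (0:ℝ) 1) → Tendsto F (𝓝 (x,y)) (𝓝 0) →
      Tendsto (fun z => θ (F z)) (𝓝 (x,y)) (𝓝 0) := by
    intro F h1 h2
    have := (hc 0 (by simp))
    rw [ContinuousWithinAt, h0] at this
    exact this.comp (tendsto_nhdsWithin_iff.2 ⟨h2, h1⟩)
  have c1 : Tendsto (fun z : Rn n × Rn n => ‖x - z.1‖) (𝓝 (x,y)) (𝓝 0) := by
    have : Continuous (fun z : Rn n × Rn n => ‖x - z.1‖) := by fun_prop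
    simpa using this.tendsto (x,y)
  have c2 : Tendsto (fun z : Rn n × Rn n => ‖y - z.2‖) (𝓝 (x,y)) (𝓝 0) := by
    have : Continuous (fun z : Rn n × Rn n => ‖y - z.2‖) := by fun_prop
    simpa using this.tendsto (x,y)
  have c3 : Tendsto (fun z : Rn n × Rn n => ‖x - z.2‖) (𝓝 (x,y)) (𝓝 ‖x - y‖) := by
    have : Continuous (fun z : Rn n × Rn n => ‖x - z.2‖) := by fun_prop
    exact this.tendsto (x,y)
  have e1 : ∀ᶠ z in 𝓝 (x,y), 2 * ‖x - z.1‖ ≤ ‖x - z.2‖ ∧ 2 * ‖y - z.2‖ ≤ ‖y - x‖ ∧ x ≠ z.2 := by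
    have a1 := c1.eventually (gt_mem_nhds (show (0:ℝ) < ‖x-y‖/4 by positivity))
    have a2 := c2.eventually (gt_mem_nhds (show (0:ℝ) < ‖x-y‖/4 by positivity))
    have a3 := c3.eventually (lt_mem_nhds (show ‖x-y‖/2 < ‖x-y‖ by linarith))
    filter_upwards [a1, a2, a3] with z h1 h2 h3
    refine ⟨by linarith, by rw [norm_sub_rev y x]; linarith, fun h => ?_⟩
    rw [← h, sub_self, norm_zero] at h3; linarith
  have i1 : ∀ z : Rn n × Rn n, 2 * ‖x - z.1‖ ≤ ‖x - z.2‖ → x ≠ z.2 → ‖x - z.1‖/‖x - z.2‖ ∈ Icc (0:ℝ) 1 := by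
    intro z h h'
    have : 0 < ‖x - z.2‖ := norm_pos_iff.2 (sub_ne_zero.2 h')
    refine ⟨by positivity, (div_le_one this).2 ?_⟩
    linarith [norm_nonneg (x - z.1)]
  have t1 : Tendsto (fun z : Rn n × Rn n => θ (‖x - z.1‖/‖x - z.2‖)/‖x - z.2‖^n) (𝓝 (x,y)) (𝓝 0) := by
    have := (lim0 (fun z => ‖x - z.1‖/‖x - z.2‖) (by
      filter_upwards [e1] with z hz
      exact i1 z hz.1 hz.2.2) (by have := c1.div c3 hd.ne'; rw [zero_div] at this; exact this)).div (c3.pow n) (by positivity)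
    rw [zero_div] at this; exact this
  have t2 : Tendsto (fun z : Rn n × Rn n => θ (‖y - z.2‖/‖y - x‖)/‖y - x‖^n) (𝓝 (x,y)) (𝓝 0) := by
    have := (lim0 (fun z => ‖y - z.2‖/‖y - x‖) (by
      filter_upwards [e1] with z hz
      refine ⟨by positivity, div_le_one_of_le₀ ?_ (by positivity)⟩
      linarith [norm_nonneg (y - z.2), hz.2.1]) (by simpa using c2.div_const _)).div_const (‖y-x‖^n)
    simpa using this
  rw [ContinuousAt, tendsto_iff_dist_tendsto_zero]
  refine squeeze_zero' (Eventually.of_forall fun _ => dist_nonneg) ?_ (by simpa using t1.add t2)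
  filter_upwards [e1] with z hz
  have r1 := hK.2 x z.1 z.2 hz.2.2 hz.1
  have r2 := hK.2 y z.2 x hxy.symm hz.2.1
  rw [Real.dist_eq]
  have : K z.1 z.2 - K x y = -(K x z.2 - K z.1 z.2) - (K x y - K x z.2) := by ring
  rw [this]
  refine (abs_sub _ _).trans ?_
  rw [abs_neg]
  linarith [abs_nonneg (K z.2 x - K z.2 z.1), abs_nonneg (K y x - K z.2 x)]

lemma gk_of [NeZero n] {θ : ℝ → ℝ} (hθ : IsModulus θ) (hD : DiniCondition θ) {C₀ : ℝ} {K : Rn n → Rn n → ℝ}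
    (hK : IsThetaKernel n θ C₀ K) : ∃ Cr, GK C₀ Cr (fun x y : Rn n => if x = y then 0 else K x y) := by
  have hcont := K_cont hθ hK
  have hn : n ≠ 0 := NeZero.ne n
  obtain ⟨A, hAe⟩ : ∃ A : ℝ≥0∞, A = 2 ^ n * volume (ball (0 : Rn n) 1) * ∑' j : ℕ, ENNReal.ofReal (θ ((1/2:ℝ) ^ (j+1))) := ⟨_, rfl⟩
  have hA : A ≠ ⊤ := hAe ▸ ENNReal.mul_ne_top (ENNReal.mul_ne_top (by finiteness) measure_ball_lt_top.ne) (dini_sum hθ hD)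
  have hmeas : Measurable (fun z : Rn n × Rn n => if z.1 = z.2 then 0 else K z.1 z.2) := by
    have ho : IsOpen {z : Rn n × Rn n | z.1 ≠ z.2} := isOpen_ne_fun continuous_fst continuous_snd
    have := hcont.measurable_piecewise (g := fun _ => (0:ℝ)) continuousOn_const ho.measurableSet
    convert this using 2 with z
    by_cases h : z.1 = z.2 <;> simp [Set.piecewise, h]
  have hreg : ∀ x x' y : Rn n, x ≠ y → 2 * ‖x - x'‖ ≤ ‖x - y‖ → x' ≠ y := by
    rintro x x' y h1 h2 rfl
    have : 0 < ‖x - x'‖ := norm_pos_iff.2 (sub_ne_zero.2 h1)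
    linarith
  refine ⟨A.toNNReal, hmeas, ?_, ?_, ?_, ?_⟩
  · obtain ⟨x, hx⟩ := exists_ne (0 : Rn n)
    have := (abs_nonneg _).trans (hK.1 x 0 hx)
    have h2 : 0 < ‖x - 0‖ ^ n := pow_pos (norm_pos_iff.2 (by simpa using hx)) _
    by_contra h
    exact absurd this (not_le.2 (div_neg_of_neg_of_pos (not_le.1 h) h2))
  · intro x y
    by_cases h : x = y
    · simp [h, hn]
    · simp only [h, if_false]; rw [dist_eq_norm]; exact hK.1 x y h
  · intro x z u δ g hδ hxz hu hg
    rw [ENNReal.coe_toNNReal hA]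
    rw [hAe]
    refine reg_core hθ (fun x y : Rn n => if x = y then 0 else K x y) ?_ x z u δ g hδ hxz hu hg
    intro x x' y h1 h2
    rw [if_neg h1, if_neg (hreg x x' y h1 h2)]
    linarith [hK.2 x x' y h1 h2, abs_nonneg (K y x - K y x')]
  · intro x z δ hδ hxz
    rw [ENNReal.coe_toNNReal hA]
    have := reg_core hθ (fun x y : Rn n => if y = x then 0 else K y x) (by
      intro x x' y h1 h2
      have h3 := hreg x x' y h1 h2
      rw [if_neg h1.symm, if_neg h3.symm]
      linarith [hK.2 x x' y h1 h2, abs_nonneg (K x y - K x' y)]) x z x δ (fun _ => 1) hδ hxz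
      (mem_ball_self (by positivity)) aemeasurable_const
    simp only [mul_one] at this
    rw [hAe]
    exact this.trans ((mul_le_mul_right (MM_one x) _).trans (by rw [mul_one]))

end P3

section P4
open scoped NNReal
variable {n : ℕ}

open Classical in
def TT (T : Lp ℝ 2 (volume : Measure (Rn n)) →L[ℝ] Lp ℝ 2 (volume : Measure (Rn n))) (f : Rn n → ℝ) :
    Rn n → ℝ := if h : MemLp f 2 volume then (T (h.toLp f) : Rn n → ℝ) else 0

variable {T : Lp ℝ 2 (volume : Measure (Rn n)) →L[ℝ] Lp ℝ 2 (volume : Measure (Rn n))}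

lemma TT_of {f : Rn n → ℝ} (h : MemLp f 2 volume) : TT T f = (T (h.toLp f) : Rn n → ℝ) := by
  simp [TT, h]

lemma TT_sm (f : Rn n → ℝ) : AEStronglyMeasurable (TT T f) volume := by
  by_cases h : MemLp f 2 volume
  · rw [TT_of h]; exact Lp.aestronglyMeasurable _
  · simp only [TT, h, dif_neg, not_false_eq_true]; exact aestronglyMeasurable_zero

lemma TT_sub {f g : Rn n → ℝ} (hf : MemLp f 2 volume) (hg : MemLp g 2 volume) :
    TT T (f - g) =ᵐ[volume] TT T f - TT T g := by
  rw [TT_of hf, TT_of hg, TT_of (hf.sub hg), MemLp.toLp_sub, map_sub]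
  exact Lp.coeFn_sub _ _

lemma TT_add {f g : Rn n → ℝ} (hf : MemLp f 2 volume) (hg : MemLp g 2 volume) :
    TT T (f + g) =ᵐ[volume] TT T f + TT T g := by
  rw [TT_of hf, TT_of hg, TT_of (hf.add hg), MemLp.toLp_add, map_add]
  exact Lp.coeFn_add _ _

lemma TT_norm {f : Rn n → ℝ} (hf : MemLp f 2 volume) :
    eLpNorm (TT T f) 2 volume ≤ ‖T‖ₑ * eLpNorm f 2 volume := by
  rw [TT_of hf, ← Lp.enorm_def]
  refine (T.le_opENorm _).trans ?_
  rw [Lp.enorm_toLp]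

lemma L1L2 {h : Rn n → ℝ} (hm : AEStronglyMeasurable h volume) (V : Set (Rn n)) :
    ∫⁻ x in V, ‖h x‖ₑ ≤ eLpNorm h 2 volume * volume V ^ (1/2:ℝ) := by
  rw [← eLpNorm_one_eq_lintegral_enorm]
  refine (eLpNorm_le_eLpNorm_mul_rpow_measure_univ (q := 2) (by norm_num) hm.restrict).trans ?_
  rw [Measure.restrict_apply_univ]
  rw [show 1 / (1:ℝ≥0∞).toReal - 1 / (2:ℝ≥0∞).toReal = 1/2 by norm_num]
  exact mul_le_mul_left (eLpNorm_mono_measure _ Measure.restrict_le_self) _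

variable {K : Rn n → Rn n → ℝ} {C₀ : ℝ} {Cr : ℝ≥0}

lemma Ksm (hK : GK C₀ Cr K) {f : Rn n → ℝ} (hf : Measurable f) :
    Measurable (fun z => ∫ y, K z y * f y) := by
  have : StronglyMeasurable (fun z : Rn n × Rn n => K z.1 z.2 * f z.2) :=
    (hK.meas.mul (hf.comp measurable_snd)).stronglyMeasurable
  exact (this.integral_prod_right (ν := volume)).measurable

lemma Kmz (hK : GK C₀ Cr K) (z : Rn n) : Measurable (fun y => K z y) :=
  hK.meas.comp (measurable_const.prodMk measurable_id)

lemma Kmz' (hK : GK C₀ Cr K) (z : Rn n) : Measurable (fun y => K y z) :=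
  hK.meas.comp (measurable_id.prodMk measurable_const)

lemma K_le (hK : GK C₀ Cr K) {x y : Rn n} {e : ℝ} (he : 0 < e) (h : e ≤ dist x y) : |K x y| ≤ C₀ / e ^ n := by
  refine (hK.size x y).trans ?_
  have := hK.c0
  gcongr

lemma K_int (hK : GK C₀ Cr K) {z : Rn n} {e : ℝ} (he : 0 < e) {f : Rn n → ℝ} (hf : Integrable f)
    (hz : ∀ y, f y ≠ 0 → e ≤ dist z y) : Integrable (fun y => K z y * f y) := by
  refine (hf.norm.const_mul (C₀ / e ^ n)).mono ((Kmz hK z).aestronglyMeasurable.mul hf.1) ?_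
  refine Eventually.of_forall fun y => ?_
  by_cases h : f y = 0
  · simp [h]
  · rw [norm_mul, Real.norm_eq_abs, norm_mul, norm_norm]
    gcongr
    exact (K_le hK he (hz y h)).trans (le_abs_self _)

lemma int_of_bdd {f : Rn n → ℝ} (hf : MemLp f 2 volume) {c : Rn n} {R : ℝ} (h : ∀ x, x ∉ ball c R → f x = 0) :
    Integrable f := by
  haveI : IsFiniteMeasure ((volume : Measure (Rn n)).restrict (ball c R)) := ⟨by
    rw [Measure.restrict_apply_univ]; exact measure_ball_lt_top⟩
  have : IntegrableOn f (ball c R) := (hf.restrict _).integrable (by norm_num)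
  exact (integrableOn_iff_integrable_of_support_subset fun x hx => by
    by_contra h2; exact hx (h x h2)).1 this

lemma rep_core (hK : GK C₀ Cr K) (hT : IsCZO n K T) {f : Rn n → ℝ} (hfm : Measurable f) (hf : MemLp f 2 volume)
    {z0 : Rn n} {R η : ℝ} (hη : 0 < η) (hR : 0 < R) (hfR : ∀ x, x ∉ ball z0 R → f x = 0) (hf0 : ∀ x ∈ ball z0 (2*η), f x = 0) :
    ∀ᵐ z, z ∈ ball z0 η → TT T f z = ∫ y, K z y * f y := by
  set V := ball z0 (R+1)
  set B := ball z0 η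
  set M := C₀ / (η/2)^n
  set A : ℝ≥0∞ := ‖T‖ₑ * volume B ^ (1/2:ℝ) + (ENNReal.ofReal M * volume V ^ (1/2:ℝ)) * volume B
  have hVt : volume V ≠ ⊤ := measure_ball_lt_top.ne
  have hBt : volume B ≠ ⊤ := measure_ball_lt_top.ne
  have hA : A ≠ ⊤ := by
    refine ENNReal.add_ne_top.2 ⟨ENNReal.mul_ne_top (by finiteness) (by finiteness), ENNReal.mul_ne_top (by finiteness) hBt⟩
  have key : ∀ ε : ℝ, 0 < ε → ∫⁻ z in B, ‖TT T f z - ∫ y, K z y * f y‖ₑ ≤ A * ENNReal.ofReal ε := by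
    intro ε hε
    obtain ⟨ψ, hψc, hψs, hψ⟩ := hf.exist_eLpNorm_sub_le (by norm_num) (by norm_num) hε
    let χ1 : ContDiffBump z0 := ⟨R, R+1, hR, by linarith⟩
    let χ2 : ContDiffBump z0 := ⟨3*η/2, 2*η, by positivity, by linarith⟩
    let φ : Rn n → ℝ := fun x => χ1 x * (1 - χ2 x) * ψ x
    have hφs : ContDiff ℝ (⊤:ℕ∞) φ := (χ1.contDiff.mul (contDiff_const.sub χ2.contDiff)).mul hψs
    have hφc : HasCompactSupport φ := HasCompactSupport.mul_left hψc
    have hφm : MemLp φ 2 volume := hφs.continuous.memLp_of_hasCompactSupport hφc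
    have hφ0 : ∀ x ∈ ball z0 (3*η/2), φ x = 0 := by
      intro x hx
      simp only [φ, χ2.one_of_mem_closedBall (ball_subset_closedBall hx), sub_self, mul_zero, zero_mul]
    have hφV : ∀ x, x ∉ V → φ x = 0 := by
      intro x hx
      have : χ1 x = 0 := by
        by_contra h
        have h' : x ∈ Function.support χ1 := h
        rw [χ1.support_eq] at h'; exact hx h'
      simp [φ, this]
    have hfφ : eLpNorm (f - φ) 2 volume ≤ ENNReal.ofReal ε := by
      refine (eLpNorm_mono fun x => ?_).trans hψ
      have e : (f - φ) x = (χ1 x * (1 - χ2 x)) * (f - ψ) x := by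
        simp only [Pi.sub_apply, φ, mul_sub]
        congr 1
        by_cases h : f x = 0
        · simp [h]
        · have h1 : x ∈ ball z0 R := by by_contra h2; exact h (hfR x h2)
          have h2 : x ∉ ball z0 (2*η) := fun h2 => h (hf0 x h2)
          rw [χ1.one_of_mem_closedBall (ball_subset_closedBall h1)]
          have : χ2 x = 0 := by
            by_contra h
            have h' : x ∈ Function.support χ2 := h
            rw [χ2.support_eq] at h'; exact h2 h'
          simp [this]
      rw [e, norm_mul]
      have h1 : ‖χ1 x * (1 - χ2 x)‖ ≤ 1 := by
        rw [Real.norm_eq_abs, abs_of_nonneg (mul_nonneg χ1.nonneg (sub_nonneg.2 χ2.le_one))]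
        exact mul_le_one₀ χ1.le_one (sub_nonneg.2 χ2.le_one) (by linarith [χ2.nonneg (x := x)])
      exact mul_le_of_le_one_left (norm_nonneg _) h1
    have hts : ∀ z ∈ B, z ∉ tsupport φ := by
      intro z hz hz2
      have : tsupport φ ⊆ (ball z0 (3*η/2))ᶜ :=
        closure_minimal (fun x hx hx2 => hx (hφ0 x hx2)) isOpen_ball.isClosed_compl
      exact this hz2 (ball_subset_ball (by linarith) hz)
    have hfV : ∀ x, x ∉ V → f x = 0 := fun x hx => hfR x fun h => hx (ball_subset_ball (by linarith) h)
    have hf0' : ∀ x ∈ ball z0 (3*η/2), f x = 0 := fun x hx => hf0 x (ball_subset_ball (by linarith) hx)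
    have far : ∀ z ∈ B, ∀ y, y ∉ ball z0 (3*η/2) → η/2 ≤ dist z y := by
      intro z hz y hy
      have hz : dist z z0 < η := hz
      have hy : 3*η/2 ≤ dist y z0 := not_lt.1 hy
      linarith [dist_triangle y z z0, dist_comm z y]
    have hint : ∀ z ∈ B, ‖(∫ y, K z y * φ y) - ∫ y, K z y * f y‖ₑ ≤ ENNReal.ofReal M * volume V ^ (1/2:ℝ) * ENNReal.ofReal ε := by
      intro z hz
      rw [← integral_sub (K_int hK (half_pos hη) (int_of_bdd hφm hφV) fun y hy => far z hz y fun h => hy (hφ0 y h))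
        (K_int hK (half_pos hη) (int_of_bdd hf hfV) fun y hy => far z hz y fun h => hy (hf0' y h))]
      refine (enorm_integral_le_lintegral_enorm _).trans ?_
      calc ∫⁻ y, ‖K z y * φ y - K z y * f y‖ₑ ≤ ∫⁻ y, ENNReal.ofReal M * V.indicator (fun y => ‖(f - φ) y‖ₑ) y := by
            refine lintegral_mono fun y => ?_
            by_cases hy : y ∈ V
            · rw [indicator_of_mem hy, ← mul_sub, enorm_mul, ← enorm_neg (φ y - f y), neg_sub]
              by_cases hy2 : y ∈ ball z0 (3*η/2)
              · simp [hφ0 y hy2, hf0' y hy2]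
              · gcongr
                · rw [← ofReal_norm]; exact ENNReal.ofReal_le_ofReal (K_le hK (half_pos hη) (far z hz y hy2))
                · exact le_rfl
            · simp [hφV y hy, hfV y hy]
        _ = ENNReal.ofReal M * ∫⁻ y in V, ‖(f - φ) y‖ₑ := by
            rw [lintegral_const_mul' _ _ (by finiteness), lintegral_indicator measurableSet_ball]
        _ ≤ ENNReal.ofReal M * (ENNReal.ofReal ε * volume V ^ (1/2:ℝ)) := by
            gcongr ENNReal.ofReal M * ?_
            refine (L1L2 (hf.sub hφm).1 V).trans ?_
            gcongr
        _ = _ := by ring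
    have hsub := TT_sub (T := T) hf hφm
    have hczo := hT φ hφm hφs hφc
    calc ∫⁻ z in B, ‖TT T f z - ∫ y, K z y * f y‖ₑ ≤ ∫⁻ z in B, (‖TT T (f - φ) z‖ₑ + ENNReal.ofReal M * volume V ^ (1/2:ℝ) * ENNReal.ofReal ε) := by
          refine lintegral_mono_ae ?_
          filter_upwards [ae_restrict_of_ae hsub, ae_restrict_of_ae hczo, ae_restrict_mem measurableSet_ball] with z h1 h2 h3
          have h4 := h2 (hts z h3)
          rw [← TT_of hφm] at h4
          have : TT T f z - ∫ y, K z y * f y = TT T (f - φ) z + ((∫ y, K z y * φ y) - ∫ y, K z y * f y) := by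
            rw [h1, Pi.sub_apply, h4]; ring
          rw [this]
          exact (enorm_add_le _ _).trans (add_le_add_right (hint z h3) _)
      _ ≤ (‖T‖ₑ * ENNReal.ofReal ε) * volume B ^ (1/2:ℝ) + ENNReal.ofReal M * volume V ^ (1/2:ℝ) * ENNReal.ofReal ε * volume B := by
          rw [lintegral_add_right _ measurable_const, lintegral_const, Measure.restrict_apply_univ]
          gcongr
          refine (L1L2 (TT_sm _) B).trans ?_
          gcongr
          refine (TT_norm (hf.sub hφm)).trans ?_
          gcongr
      _ = _ := by simp only [A]; ring
  have h0 : ∫⁻ z in B, ‖TT T f z - ∫ y, K z y * f y‖ₑ = 0 := by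
    refine le_antisymm (ge_of_tendsto (x := 𝓝[>] (0:ℝ)) (f := fun ε => A * ENNReal.ofReal ε) ?_ ?_) zero_le
    · have : Tendsto (fun ε => A * ENNReal.ofReal ε) (𝓝 0) (𝓝 (A * ENNReal.ofReal 0)) :=
        ENNReal.Tendsto.const_mul (ENNReal.tendsto_ofReal tendsto_id) (Or.inr hA)
      rw [ENNReal.ofReal_zero, mul_zero] at this
      exact this.mono_left nhdsWithin_le_nhds
    · filter_upwards [self_mem_nhdsWithin] with ε hε
      exact key ε hε
  rw [lintegral_eq_zero_iff'] at h0
  · filter_upwards [(ae_restrict_iff' measurableSet_ball).1 h0] with z hz hzB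
    have := hz hzB
    simpa [sub_eq_zero] using this
  · exact ((TT_sm f).sub (Ksm hK hfm).aestronglyMeasurable).enorm.restrict

lemma rep (hK : GK C₀ Cr K) (hT : IsCZO n K T) {f : Rn n → ℝ} (hfm : Measurable f) (hf : MemLp f 2 volume)
    {c : Rn n} {R : ℝ} (hfR : ∀ x, x ∉ ball c R → f x = 0) {U : Set (Rn n)} (hU : IsOpen U) (hf0 : ∀ x ∈ U, f x = 0) :
    ∀ᵐ z, z ∈ U → TT T f z = ∫ y, K z y * f y := by
  rw [ae_iff]
  refine measure_null_of_locally_null _ fun z0 hz0 => ?_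
  simp only [mem_ofPred_eq, Classical.not_imp] at hz0
  obtain ⟨r, hr, hrU⟩ := Metric.isOpen_iff.1 hU z0 hz0.1
  have := rep_core (z0 := z0) (R := dist z0 c + |R| + 1) (η := r/2) hK hT hfm hf (by positivity) (by positivity) (fun x hx => hfR x fun h => hx ?_)
    (fun x hx => hf0 x (hrU (by simpa [mul_div_cancel₀] using hx)))
  · refine ⟨ball z0 (r/2) ∩ {a | ¬(a ∈ U → TT T f a = ∫ y, K a y * f y)}, ?_, ?_⟩
    · rw [inter_comm]; exact inter_mem_nhdsWithin _ (ball_mem_nhds _ (by positivity))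
    · rw [ae_iff] at this
      refine measure_mono_null ?_ this
      rintro a ⟨h1, h2⟩ h3
      simp only [mem_ofPred_eq, Classical.not_imp] at h2
      exact h2.2 (h3 h1)
  · have h1 : dist x c < R := h
    rw [mem_ball]
    linarith [dist_triangle x c z0, dist_comm c z0, le_abs_self R]

end P4

section P5
open scoped NNReal
variable {n : ℕ} {T : Lp ℝ 2 (volume : Measure (Rn n)) →L[ℝ] Lp ℝ 2 (volume : Measure (Rn n))}
  {K : Rn n → Rn n → ℝ} {C₀ : ℝ} {Cr : ℝ≥0}

lemma atom [NeZero n] (hK : GK C₀ Cr K) (hT : IsCZO n K T) {a : Rn n → ℝ} (ham : Measurable a)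
    (ha : MemLp a 2 volume) {k : ℤ} {x0 : Rn n} (h0 : ∀ y, y ∉ dy k x0 → a y = 0) (hi : ∫ y, a y = 0) :
    ∫⁻ x in (BB k x0)ᶜ, ‖TT T a x‖ₑ ≤ Cr * ∫⁻ y, ‖a y‖ₑ := by
  have hr := rad_pos (n := n) k
  set c := ctr k x0
  have hbs : ∀ y, y ∉ BB k x0 → a y = 0 := fun y hy => h0 y fun h => hy (dy_sub_BB k x0 h)
  have hai : Integrable a := int_of_bdd ha hbs
  have hrep := rep hK hT ham ha hbs (U := (closedBall c (rad n k))ᶜ) isClosed_closedBall.isOpen_compl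
    (fun y hy => h0 y fun h => hy (dist_dy_ctr h))
  have hBm : MeasurableSet (BB k x0)ᶜ := measurableSet_ball.compl
  have far : ∀ x ∈ (BB k x0)ᶜ, 4 * rad n k ≤ dist x c := fun x hx => not_lt.1 hx
  have pt : ∀ x ∈ (BB k x0)ᶜ, ‖∫ y, K x y * a y‖ₑ ≤ ∫⁻ y, ‖K x c - K x y‖ₑ * ‖a y‖ₑ := by
    intro x hx
    have h1 : Integrable (fun y => K x y * a y) := K_int hK hr hai fun y hy => by
      have hy' : y ∈ dy k x0 := by by_contra h; exact hy (h0 y h)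
      have := far x hx
      have := dist_dy_ctr hy'
      have := dist_triangle x y c
      linarith
    have : ∫ y, K x y * a y = ∫ y, (K x y * a y - K x c * a y) := by
      rw [integral_sub h1 (hai.const_mul _), integral_const_mul, hi, mul_zero, sub_zero]
    rw [this]
    refine (enorm_integral_le_lintegral_enorm _).trans (lintegral_mono fun y => ?_)
    rw [← sub_mul, enorm_mul, ← enorm_neg, neg_sub]
  have hmeas : Measurable (fun z : Rn n × Rn n => ‖K z.1 c - K z.1 z.2‖ₑ * ‖a z.2‖ₑ) :=
    (((Kmz' hK c).comp measurable_fst).sub hK.meas).enorm.mul (ham.comp measurable_snd).enorm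
  calc ∫⁻ x in (BB k x0)ᶜ, ‖TT T a x‖ₑ ≤ ∫⁻ x in (BB k x0)ᶜ, ∫⁻ y, ‖K x c - K x y‖ₑ * ‖a y‖ₑ := by
        refine lintegral_mono_ae ?_
        filter_upwards [ae_restrict_of_ae hrep, ae_restrict_mem hBm] with x h1 h2
        rw [h1 (fun h => ?_)]
        · exact pt x h2
        · have h : dist x c ≤ rad n k := h
          linarith [far x h2]
    _ = ∫⁻ y, ∫⁻ x in (BB k x0)ᶜ, ‖K x c - K x y‖ₑ * ‖a y‖ₑ :=
        lintegral_lintegral_swap hmeas.aemeasurable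
    _ ≤ ∫⁻ y, Cr * ‖a y‖ₑ := by
        refine lintegral_mono fun y => ?_
        by_cases hy : y ∈ dy k x0
        · rw [lintegral_mul_const' _ _ enorm_ne_top]
          gcongr
          refine le_trans ?_ (hK.reg2 c y (rad n k) hr (by rw [dist_comm]; exact dist_dy_ctr hy))
          calc _ = ∫⁻ x in (BB k x0)ᶜ, ENNReal.ofReal |K x c - K x y| :=
                lintegral_congr fun x => by rw [← ofReal_norm, Real.norm_eq_abs]
            _ ≤ _ := lintegral_mono_set fun x hx => by
                have := far x hx
                rw [dist_comm] at this
                exact le_trans (by linarith) this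
        · simp [h0 y hy]
    _ = _ := by rw [lintegral_const_mul' _ _ (by finiteness)]

lemma exists_level (n : ℕ) [NeZero n] (I l : ℝ≥0∞) (hI : I ≠ ⊤) (hl : l ≠ 0) : ∃ k0 : ℤ, ∀ x : Rn n, I ≤ l * volume (dy k0 x) := by
  obtain ⟨m, hm⟩ := ENNReal.exists_nat_gt (ENNReal.div_ne_top hI hl)
  refine ⟨-(m:ℤ), fun x => ?_⟩
  rw [vol_dy, neg_neg, zpow_natCast]
  have h1 : (m : ℝ≥0∞) ≤ ENNReal.ofReal (2^m) ^ n := by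
    rw [← ENNReal.ofReal_pow (by positivity), ← ENNReal.ofReal_natCast]
    refine ENNReal.ofReal_le_ofReal ?_
    have h2 : (m:ℝ) ≤ 2^m := by exact_mod_cast Nat.lt_two_pow_self.le
    exact h2.trans (le_self_pow₀ (one_le_pow₀ (by norm_num)) (NeZero.ne n))
  rcases eq_or_ne l ⊤ with rfl | hlt
  · rw [ENNReal.top_mul]; exact le_top
    exact pow_ne_zero _ (ENNReal.ofReal_pos.2 (by positivity)).ne'
  · calc I = l * (I / l) := (ENNReal.mul_div_cancel hl hlt).symm
      _ ≤ _ := by gcongr; exact hm.le.trans h1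

lemma TT_sum {ι : Type*} (F : Finset ι) (h : ι → Rn n → ℝ) (hm : ∀ i ∈ F, MemLp (h i) 2 volume) :
    ∀ᵐ z, ‖TT T (∑ i ∈ F, h i) z‖ₑ ≤ ∑ i ∈ F, ‖TT T (h i) z‖ₑ := by
  classical
  induction F using Finset.induction_on with
  | empty =>
    have h0 := TT_sub (T := T) (f := 0) (g := 0) MemLp.zero MemLp.zero
    simp only [sub_self] at h0
    filter_upwards [h0] with z hz
    simp only [Finset.sum_empty]
    rw [hz]; simp
  | insert i s hi ih =>
    have h1 := ih fun j hj => hm j (Finset.mem_insert_of_mem hj)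
    have hs : MemLp (∑ i ∈ s, h i) 2 volume := memLp_finsetSum' s fun j hj => hm j (Finset.mem_insert_of_mem hj)
    filter_upwards [h1, TT_add (T := T) (hm i (Finset.mem_insert_self _ _)) hs] with z h2 h3
    rw [Finset.sum_insert hi, Finset.sum_insert hi, h3]
    exact (enorm_add_le _ _).trans (by gcongr)

lemma sq_eLp (f : Rn n → ℝ) : eLpNorm f 2 volume ^ 2 = ∫⁻ x, ‖f x‖ₑ ^ 2 := by
  rw [eLpNorm_eq_lintegral_rpow_enorm_toReal (by norm_num) (by norm_num), ← ENNReal.rpow_natCast, ← ENNReal.rpow_mul]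
  norm_num

lemma cheb2 {f : Rn n → ℝ} (hf : MemLp f 2 volume) (s : ℝ≥0∞) :
    s ^ 2 * volume {x | s ≤ ‖TT T f x‖ₑ} ≤ ‖T‖ₑ ^ 2 * ∫⁻ x, ‖f x‖ₑ ^ 2 := by
  calc s ^ 2 * volume {x | s ≤ ‖TT T f x‖ₑ} ≤ s ^ 2 * volume {x | s ^ 2 ≤ ‖TT T f x‖ₑ ^ 2} := by
        refine mul_le_mul_right (measure_mono fun x hx => ?_) _
        have hx : s ≤ ‖TT T f x‖ₑ := hx
        exact pow_le_pow_left₀ zero_le hx 2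
    _ ≤ ∫⁻ x, ‖TT T f x‖ₑ ^ 2 := mul_meas_ge_le_lintegral₀ ((TT_sm f).enorm.pow_const 2) _
    _ = eLpNorm (TT T f) 2 volume ^ 2 := (sq_eLp _).symm
    _ ≤ (‖T‖ₑ * eLpNorm f 2 volume) ^ 2 := by gcongr; exact TT_norm hf
    _ = _ := by rw [mul_pow, sq_eLp]

lemma weakT [NeZero n] (hK : GK C₀ Cr K) (hT : IsCZO n K T) : ∃ C : ℝ≥0, ∀ (f : Rn n → ℝ), Measurable f →
    MemLp f 2 volume → ∀ (c : Rn n) (R : ℝ), (∀ x, x ∉ ball c R → f x = 0) → ∀ l : ℝ≥0∞, l ≠ 0 → l ≠ ⊤ →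
      l * volume {z | l < ‖TT T f z‖ₑ} ≤ C * ∫⁻ y, ‖f y‖ₑ := by
  have hCt : 4 * ‖T‖ₑ ^ 2 * (2 ^ n + 2) + cB n + 4 * Cr ≠ ⊤ := by
    have := cB_top (n := n)
    finiteness
  refine ⟨(4 * ‖T‖ₑ ^ 2 * (2 ^ n + 2) + cB n + 4 * Cr).toNNReal, fun f hfm hf c R hfR l hl0 hlt => ?_⟩
  rw [ENNReal.coe_toNNReal hCt]
  set I := ∫⁻ y, ‖f y‖ₑ with hI
  have hfi : Integrable f := int_of_bdd hf hfR
  have hIt : I ≠ ⊤ := hfi.2.ne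
  rcases eq_or_ne I 0 with hI0 | hI0
  · have hf0 : f =ᵐ[volume] 0 := by
      rw [hI, lintegral_eq_zero_iff hfm.enorm] at hI0
      filter_upwards [hI0] with x hx
      simpa using hx
    have h1 := cheb2 (T := T) hf l
    have h2 : ∫⁻ x, ‖f x‖ₑ ^ 2 = 0 := by
      rw [lintegral_eq_zero_iff (hfm.enorm.pow_const 2)]
      filter_upwards [hf0] with x hx
      simp [hx]
    rw [h2, mul_zero] at h1
    have h3 : volume {x | l ≤ ‖TT T f x‖ₑ} = 0 := by
      rcases mul_eq_zero.1 (le_antisymm h1 zero_le) with h | h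
      · exact absurd (pow_eq_zero_iff (two_ne_zero) |>.1 h) hl0
      · exact h
    have h4 : volume {z | l < ‖TT T f z‖ₑ} = 0 := by
      refine measure_mono_null (fun x hx => ?_) h3
      have hx : l < ‖TT T f x‖ₑ := hx
      exact hx.le
    rw [h4, mul_zero]
    exact zero_le
  obtain ⟨k0, hk0⟩ := exists_level n I l hIt hl0
  obtain ⟨S, hSc, hSd, hSP, hSm, hSv, hSl⟩ := stopping univ k0 (fun y => ‖f y‖ₑ) hfm.enorm hIt l
    (fun x _ => (setLIntegral_le_lintegral _ _).trans (hk0 x))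
  have hf2 : ∫⁻ x, ‖f x‖ₑ ^ 2 ≠ ⊤ := by
    rw [← sq_eLp]; exact ENNReal.pow_ne_top hf.2.ne
  have htail : ∑' P : S, ∫⁻ x in (P : Set (Rn n)), ‖f x‖ₑ ^ 2 ≠ ⊤ := by
    rw [← lintegral_sUnion' hSc hSm hSd]
    exact ne_top_of_le_ne_top hf2 (setLIntegral_le_lintegral _ _)
  have hpos : 0 < l * I := ENNReal.mul_pos hl0 hI0
  obtain ⟨F, hF⟩ := ((ENNReal.tendsto_tsum_compl_atTop_zero htail).eventually (gt_mem_nhds hpos)).exists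
  have hSum : ∑' P : S, ∫⁻ x in (P : Set (Rn n)), ‖f x‖ₑ ≤ I := by
    rw [← lintegral_sUnion' hSc hSm hSd]; exact setLIntegral_le_lintegral _ _
  have hSumF : ∑ P ∈ F, ∫⁻ x in (P : Set (Rn n)), ‖f x‖ₑ ≤ I := (ENNReal.sum_le_tsum F).trans hSum
  have hvt : ∀ P : S, volume (P : Set (Rn n)) ≠ ⊤ ∧ volume (P : Set (Rn n)) ≠ 0 := by
    intro P
    obtain ⟨k, x, -, -, h, -⟩ := hSP P P.2
    rw [h]; exact ⟨vol_dy_top k x, vol_dy_pos k x⟩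
  let av : S → ℝ := fun P => (∫ y in (P : Set (Rn n)), f y) / (volume (P : Set (Rn n))).toReal
  let h : S → Rn n → ℝ := fun P => (P : Set (Rn n)).indicator (fun z => f z - av P)
  have hav : ∀ P : S, ‖av P‖ₑ * volume (P : Set (Rn n)) ≤ ∫⁻ y in (P : Set (Rn n)), ‖f y‖ₑ := by
    intro P
    have hpos := ENNReal.toReal_pos (hvt P).2 (hvt P).1
    have : ‖av P‖ₑ * volume (P : Set (Rn n)) = ‖∫ y in (P : Set (Rn n)), f y‖ₑ := by
      rw [← ENNReal.ofReal_toReal (hvt P).1]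
      rw [← ofReal_norm, ← ofReal_norm, ← ENNReal.ofReal_mul (norm_nonneg _), Real.norm_eq_abs, Real.norm_eq_abs, abs_div,
        abs_of_pos hpos, div_mul_cancel₀ _ hpos.ne']
    rw [this]; exact enorm_integral_le_lintegral_enorm _
  have hav2 : ∀ P : S, ‖av P‖ₑ ≤ 2 ^ n * l := by
    intro P
    obtain ⟨k, x, -, -, -, h⟩ := hSP P P.2
    exact (ENNReal.mul_le_mul_iff_left (hvt P).2 (hvt P).1).1 ((hav P).trans h)
  have hhm : ∀ P, Measurable (h P) := fun P => (hfm.sub_const _).indicator (hSm P P.2)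
  have hhL : ∀ P, MemLp (h P) 2 volume := by
    intro P
    have e : h P = (P : Set (Rn n)).indicator f - (P : Set (Rn n)).indicator (fun _ => av P) := by
      rw [← indicator_sub']; rfl
    rw [e]
    exact (hf.indicator (hSm P P.2)).sub (memLp_indicator_const 2 (hSm P P.2) _ (Or.inr (hvt P).1))
  have hsumL : MemLp (∑ P ∈ F, h P) 2 volume := memLp_finsetSum' F fun P _ => hhL P
  have hhi : ∀ P, ∫ y, h P y = 0 := by
    intro P
    rw [integral_indicator (hSm P P.2), integral_sub hfi.integrableOn, setIntegral_const]
    · simp only [av, Measure.real, smul_eq_mul]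
      rw [mul_div_cancel₀, sub_self]
      exact (ENNReal.toReal_pos (hvt P).2 (hvt P).1).ne'
    · exact integrableOn_const (hvt P).1
  have hh1 : ∀ P, ∫⁻ y, ‖h P y‖ₑ ≤ 2 * ∫⁻ y in (P : Set (Rn n)), ‖f y‖ₑ := by
    intro P
    calc ∫⁻ y, ‖h P y‖ₑ = ∫⁻ y in (P : Set (Rn n)), ‖f y - av P‖ₑ := by
          rw [← lintegral_indicator (hSm P P.2)]
          simp only [h, enorm_indicator_eq_indicator_enorm]
      _ ≤ ∫⁻ y in (P : Set (Rn n)), (‖f y‖ₑ + ‖av P‖ₑ) := lintegral_mono fun y => enorm_sub_le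
      _ ≤ _ := by
          rw [lintegral_add_right _ measurable_const, lintegral_const, Measure.restrict_apply_univ, two_mul]
          gcongr
          exact hav P
  set g := f - ∑ P ∈ F, h P with hg
  have hgL : MemLp g 2 volume := hf.sub hsumL
  have hzero : ∀ P Q : S, P ≠ Q → ∀ z ∈ (P : Set (Rn n)), h Q z = 0 := by
    intro P Q hPQ z hz
    refine indicator_of_notMem (fun hz2 => ?_) _
    exact (Set.disjoint_left.1 (hSd P.2 Q.2 (fun e => hPQ (Subtype.ext e)))) hz hz2
  have hgP : ∀ P : S, P ∈ F → ∀ z ∈ (P : Set (Rn n)), g z = av P := by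
    intro P hP z hz
    rw [hg, Pi.sub_apply, Finset.sum_apply, Finset.sum_eq_single P (fun Q _ hQ => hzero P Q hQ.symm z hz) (fun h => absurd hP h)]
    simp [h, hz]
  have hgN : ∀ P : S, P ∉ F → ∀ z ∈ (P : Set (Rn n)), g z = f z := by
    intro P hP z hz
    rw [hg, Pi.sub_apply, Finset.sum_apply, Finset.sum_eq_zero fun Q hQ => hzero P Q (fun e => hP (e ▸ hQ)) z hz, sub_zero]
  have hgO : ∀ z ∉ ⋃₀ S, g z = f z := by
    intro z hz
    rw [hg, Pi.sub_apply, Finset.sum_apply, Finset.sum_eq_zero, sub_zero]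
    exact fun Q _ => indicator_of_notMem (fun hz2 => hz ⟨Q, Q.2, hz2⟩) _
  have hSM : MeasurableSet (⋃₀ S) := MeasurableSet.sUnion hSc hSm
  have hg2 : ∫⁻ x, ‖g x‖ₑ ^ 2 ≤ (2 ^ n + 2) * l * I := by
    rw [← lintegral_add_compl _ hSM, lintegral_sUnion' hSc hSm hSd, ← ENNReal.sum_add_tsum_compl F]
    have a1 : ∑ P ∈ F, ∫⁻ x in (P : Set (Rn n)), ‖g x‖ₑ ^ 2 ≤ 2 ^ n * l * I := by
      refine le_trans ?_ (mul_le_mul_right hSumF _)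
      rw [Finset.mul_sum]
      refine Finset.sum_le_sum fun P hP => ?_
      rw [setLIntegral_congr_fun (hSm P P.2) (fun x hx => by rw [hgP P hP x hx]), lintegral_const, Measure.restrict_apply_univ,
        pow_two, mul_assoc]
      exact mul_le_mul' (hav2 P) (hav P)
    have a2 : ∑' P : {P : S // P ∉ F}, ∫⁻ x in (P.1 : Set (Rn n)), ‖g x‖ₑ ^ 2 ≤ l * I := by
      refine le_trans (le_of_eq (tsum_congr fun P => ?_)) hF.le
      exact setLIntegral_congr_fun (hSm P.1 P.1.2) fun x hx => by rw [hgN P.1 P.2 x hx]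
    have a3 : ∫⁻ x in (⋃₀ S)ᶜ, ‖g x‖ₑ ^ 2 ≤ l * I := by
      refine le_trans ?_ (mul_le_mul_right (setLIntegral_le_lintegral (⋃₀ S)ᶜ _) _)
      rw [← lintegral_const_mul' _ _ hlt]
      refine setLIntegral_mono_ae' hSM.compl ?_
      filter_upwards [hSl] with x hx hxS
      rw [hgO x hxS, pow_two]
      gcongr
      exact hx trivial hxS
    calc _ ≤ 2 ^ n * l * I + l * I + l * I := add_le_add (add_le_add a1 a2) a3
      _ = _ := by ring
  choose kk xx hkk hxx hPe hPv using fun P : S => hSP P P.2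
  let E : Set (Rn n) := ⋃ P ∈ F, BB (kk P) (xx P)
  have hEm : MeasurableSet E := F.measurableSet_biUnion fun P _ => measurableSet_ball
  have hE : l * volume E ≤ cB n * I := by
    have : ∑ P ∈ F, volume (P : Set (Rn n)) ≤ volume (⋃₀ S) := by
      have := lintegral_sUnion' (μ := (volume : Measure (Rn n))) hSc hSm hSd (fun _ => 1)
      simp only [lintegral_const, one_mul, Measure.restrict_apply_univ] at this
      rw [this]; exact ENNReal.sum_le_tsum F
    calc l * volume E ≤ l * ∑ P ∈ F, volume (BB (kk P) (xx P)) := by gcongr; exact measure_biUnion_finset_le _ _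
      _ = cB n * (l * ∑ P ∈ F, volume (P : Set (Rn n))) := by
          have : ∀ P, volume (BB (kk P) (xx P)) = cB n * volume (P : Set (Rn n)) := fun P => by rw [vol_BB, ← hPe P]
          simp_rw [this]
          rw [← Finset.mul_sum]; ring
      _ ≤ cB n * I := by
          gcongr
          refine (mul_le_mul_right this l).trans (hSv.trans (setLIntegral_le_lintegral _ _))
  have hTh : ∫⁻ x in Eᶜ, ‖TT T (∑ P ∈ F, h P) x‖ₑ ≤ 2 * Cr * I := by
    calc _ ≤ ∫⁻ x in Eᶜ, ∑ P ∈ F, ‖TT T (h P) x‖ₑ := lintegral_mono_ae (ae_restrict_of_ae (TT_sum F h fun P _ => hhL P))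
      _ = ∑ P ∈ F, ∫⁻ x in Eᶜ, ‖TT T (h P) x‖ₑ := lintegral_finsetSum' _ fun P _ => (TT_sm _).enorm.restrict
      _ ≤ ∑ P ∈ F, Cr * (2 * ∫⁻ y in (P : Set (Rn n)), ‖f y‖ₑ) := by
          refine Finset.sum_le_sum fun P hP => ?_
          refine (lintegral_mono_set (compl_subset_compl.2 (subset_biUnion_of_mem (u := fun P => BB (kk P) (xx P)) hP))).trans ?_
          refine (atom hK hT (hhm P) (hhL P) (fun y hy => indicator_of_notMem (by rwa [hPe P]) _) (hhi P)).trans ?_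
          gcongr
          exact hh1 P
      _ = 2 * Cr * ∑ P ∈ F, ∫⁻ y in (P : Set (Rn n)), ‖f y‖ₑ := by
          rw [Finset.mul_sum]; refine Finset.sum_congr rfl fun _ _ => by ring
      _ ≤ _ := by gcongr
  have hdec : ∀ᵐ z, ‖TT T f z‖ₑ ≤ ‖TT T g z‖ₑ + ‖TT T (∑ P ∈ F, h P) z‖ₑ := by
    filter_upwards [TT_sub (T := T) hf hsumL] with z hz
    rw [← hg] at hz
    have : TT T f z = TT T g z + TT T (∑ P ∈ F, h P) z := by rw [hz, Pi.sub_apply]; ring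
    rw [this]; exact enorm_add_le _ _
  have hmain : volume {z | l < ‖TT T f z‖ₑ} ≤ volume {z | l / 2 ≤ ‖TT T g z‖ₑ} +
      (volume E + (volume.restrict Eᶜ) {z | l / 2 ≤ ‖TT T (∑ P ∈ F, h P) z‖ₑ}) := by
    rw [Measure.restrict_apply' hEm.compl]
    refine le_trans (measure_mono_ae ?_) ((measure_union_le _ _).trans (add_le_add_right (measure_union_le _ _) _))
    filter_upwards [hdec] with z hz hz2
    have hz2 : l < ‖TT T f z‖ₑ := hz2
    by_contra hcon
    change z ∉ {z | l / 2 ≤ ‖TT T g z‖ₑ} ∪ (E ∪ _) at hcon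
    simp only [mem_union, mem_inter_iff, mem_ofPred_eq, mem_compl_iff, not_or, not_and, not_not, not_le] at hcon
    have h3 : ‖TT T (∑ P ∈ F, h P) z‖ₑ < l/2 := by
      by_contra h4
      exact hcon.2.1 (hcon.2.2 (not_lt.1 h4))
    have := (hz2.trans_le hz).trans (ENNReal.add_lt_add hcon.1 h3)
    rw [ENNReal.add_halves] at this
    exact lt_irrefl _ this
  have b1 : l * volume {z | l / 2 ≤ ‖TT T g z‖ₑ} ≤ 4 * ‖T‖ₑ ^ 2 * (2 ^ n + 2) * I := by
    have h1 := (cheb2 (T := T) hgL (l/2)).trans (mul_le_mul_right hg2 _)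
    have h2 : l ^ 2 = 4 * (l/2)^2 := by
      have : l = 2 * (l/2) := (ENNReal.mul_div_cancel (by norm_num) (by norm_num)).symm
      nth_rw 1 [this]; ring
    refine (ENNReal.mul_le_mul_iff_right hl0 hlt).1 ?_
    calc l * (l * volume {z | l / 2 ≤ ‖TT T g z‖ₑ}) = 4 * ((l/2)^2 * volume {z | l / 2 ≤ ‖TT T g z‖ₑ}) := by
          rw [← mul_assoc, ← pow_two, h2]; ring
      _ ≤ 4 * (‖T‖ₑ ^ 2 * ((2 ^ n + 2) * l * I)) := by gcongr
      _ = _ := by ring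
  have b3 : l * (volume.restrict Eᶜ) {z | l / 2 ≤ ‖TT T (∑ P ∈ F, h P) z‖ₑ} ≤ 4 * Cr * I := by
    have h1 := (mul_meas_ge_le_lintegral₀ (μ := volume.restrict Eᶜ) (TT_sm (T := T) (∑ P ∈ F, h P)).enorm.restrict (l/2)).trans hTh
    have : l = 2 * (l/2) := (ENNReal.mul_div_cancel (by norm_num) (by norm_num)).symm
    calc _ = 2 * ((l/2) * (volume.restrict Eᶜ) {z | l / 2 ≤ ‖TT T (∑ P ∈ F, h P) z‖ₑ}) := by
          nth_rw 1 [this]; ring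
      _ ≤ 2 * (2 * Cr * I) := by gcongr
      _ = _ := by ring
  calc _ ≤ l * (volume {z | l / 2 ≤ ‖TT T g z‖ₑ} +
      (volume E + (volume.restrict Eᶜ) {z | l / 2 ≤ ‖TT T (∑ P ∈ F, h P) z‖ₑ})) := by gcongr
    _ = l * volume {z | l / 2 ≤ ‖TT T g z‖ₑ} + (l * volume E + l * (volume.restrict Eᶜ) {z | l / 2 ≤ ‖TT T (∑ P ∈ F, h P) z‖ₑ}) := by ring
    _ ≤ 4 * ‖T‖ₑ ^ 2 * (2 ^ n + 2) * I + (cB n * I + 4 * Cr * I) := by gcongr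
    _ = _ := by ring

end P5

section P6
open scoped NNReal
variable {n : ℕ} {T : Lp ℝ 2 (volume : Measure (Rn n)) →L[ℝ] Lp ℝ 2 (volume : Measure (Rn n))}
  {K : Rn n → Rn n → ℝ} {C₀ : ℝ} {Cr : ℝ≥0}

lemma tr_meas (x : Rn n) (ε : ℝ) : MeasurableSet {y : Rn n | ε ≤ dist x y} :=
  (isClosed_le continuous_const (by fun_prop)).measurableSet

lemma tr_eq (x : Rn n) (ε : ℝ) (F : Rn n → ℝ) (g : Rn n → ℝ) : ∫ y in {y : Rn n | ε ≤ dist x y}, F y * g y =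
    ∫ y, F y * {y : Rn n | ε ≤ dist x y}.indicator g y := by
  rw [← integral_indicator (tr_meas x ε)]
  refine integral_congr_ae (Eventually.of_forall fun y => ?_)
  by_cases h : ε ≤ dist x y <;> simp [indicator, h]

lemma vol_half (x : Rn n) {ε : ℝ} (hε : 0 < ε) : volume (ball x ε) = 2 ^ n * volume (ball x (ε/2)) := by
  have h : ENNReal.ofReal ε = 2 * ENNReal.ofReal (ε/2) := by
    rw [← ENNReal.ofReal_ofNat, ← ENNReal.ofReal_mul (by norm_num)]; congr 1; ring
  rw [vol_ball _ hε, vol_ball _ (half_pos hε), h, mul_pow, mul_assoc]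

lemma cotlar [NeZero n] (hK : GK C₀ Cr K) (hT : IsCZO n K T) : ∃ C : ℝ≥0, ∀ (f : Rn n → ℝ), Measurable f →
    MemLp f 2 volume → ∀ (c : Rn n) (R : ℝ), (∀ x, x ∉ ball c R → f x = 0) → ∀ l : ℝ≥0∞, l ≠ 0 → l ≠ ⊤ →
      l * volume {z | 4 * l < truncT K f z} ≤ C * ∫⁻ y, ‖f y‖ₑ := by
  obtain ⟨Cw, hCw⟩ := weakT hK hT
  obtain ⟨Cm, hCm⟩ := MM_weak (AI_vol (n := n))
  let d : ℝ≥0 := 8 * 2 ^ n * (Cw + 1 + Cr)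
  have hd0 : (d : ℝ≥0∞) ≠ 0 := by
    have : 0 < d := by positivity
    exact_mod_cast this.ne'
  have hd1 : Cw * 2 ^ n * (d:ℝ≥0∞)⁻¹ ≤ 8⁻¹ := by
    rw [← div_eq_mul_inv, ENNReal.div_le_iff hd0 ENNReal.coe_ne_top]
    simp only [d]; push_cast
    rw [← mul_assoc, ← mul_assoc, ENNReal.inv_mul_cancel (by norm_num) (by norm_num), one_mul, mul_comm]
    gcongr
    rw [add_assoc]; exact le_self_add
  have hd2 : Cr * (d:ℝ≥0∞)⁻¹ ≤ 1 := by
    rw [← div_eq_mul_inv]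
    refine ENNReal.div_le_of_le_mul ?_
    have : Cr ≤ d := by
      have h2 : (1:ℝ≥0) ≤ 8 * 2 ^ n := one_le_mul_of_one_le_of_one_le (by norm_num) (one_le_pow₀ (by norm_num))
      calc Cr ≤ Cw + 1 + Cr := le_add_self
        _ ≤ _ := le_mul_of_one_le_left zero_le h2
    rw [one_mul]; exact_mod_cast this
  refine ⟨8 * Cm * Cw + d * Cm, fun f hfm hf c R hfR l hl0 hlt => ?_⟩
  set I := ∫⁻ y, ‖f y‖ₑ
  set W := toMeasurable volume {z | l < ‖TT T f z‖ₑ} with hW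
  have hWm : MeasurableSet W := measurableSet_toMeasurable _ _
  have hsub : {z | 4 * l < truncT K f z} ⊆ {z | 8⁻¹ < MM volume (W.indicator 1) z} ∪
      {z | (d:ℝ≥0∞)⁻¹ * l < MM volume (fun y => ‖f y‖ₑ) z} := by
    intro x hx
    by_contra hcon
    simp only [mem_union, mem_ofPred_eq, not_or, not_lt] at hcon
    obtain ⟨hc1, hc2⟩ := hcon
    have hx : 4 * l < truncT K f x := hx
    refine absurd hx (not_lt.2 (iSup₂_le fun ε hε => ?_))
    set B := ball x (ε/2)
    have hBt : volume B ≠ ⊤ := measure_ball_lt_top.ne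
    have hB0 : volume B ≠ 0 := (measure_ball_pos volume x (half_pos hε)).ne'
    set f1 := (ball x ε).indicator f with hf1
    have hf1m : Measurable f1 := hfm.indicator measurableSet_ball
    have hf1L : MemLp f1 2 volume := hf.indicator measurableSet_ball
    set f2 := f - f1 with hf2
    have hf2m : Measurable f2 := hfm.sub hf1m
    have hf2L : MemLp f2 2 volume := hf.sub hf1L
    have hf2e : f2 = {y : Rn n | ε ≤ dist x y}.indicator f := by
      ext y
      by_cases h : dist x y < ε
      · have : ¬ ε ≤ dist x y := not_le.2 h
        simp [f2, f1, indicator, mem_ball, dist_comm y x, h, this]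
      · have : ε ≤ dist x y := not_lt.1 h
        simp [f2, f1, indicator, mem_ball, dist_comm y x, h, this]
    have hrep := rep hK hT hf2m hf2L (c := c) (R := R) (U := ball x ε) (fun y hy => by
      simp [hf2e, indicator, hfR y hy]) isOpen_ball (fun y hy => by simp [f2, f1, hy])
    have hv1 : volume (W ∩ B) ≤ 8⁻¹ * volume B := by
      have h1 := setI_le_MM (μ := volume) AI_vol.1 (W.indicator 1) (mem_ball_self (x := x) (half_pos hε))
      rw [lintegral_indicator_one hWm, Measure.restrict_apply hWm] at h1
      refine h1.trans ?_
      rw [mul_comm]; gcongr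
    have hv2 : volume {z | l < ‖TT T f1 z‖ₑ} ≤ 8⁻¹ * volume B := by
      have h1 := hCw f1 hf1m hf1L c R (fun y hy => by simp [f1, indicator, hfR y hy]) l hl0 hlt
      have h2 : ∫⁻ y, ‖f1 y‖ₑ = ∫⁻ y in ball x ε, ‖f y‖ₑ := by
        rw [← lintegral_indicator measurableSet_ball]
        simp only [f1, enorm_indicator_eq_indicator_enorm]
      have h3 := setI_le_MM (μ := volume) AI_vol.1 (fun y => ‖f y‖ₑ) (mem_ball_self (x := x) hε)
      rw [h2] at h1
      refine (ENNReal.mul_le_mul_iff_right hl0 hlt).1 (h1.trans ?_)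
      calc Cw * ∫⁻ y in ball x ε, ‖f y‖ₑ ≤ Cw * (volume (ball x ε) * ((d:ℝ≥0∞)⁻¹ * l)) := by
            gcongr
            exact h3.trans (by gcongr)
        _ = (Cw * 2 ^ n * (d:ℝ≥0∞)⁻¹) * (l * volume B) := by rw [vol_half x hε]; ring
        _ ≤ 8⁻¹ * (l * volume B) := by gcongr
        _ = _ := by ring
    obtain ⟨z, hzB, hzW, hz1, hz2, hz3⟩ : ∃ z ∈ B, z ∉ W ∧ ‖TT T f1 z‖ₑ ≤ l ∧
        (TT T f2 z = ∫ y, K z y * f2 y) ∧ TT T f2 z = TT T f z - TT T f1 z := by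
      by_contra hno
      push Not at hno
      have : volume B ≤ volume (W ∩ B) + volume {z | l < ‖TT T f1 z‖ₑ} := by
        refine le_trans (measure_mono_ae ?_) (measure_union_le _ _)
        filter_upwards [hrep, TT_sub (T := T) hf hf1L] with z h1 h2 hzB
        have hzB : z ∈ B := hzB
        by_cases hzW : z ∈ W
        · exact Or.inl ⟨hzW, hzB⟩
        · refine Or.inr ?_
          by_contra h3
          exact hno z hzB hzW (not_lt.1 h3) (h1 (ball_subset_ball (by linarith) hzB)) h2
      have h4 := this.trans (add_le_add hv1 hv2)
      rw [← add_mul] at h4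
      have h5 : (1:ℝ≥0∞) ≤ 8⁻¹ + 8⁻¹ := (ENNReal.mul_le_mul_iff_left hB0 hBt).1 (by rwa [one_mul])
      have h6 : (8⁻¹ + 8⁻¹ : ℝ≥0∞) < 1 := by
        have e : (8⁻¹ : ℝ≥0∞) = ((8⁻¹ : ℝ≥0) : ℝ≥0∞) := by rw [ENNReal.coe_inv (by norm_num)]; norm_num
        rw [e, ← ENNReal.coe_add]
        rw [show (1:ℝ≥0∞) = ((1:ℝ≥0):ℝ≥0∞) from rfl, ENNReal.coe_lt_coe, ← NNReal.coe_lt_coe]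
        push_cast; norm_num
      exact absurd h5 (not_le.2 h6)
    have hTf : ‖TT T f z‖ₑ ≤ l := by
      by_contra h
      exact hzW (subset_toMeasurable _ _ (not_le.1 h))
    have hf2i : Integrable f2 := int_of_bdd hf2L (c := c) (R := R) fun y hy => by simp [hf2e, indicator, hfR y hy]
    have hzx : dist x z ≤ ε/2 := by rw [dist_comm]; exact (mem_ball.1 hzB).le
    have hfar : ∀ y, f2 y ≠ 0 → ε ≤ dist x y := by
      intro y hy; by_contra h; exact hy (by simp [hf2e, indicator, h])
    have hi1 : Integrable (fun y => K x y * f2 y) := K_int hK hε hf2i hfar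
    have hi2 : Integrable (fun y => K z y * f2 y) := K_int hK (half_pos hε) hf2i fun y hy => by
      linarith [hfar y hy, dist_triangle x z y]
    rw [tr_eq, ← hf2e, ← Real.norm_eq_abs, ofReal_norm]
    have hdiff : ‖(∫ y, K x y * f2 y) - ∫ y, K z y * f2 y‖ₑ ≤ l := by
      rw [← integral_sub hi1 hi2]
      refine (enorm_integral_le_lintegral_enorm _).trans ?_
      calc _ = ∫⁻ y in {y | 2 * (ε/2) ≤ dist x y}, ENNReal.ofReal |K x y - K z y| * ‖f y‖ₑ := by
            rw [← lintegral_indicator (tr_meas _ _), mul_div_cancel₀ _ (by norm_num : (2:ℝ) ≠ 0)]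
            refine lintegral_congr fun y => ?_
            rw [← sub_mul, enorm_mul, hf2e]
            have h1 : ENNReal.ofReal |K x y - K z y| = ‖K x y - K z y‖ₑ := by
              rw [← Real.norm_eq_abs, ofReal_norm]
            by_cases h : ε ≤ dist x y <;> simp [indicator, h, h1]
        _ ≤ Cr * MM volume (fun y => ‖f y‖ₑ) x := hK.reg1 x z x (ε/2) _ (half_pos hε) hzx (mem_ball_self (by positivity)) hfm.enorm.aemeasurable
        _ ≤ Cr * ((d:ℝ≥0∞)⁻¹ * l) := by gcongr
        _ ≤ l := by rw [← mul_assoc]; exact mul_le_of_le_one_left zero_le hd2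
    have e : ∫ y, K x y * f2 y = ((∫ y, K x y * f2 y) - ∫ y, K z y * f2 y) + (TT T f z - TT T f1 z) := by
      rw [← hz3, hz2]; ring
    rw [e]
    calc _ ≤ l + (l + l) := (enorm_add_le _ _).trans (add_le_add hdiff (enorm_sub_le.trans (add_le_add hTf hz1)))
      _ ≤ l + (l + l) + l := le_self_add
      _ = 4 * l := by ring
  have hw1 : l * volume {z | 8⁻¹ < MM volume (W.indicator 1) z} ≤ 8 * Cm * Cw * I := by
    have h1 := hCm (W.indicator 1) 8⁻¹
    rw [lintegral_indicator_one hWm, hW, measure_toMeasurable] at h1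
    have h2 := hCw f hfm hf c R hfR l hl0 hlt
    calc _ = 8 * l * (8⁻¹ * volume {z | 8⁻¹ < MM volume (W.indicator 1) z}) := by
          rw [show 8 * l * (8⁻¹ * volume {z | 8⁻¹ < MM volume (W.indicator 1) z}) =
            (8 * 8⁻¹) * (l * volume {z | 8⁻¹ < MM volume (W.indicator 1) z}) by ring,
            ENNReal.mul_inv_cancel (by norm_num) (by norm_num), one_mul]
      _ ≤ 8 * l * (Cm * volume {z | l < ‖TT T f z‖ₑ}) := by gcongr
      _ = 8 * Cm * (l * volume {z | l < ‖TT T f z‖ₑ}) := by ring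
      _ ≤ 8 * Cm * (Cw * I) := by gcongr
      _ = _ := by ring
  have hw2 : l * volume {z | (d:ℝ≥0∞)⁻¹ * l < MM volume (fun y => ‖f y‖ₑ) z} ≤ d * Cm * I := by
    have h1 := hCm (fun y => ‖f y‖ₑ) ((d:ℝ≥0∞)⁻¹ * l)
    calc _ = d * ((d:ℝ≥0∞)⁻¹ * l * volume {z | (d:ℝ≥0∞)⁻¹ * l < MM volume (fun y => ‖f y‖ₑ) z}) := by
          rw [← mul_assoc, ← mul_assoc, ENNReal.mul_inv_cancel hd0 ENNReal.coe_ne_top, one_mul]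
      _ ≤ d * (Cm * I) := by gcongr
      _ = _ := by ring
  calc _ ≤ l * (volume {z | 8⁻¹ < MM volume (W.indicator 1) z} +
      volume {z | (d:ℝ≥0∞)⁻¹ * l < MM volume (fun y => ‖f y‖ₑ) z}) := by
        gcongr
        exact (measure_mono hsub).trans (measure_union_le _ _)
    _ ≤ 8 * Cm * Cw * I + d * Cm * I := by rw [mul_add]; exact add_le_add hw1 hw2
    _ = _ := by push_cast; ring

lemma weakTs [NeZero n] (hK : GK C₀ Cr K) (hT : IsCZO n K T) : ∃ C : ℝ≥0, ∀ (f : Rn n → ℝ), Measurable f →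
    Integrable f → ∀ l : ℝ≥0∞, l ≠ 0 → l ≠ ⊤ →
      l * volume {z | 4 * l < truncT K f z} ≤ C * ∫⁻ y, ‖f y‖ₑ := by
  obtain ⟨C, hC⟩ := cotlar hK hT
  refine ⟨C, fun f hfm hfi l hl0 hlt => ?_⟩
  let A : ℕ → Set (Rn n) := fun N => {x | ‖f x‖ ≤ N} ∩ ball 0 N
  have hA : ∀ N, MeasurableSet (A N) := fun N => (measurableSet_le hfm.norm measurable_const).inter measurableSet_ball
  let F : ℕ → Rn n → ℝ := fun N => (A N).indicator f
  have hFm : ∀ N, Measurable (F N) := fun N => hfm.indicator (hA N)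
  have hFL : ∀ N, MemLp (F N) 2 volume := by
    intro N
    rw [memLp_indicator_iff_restrict (hA N)]
    have : IsFiniteMeasure ((volume : Measure (Rn n)).restrict (A N)) := ⟨by
      rw [Measure.restrict_apply_univ]
      exact (measure_mono inter_subset_right).trans_lt measure_ball_lt_top⟩
    refine MemLp.of_bound hfm.aestronglyMeasurable N ?_
    filter_upwards [ae_restrict_mem (hA N)] with x hx
    exact hx.1
  have hFb : ∀ (N : ℕ) x, x ∉ ball (0:Rn n) (N:ℝ) → F N x = 0 := fun N x hx => indicator_of_notMem (fun h => hx h.2) _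
  have hFle : ∀ N x, ‖F N x‖ ≤ ‖f x‖ := fun N x => norm_indicator_le_norm_self _ _
  have hFlim : ∀ x, ∀ᶠ N in atTop, F N x = f x := by
    intro x
    obtain ⟨N0, hN0⟩ := exists_nat_gt (max ‖f x‖ ‖x‖)
    filter_upwards [eventually_ge_atTop N0] with N hN
    have hN' : (N0:ℝ) ≤ N := by exact_mod_cast hN
    refine indicator_of_mem (show x ∈ A N from ⟨?_, ?_⟩) _
    · exact ((le_max_left _ _).trans hN0.le).trans hN'
    · rw [mem_ball_zero_iff]; exact ((le_max_right _ _).trans_lt hN0).trans_le hN'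
  have hsub : {z | 4 * l < truncT K f z} ⊆ ⋃ N, ⋂ M ≥ N, {z | 4 * l < truncT K (F M) z} := by
    intro x hx
    simp only [mem_ofPred_eq, truncT, lt_iSup_iff] at hx
    obtain ⟨ε, hε, hx⟩ := hx
    have hi : IntegrableOn (fun y => K x y * f y) {y | ε ≤ dist x y} := by
      have := K_int hK (z := x) hε (hfi.indicator (tr_meas x ε)) (fun y hy => by
        by_contra h; exact hy (indicator_of_notMem (show y ∉ {y | ε ≤ dist x y} from h) _))
      rw [← integrable_indicator_iff (tr_meas x ε)]
      refine this.congr (Eventually.of_forall fun y => ?_)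
      by_cases h : ε ≤ dist x y <;> simp [indicator, h]
    have hlim : Tendsto (fun N => ∫ y in {y | ε ≤ dist x y}, K x y * F N y) atTop (𝓝 (∫ y in {y | ε ≤ dist x y}, K x y * f y)) := by
      refine tendsto_integral_of_dominated_convergence (fun y => ‖K x y * f y‖) (fun N => ?_) hi.norm (fun N => ?_) ?_
      · exact ((Kmz hK x).mul (hFm N)).aestronglyMeasurable
      · refine Eventually.of_forall fun y => ?_
        rw [norm_mul, norm_mul]; gcongr; exact hFle N y
      · refine Eventually.of_forall fun y => ?_
        refine tendsto_const_nhds.congr' ?_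
        filter_upwards [hFlim y] with N hN
        rw [hN]
    have hlim2 := (ENNReal.tendsto_ofReal hlim.abs).eventually (lt_mem_nhds hx)
    obtain ⟨N, hN⟩ := eventually_atTop.1 hlim2
    simp only [mem_iUnion, mem_iInter]
    refine ⟨N, fun M hM => lt_of_lt_of_le (hN M hM) (le_iSup₂_of_le ε hε le_rfl)⟩
  have hmono : Monotone fun N => ⋂ M ≥ N, {z | 4 * l < truncT K (F M) z} := by
    intro N N' h x hx
    simp only [mem_iInter] at hx ⊢
    exact fun M hM => hx M (h.trans hM)
  calc _ ≤ l * volume (⋃ N, ⋂ M ≥ N, {z | 4 * l < truncT K (F M) z}) := by gcongr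
    _ ≤ _ := by
      rw [hmono.measure_iUnion, ENNReal.mul_iSup]
      refine iSup_le fun N => ?_
      calc _ ≤ l * volume {z | 4 * l < truncT K (F N) z} := by
            refine mul_le_mul_right (measure_mono fun x hx => ?_) _
            simp only [mem_iInter] at hx
            exact hx N le_rfl
        _ ≤ C * ∫⁻ y, ‖F N y‖ₑ := hC (F N) (hFm N) (hFL N) 0 N (hFb N) l hl0 hlt
        _ ≤ _ := by
          gcongr with y
          rw [enorm_le_iff_norm_le]; exact hFle N y

lemma grand [NeZero n] (hK : GK C₀ Cr K) : ∃ C : ℝ≥0, ∀ (g : Rn n → ℝ), Measurable g → Integrable g →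
    ∀ (k : ℤ) (x z : Rn n), z ∈ dy k x → truncT K ((BB k x)ᶜ.indicator g) x ≤
      truncT K g z + C * MM volume (fun y => ‖g y‖ₑ) z := by
  have hCt : Cr + ENNReal.ofReal C₀ * 4 ^ n * volume (ball (0 : Rn n) 1) ≠ ⊤ := by
    have : volume (ball (0 : Rn n) 1) ≠ ⊤ := measure_ball_lt_top.ne
    finiteness
  refine ⟨(Cr + ENNReal.ofReal C₀ * 4 ^ n * volume (ball (0 : Rn n) 1)).toNNReal, fun g hgm hgi k x z hz => ?_⟩
  rw [ENNReal.coe_toNNReal hCt]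
  refine iSup₂_le fun ε hε => ?_
  set δ := rad n k with hδd
  have hδ : 0 < δ := rad_pos k
  set e := max ε (3 * δ) with he
  have he0 : 0 < e := lt_max_of_lt_left hε
  have h3e : 3 * δ ≤ e := le_max_right _ _
  have hxz : dist x z ≤ δ := by rw [dist_comm]; exact dist_dy hz
  have hxc := dist_ctr k x
  rw [tr_eq]
  set F1 := {y : Rn n | ε ≤ dist x y}.indicator ((BB k x)ᶜ.indicator g) with hF1
  set F2 := {y : Rn n | e ≤ dist z y}.indicator g with hF2
  have hF1i : Integrable F1 := (hgi.indicator measurableSet_ball.compl).indicator (tr_meas _ _)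
  have hF2i : Integrable F2 := hgi.indicator (tr_meas _ _)
  have hF1v : ∀ y, F1 y ≠ 0 → e ≤ dist x y ∧ 4 * δ ≤ dist y (ctr k x) ∧ F1 y = g y := by
    intro y hy
    by_cases h1 : ε ≤ dist x y
    · by_cases h2 : y ∈ BB k x
      · exact absurd (by simp [hF1, indicator, h2]) hy
      · have h3 : 4 * δ ≤ dist y (ctr k x) := not_lt.1 h2
        refine ⟨max_le h1 ?_, h3, by simp [hF1, indicator, h1, h2]⟩
        linarith [dist_triangle y x (ctr k x), dist_comm x y]
    · exact absurd (by simp [hF1, indicator, h1]) hy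
  have hF1v' : ∀ y, e ≤ dist x y → 4 * δ ≤ dist y (ctr k x) → F1 y = g y := by
    intro y h1 h2
    have h3 : ε ≤ dist x y := (le_max_left _ _).trans h1
    have h4 : y ∉ BB k x := not_lt.2 h2
    simp [hF1, indicator, h3, h4]
  have hi1 : Integrable (fun y => K x y * F1 y) := K_int hK he0 hF1i fun y hy => (hF1v y hy).1
  have hi2 : Integrable (fun y => K z y * F2 y) := K_int hK he0 hF2i fun y hy => by
    by_contra h; exact hy (indicator_of_notMem (show y ∉ {y | e ≤ dist z y} from h) _)
  have hpt : ∀ y, ‖K x y * F1 y - K z y * F2 y‖ₑ ≤ {y | 2 * δ ≤ dist x y}.indicator (fun y => ENNReal.ofReal |K x y - K z y| * ‖g y‖ₑ) y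
      + ENNReal.ofReal (C₀ / (e/2)^n) * (ball z (2*e)).indicator (fun y => ‖g y‖ₑ) y := by
    intro y
    have hKz : e/2 ≤ dist z y → ‖K z y‖ₑ ≤ ENNReal.ofReal (C₀ / (e/2)^n) := fun h => by
      rw [← ofReal_norm]; exact ENNReal.ofReal_le_ofReal (K_le hK (half_pos he0) h)
    by_cases h1 : e ≤ dist x y ∧ 4 * δ ≤ dist y (ctr k x)
    · have hv := hF1v' y h1.1 h1.2
      have h2d : 2 * δ ≤ dist x y := by linarith [h1.1]
      rw [hv, indicator_of_mem (show y ∈ {y | 2 * δ ≤ dist x y} from h2d)]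
      by_cases h2 : e ≤ dist z y
      · have : F2 y = g y := indicator_of_mem (show y ∈ {y | e ≤ dist z y} from h2) _
        rw [this, ← sub_mul, enorm_mul, ← ofReal_norm, Real.norm_eq_abs]
        exact le_self_add
      · have h0 : F2 y = 0 := indicator_of_notMem (show y ∉ {y | e ≤ dist z y} from h2) _
        rw [h0, mul_zero, sub_zero, indicator_of_mem (by rw [mem_ball']; linarith [not_le.1 h2]), ← add_mul, enorm_mul]
        gcongr
        rw [← Real.norm_eq_abs, ofReal_norm]
        calc ‖K x y‖ₑ = ‖(K x y - K z y) + K z y‖ₑ := by rw [sub_add_cancel]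
          _ ≤ _ := (enorm_add_le _ _).trans (add_le_add_right (hKz (by linarith [dist_triangle x z y, h1.1])) _)
    · have h0 : F1 y = 0 := by
        by_contra h; exact h1 ⟨(hF1v y h).1, (hF1v y h).2.1⟩
      rw [h0, mul_zero, zero_sub, enorm_neg, enorm_mul]
      by_cases h2 : e ≤ dist z y
      · have hF : F2 y = g y := indicator_of_mem (show y ∈ {y | e ≤ dist z y} from h2) _
        have hb : y ∈ ball z (2*e) := by
          rw [mem_ball']
          by_cases h3 : e ≤ dist x y
          · have h4 : dist y (ctr k x) < 4 * δ := by by_contra h4; exact h1 ⟨h3, not_lt.1 h4⟩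
            have h5 := dist_dy_ctr hz
            linarith [dist_triangle z (ctr k x) y, dist_comm y (ctr k x)]
          · linarith [dist_triangle z x y, dist_comm x z, not_le.1 h3]
        rw [hF, indicator_of_mem hb]
        refine le_trans ?_ le_add_self
        gcongr
        exact hKz (by linarith)
      · have hF : F2 y = 0 := indicator_of_notMem (show y ∉ {y | e ≤ dist z y} from h2) _
        rw [hF]; simp
  have hgr : AEMeasurable (fun y => ‖g y‖ₑ) := hgm.enorm.aemeasurable
  have hdiff : ‖(∫ y, K x y * F1 y) - ∫ y, K z y * F2 y‖ₑ ≤ (Cr + ENNReal.ofReal C₀ * 4 ^ n * volume (ball (0 : Rn n) 1)) * MM volume (fun y => ‖g y‖ₑ) z := by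
    rw [← integral_sub hi1 hi2]
    refine (enorm_integral_le_lintegral_enorm _).trans ((lintegral_mono hpt).trans ?_)
    rw [lintegral_add_right _ ((hgm.enorm.indicator measurableSet_ball).const_mul _), lintegral_indicator (tr_meas _ _),
      lintegral_const_mul _ (hgm.enorm.indicator measurableSet_ball), lintegral_indicator measurableSet_ball, add_mul]
    refine add_le_add (hK.reg1 x z z δ _ hδ hxz ?_ hgr) ?_
    · rw [mem_ball']; linarith
    · refine (mul_le_mul_right (setI_le_MM AI_vol.1 _ (mem_ball_self (by positivity))) _).trans (le_of_eq ?_)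
      rw [← mul_assoc]
      congr 1
      rw [vol_ball _ (by positivity), ← mul_assoc, ← ENNReal.ofReal_pow (by positivity), ← ENNReal.ofReal_mul (div_nonneg hK.c0 (by positivity))]
      congr 1
      rw [show (4:ℝ≥0∞)^n = ENNReal.ofReal (4^n) by rw [ENNReal.ofReal_pow (by norm_num)]; simp, ← ENNReal.ofReal_mul hK.c0]
      congr 1
      rw [div_pow, mul_pow, show (4:ℝ) = 2 * 2 by norm_num, mul_pow]
      field_simp
  have h2 : ‖∫ y, K z y * F2 y‖ₑ ≤ truncT K g z := by
    rw [hF2, ← tr_eq, ← ofReal_norm, Real.norm_eq_abs]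
    exact le_iSup₂_of_le (f := fun ε (_ : 0 < ε) => ENNReal.ofReal |∫ y in {y : Rn n | ε ≤ dist z y}, K z y * g y|) e he0 le_rfl
  rw [← Real.norm_eq_abs, ofReal_norm]
  calc _ = ‖(∫ y, K z y * F2 y) + ((∫ y, K x y * F1 y) - ∫ y, K z y * F2 y)‖ₑ := by congr 1; ring
    _ ≤ _ := (enorm_add_le _ _).trans (add_le_add h2 hdiff)

end P6

section P7
open scoped NNReal
variable {n : ℕ}

structure Wt (p : ℝ) (A : ℝ≥0) (w : Rn n → ℝ≥0) : Prop where
  hp : 1 < p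
  meas : Measurable w
  pos : ∀ x, 0 < w x
  fin : ∀ c r, ∫⁻ x in ball c r, (w x : ℝ≥0∞) ≠ ⊤
  fin' : ∀ c r, ∫⁻ x in ball c r, ((w x ^ (1 - p / (p - 1)) : ℝ≥0) : ℝ≥0∞) ≠ ⊤
  ap : ∀ c r, 0 < r → (∫⁻ x in ball c r, (w x : ℝ≥0∞)) *
    (∫⁻ x in ball c r, ((w x ^ (1 - p / (p - 1)) : ℝ≥0) : ℝ≥0∞)) ^ (p - 1) ≤ A * volume (ball c r) ^ p

def wm (w : Rn n → ℝ≥0) : Measure (Rn n) := volume.withDensity fun x => (w x : ℝ≥0∞)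

def wd (p : ℝ) (w : Rn n → ℝ≥0) : Rn n → ℝ≥0 := fun x => w x ^ (1 - p / (p - 1))

lemma wm_ac (w : Rn n → ℝ≥0) : wm w ≪ volume := withDensity_absolutelyContinuous _ _

instance (w : Rn n → ℝ≥0) : SFinite (wm w) := by unfold wm; infer_instance

lemma wm_apply (w : Rn n → ℝ≥0) {E : Set (Rn n)} (hE : MeasurableSet E) : wm w E = ∫⁻ x in E, (w x : ℝ≥0∞) :=
  withDensity_apply _ hE

lemma wm_lint {w : Rn n → ℝ≥0} (hw : Measurable w) (g : Rn n → ℝ≥0∞) :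
    ∫⁻ x, g x ∂(wm w) = ∫⁻ x, w x * g x := by
  rw [wm, lintegral_withDensity_eq_lintegral_mul_non_measurable _ hw.coe_nnreal_ennreal
    (Eventually.of_forall fun x => ENNReal.coe_lt_top)]
  rfl

lemma wm_pos {w : Rn n → ℝ≥0} (hw : Measurable w) (h : ∀ x, 0 < w x) {E : Set (Rn n)} (hE : MeasurableSet E)
    (h0 : volume E ≠ 0) : wm w E ≠ 0 := by
  rw [wm_apply w hE]
  intro h1
  rw [lintegral_eq_zero_iff hw.coe_nnreal_ennreal] at h1
  apply h0
  rw [← Measure.restrict_eq_zero, ← ae_eq_bot, ← Filter.eventually_false_iff_eq_bot]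
  filter_upwards [h1] with x hx
  have : w x = 0 := by simpa using hx
  exact (h x).ne' this

lemma Wt.wdm {p : ℝ} {A : ℝ≥0} {w : Rn n → ℝ≥0} (h : Wt p A w) : Measurable (wd p w) := by
  unfold wd; exact h.meas.pow_const _

lemma Wt.wdp {p : ℝ} {A : ℝ≥0} {w : Rn n → ℝ≥0} (h : Wt p A w) (x : Rn n) : 0 < wd p w x :=
  NNReal.rpow_pos (h.pos x)

lemma Wt.hold {p : ℝ} {A : ℝ≥0} {w : Rn n → ℝ≥0} (h : Wt p A w) {E : Set (Rn n)} (hE : MeasurableSet E) :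
    volume E ^ p ≤ wm w E * wm (wd p w) E ^ (p - 1) := by
  have hp := h.hp
  have hc : p.HolderConjugate (p / (p - 1)) := Real.HolderConjugate.conjExponent hp
  have h1 := ENNReal.lintegral_mul_le_Lp_mul_Lq (volume.restrict E) hc
    (f := fun x => (w x : ℝ≥0∞) ^ (1/p)) (g := fun x => (w x : ℝ≥0∞) ^ (-(1/p)))
    (by exact (h.meas.coe_nnreal_ennreal.pow_const _).aemeasurable) (by exact (h.meas.coe_nnreal_ennreal.pow_const _).aemeasurable)
  have hp0 : 0 < p := by linarith
  have hp1 : p - 1 ≠ 0 := by linarith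
  have e1 : ∫⁻ x in E, ((fun x => (w x : ℝ≥0∞) ^ (1/p)) * (fun x => (w x : ℝ≥0∞) ^ (-(1/p)))) x = volume E := by
    rw [← setLIntegral_one]
    refine lintegral_congr fun x => ?_
    have : (w x : ℝ≥0∞) ≠ 0 := by exact_mod_cast (h.pos x).ne'
    simp only [Pi.mul_apply]
    rw [← ENNReal.rpow_add _ _ this ENNReal.coe_ne_top, add_neg_cancel, ENNReal.rpow_zero]
  have e2 : ∀ x, ((w x : ℝ≥0∞) ^ (1/p)) ^ p = w x := fun x => by
    rw [← ENNReal.rpow_mul, one_div_mul_cancel hp0.ne', ENNReal.rpow_one]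
  have e3 : ∀ x, ((w x : ℝ≥0∞) ^ (-(1/p))) ^ (p/(p-1)) = wd p w x := fun x => by
    rw [← ENNReal.rpow_mul, wd, ENNReal.coe_rpow_of_ne_zero (h.pos x).ne']
    congr 1; field_simp; ring
  rw [e1] at h1
  simp only [e2, e3] at h1
  rw [← wm_apply w hE, ← wm_apply _ hE] at h1
  calc volume E ^ p ≤ (wm w E ^ (1/p) * wm (wd p w) E ^ (1/(p/(p-1)))) ^ p := by gcongr
    _ = _ := by
      rw [ENNReal.mul_rpow_of_nonneg _ _ hp0.le, ← ENNReal.rpow_mul, ← ENNReal.rpow_mul,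
        one_div_mul_cancel hp0.ne', ENNReal.rpow_one]
      congr 2; field_simp

lemma Wt.ap' {p : ℝ} {A : ℝ≥0} {w : Rn n → ℝ≥0} (h : Wt p A w) (c : Rn n) {r : ℝ} (hr : 0 < r) :
    wm w (ball c r) * wm (wd p w) (ball c r) ^ (p - 1) ≤ A * volume (ball c r) ^ p := by
  rw [wm_apply _ measurableSet_ball, wm_apply _ measurableSet_ball]; exact h.ap c r hr

lemma Wt.key {p : ℝ} {A : ℝ≥0} {w : Rn n → ℝ≥0} (h : Wt p A w) (c : Rn n) {r : ℝ} (hr : 0 < r) {L : ℝ≥0}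
    {E : Set (Rn n)} (hE : MeasurableSet E) (hL : volume (ball c r) ≤ L * volume E) :
    wm w (ball c r) * wm (wd p w) (ball c r) ^ (p - 1) ≤ ((A * L ^ p : ℝ≥0) : ℝ≥0∞) * (wm w E * wm (wd p w) E ^ (p - 1)) := by
  have hp0 : 0 ≤ p := by linarith [h.hp]
  calc _ ≤ A * volume (ball c r) ^ p := h.ap' c hr
    _ ≤ A * (L * volume E) ^ p := by gcongr
    _ = ((A * L ^ p : ℝ≥0) : ℝ≥0∞) * volume E ^ p := by
      rw [ENNReal.mul_rpow_of_nonneg _ _ hp0, ENNReal.coe_mul, ENNReal.coe_rpow_of_nonneg _ hp0, mul_assoc]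
    _ ≤ _ := by gcongr; exact h.hold hE

lemma Wt.fb {p : ℝ} {A : ℝ≥0} {w : Rn n → ℝ≥0} (h : Wt p A w) (c : Rn n) (r : ℝ) : wm w (ball c r) ≠ ⊤ := by
  rw [wm_apply _ measurableSet_ball]; exact h.fin c r

lemma Wt.fb' {p : ℝ} {A : ℝ≥0} {w : Rn n → ℝ≥0} (h : Wt p A w) (c : Rn n) (r : ℝ) : wm (wd p w) (ball c r) ≠ ⊤ := by
  rw [wm_apply _ measurableSet_ball]; exact h.fin' c r

lemma Wt.ai {p : ℝ} {A : ℝ≥0} {w : Rn n → ℝ≥0} (h : Wt p A w) : AI (wm w) := by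
  refine ⟨h.fb, fun L => ⟨A * L ^ p, fun c r hr E hEs hE hL => ?_⟩⟩
  have hp1 : 0 < p - 1 := by linarith [h.hp]
  have hb0 := wm_pos h.wdm h.wdp measurableSet_ball (measure_ball_pos volume c hr).ne'
  have h0 : wm (wd p w) (ball c r) ^ (p-1) ≠ 0 := by
    rw [Ne, ENNReal.rpow_eq_zero_iff_of_pos hp1]; exact hb0
  have ht : wm (wd p w) (ball c r) ^ (p-1) ≠ ⊤ := ENNReal.rpow_ne_top_of_nonneg hp1.le (h.fb' c r)
  refine (ENNReal.mul_le_mul_iff_left h0 ht).1 ((h.key c hr hE hL).trans ?_)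
  rw [mul_assoc]
  gcongr

lemma Wt.ai' {p : ℝ} {A : ℝ≥0} {w : Rn n → ℝ≥0} (h : Wt p A w) : AI (wm (wd p w)) := by
  have hp1 : 0 < p - 1 := by linarith [h.hp]
  refine ⟨h.fb', fun L => ⟨(A * L ^ p) ^ (1/(p-1)), fun c r hr E hEs hE hL => ?_⟩⟩
  have hb0 := wm_pos h.meas h.pos measurableSet_ball (measure_ball_pos volume c hr).ne'
  have h1 : wm (wd p w) (ball c r) ^ (p-1) ≤ ((A * L ^ p : ℝ≥0) : ℝ≥0∞) * wm (wd p w) E ^ (p-1) := by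
    refine (ENNReal.mul_le_mul_iff_right hb0 (h.fb c r)).1 ((h.key c hr hE hL).trans ?_)
    rw [mul_left_comm]
    gcongr
  have h2 := ENNReal.rpow_le_rpow h1 (show 0 ≤ 1/(p-1) by positivity)
  rw [ENNReal.mul_rpow_of_nonneg _ _ (by positivity), ← ENNReal.rpow_mul, ← ENNReal.rpow_mul,
    mul_one_div_cancel hp1.ne', ENNReal.rpow_one, ENNReal.rpow_one, ← ENNReal.coe_rpow_of_nonneg _ (by positivity)] at h2
  exact h2

lemma exists_wt {p : ℝ} (hp : 1 < p) {ω : Rn n → ℝ} (hω : IsAp n p ω) : ∃ (A : ℝ≥0) (w : Rn n → ℝ≥0), Wt p A w ∧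
    wMeasure n ω = wm w := by
  obtain ⟨hpos, hloc, A, hA, hcube⟩ := hω
  have hm := hloc.aestronglyMeasurable
  let w0 := hm.mk ω
  have hw0 : Measurable w0 := hm.stronglyMeasurable_mk.measurable
  let w : Rn n → ℝ≥0 := fun x => if 0 < w0 x then (w0 x).toNNReal else 1
  have hwm : Measurable w := Measurable.ite (measurableSet_lt measurable_const hw0) hw0.real_toNNReal measurable_const
  have hwp : ∀ x, 0 < w x := fun x => by
    by_cases h : 0 < w0 x
    · simp [w, h]
    · simp [w, h]
  have hae : ∀ᵐ x, ENNReal.ofReal (ω x) = w x ∧ ENNReal.ofReal (ω x ^ (1 - p / (p - 1))) = ((w x ^ (1 - p / (p - 1)) : ℝ≥0) : ℝ≥0∞) := by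
    filter_upwards [hpos, hm.ae_eq_mk] with x hx hx2
    have h0 : 0 < w0 x := by rw [← show ω x = w0 x from hx2]; exact hx
    have e : w x = (ω x).toNNReal := by
      simp only [w, h0, if_true]; rw [show ω x = w0 x from hx2]
    rw [e]
    refine ⟨rfl, ?_⟩
    rw [ENNReal.ofReal, Real.toNNReal_rpow_of_nonneg hx.le]
  have hp1 : 0 < p - 1 := by linarith
  have hsub : ∀ (c : Rn n) r, ball c r ⊆ cube c (2 * r) := by
    intro c r x hx i
    rw [mem_ball, EuclideanSpace.dist_eq] at hx
    have : |x i - c i| ≤ √(∑ i, dist (x i) (c i) ^ 2) := by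
      refine Real.le_sqrt_of_sq_le ?_
      rw [sq_abs]
      refine le_trans (le_of_eq ?_) (Finset.single_le_sum (f := fun i => dist (x i) (c i) ^ 2) (fun i _ => sq_nonneg _) (Finset.mem_univ i))
      rw [Real.dist_eq, sq_abs]
    linarith
  set V := volume (ball (0:Rn n) 1)
  have hV0 : V ≠ 0 := (measure_ball_pos volume _ one_pos).ne'
  have hVt : V ≠ ⊤ := measure_ball_lt_top.ne
  have key : ∀ c r, 0 < r → (∫⁻ x in ball c r, (w x : ℝ≥0∞)) *
    (∫⁻ x in ball c r, ((w x ^ (1 - p / (p - 1)) : ℝ≥0) : ℝ≥0∞)) ^ (p - 1) ≤ A * (2 ^ n * V⁻¹) ^ p * volume (ball c r) ^ p := by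
    intro c r hr
    have h1 := hcube c (2 * r) (by positivity)
    set t := ENNReal.ofReal ((2*r)^n) with ht
    have ht0 : t ≠ 0 := by rw [ht, Ne, ENNReal.ofReal_eq_zero, not_le]; positivity
    have htt : t ≠ ⊤ := ENNReal.ofReal_ne_top
    set X := ∫⁻ x in cube c (2*r), ENNReal.ofReal (ω x)
    set Y := ∫⁻ x in cube c (2*r), ENNReal.ofReal (ω x ^ (1 - p / (p - 1)))
    have e1 : X * Y ^ (p-1) = t ^ p * (X / t * (Y / t) ^ (p-1)) := by
      rw [ENNReal.div_rpow_of_nonneg _ _ hp1.le]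
      have : t ^ p = t * t ^ (p-1) := by
        conv_rhs => rw [← ENNReal.rpow_one t, ← ENNReal.rpow_mul, ← ENNReal.rpow_add _ _ ht0 htt]
        congr 1; ring
      have h0' : t ^ (p-1) ≠ 0 := by rw [Ne, ENNReal.rpow_eq_zero_iff_of_pos hp1]; exact ht0
      have ht' : t ^ (p-1) ≠ ⊤ := ENNReal.rpow_ne_top_of_nonneg hp1.le htt
      rw [this, mul_mul_mul_comm, ENNReal.mul_div_cancel ht0 htt, ENNReal.mul_div_cancel h0' ht']
    have e2 : t = 2 ^ n * V⁻¹ * volume (ball c r) := by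
      rw [vol_ball _ hr, ht, ENNReal.ofReal_pow (by positivity), ENNReal.ofReal_mul (by norm_num), mul_pow]
      rw [show 2 ^ n * V⁻¹ * (ENNReal.ofReal r ^ n * V) = 2 ^ n * ENNReal.ofReal r ^ n * (V * V⁻¹) by ring, ENNReal.mul_inv_cancel hV0 hVt]
      simp
    calc _ = (∫⁻ x in ball c r, ENNReal.ofReal (ω x)) * (∫⁻ x in ball c r, ENNReal.ofReal (ω x ^ (1 - p / (p - 1)))) ^ (p-1) := by
          congr 1
          · exact lintegral_congr_ae (ae_restrict_of_ae (hae.mono fun x hx => hx.1.symm))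
          · congr 1
            exact lintegral_congr_ae (ae_restrict_of_ae (hae.mono fun x hx => hx.2.symm))
      _ ≤ X * Y ^ (p-1) := by
          gcongr
          · exact lintegral_mono_set (hsub c r)
          · exact lintegral_mono_set (hsub c r)
      _ ≤ t ^ p * A := by rw [e1]; gcongr
      _ = _ := by rw [e2, ENNReal.mul_rpow_of_nonneg _ _ (by linarith : 0 ≤ p)]; ring
  have hC : A * (2 ^ n * V⁻¹) ^ p ≠ ⊤ := ENNReal.mul_ne_top hA (ENNReal.rpow_ne_top_of_nonneg (by linarith) (by finiteness))
  have hfin : ∀ c r, ∫⁻ x in ball c r, (w x : ℝ≥0∞) ≠ ⊤ := by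
    intro c r
    rw [← lintegral_congr_ae (ae_restrict_of_ae (hae.mono fun x hx => hx.1))]
    have : IntegrableOn ω (ball c r) := (hloc.integrableOn_isCompact (isCompact_closedBall c r)).mono_set ball_subset_closedBall
    exact (lt_of_le_of_lt (lintegral_mono fun x => by rw [← ofReal_norm]; exact ENNReal.ofReal_le_ofReal (le_abs_self _)) this.2).ne
  refine ⟨(A * (2 ^ n * V⁻¹) ^ p).toNNReal, w, ⟨hp, hwm, hwp, hfin, ?_, ?_⟩, ?_⟩
  · intro c r
    by_cases hr : 0 < r
    · intro hcon
      have h1 := key c r hr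
      have h0 := wm_pos hwm hwp measurableSet_ball (measure_ball_pos volume c hr).ne'
      rw [wm_apply _ measurableSet_ball] at h0
      rw [hcon, ENNReal.top_rpow_of_pos hp1, ENNReal.mul_top h0, top_le_iff] at h1
      exact ENNReal.mul_ne_top hC (ENNReal.rpow_ne_top_of_nonneg (by linarith) measure_ball_lt_top.ne) h1
    · rw [ball_eq_empty.2 (not_lt.1 hr)]; simp
  · rw [ENNReal.coe_toNNReal hC]; exact key
  · exact withDensity_congr_ae (hae.mono fun x hx => hx.1)

end P7

section P8
open scoped NNReal
variable {n : ℕ}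

def mb (b : Rn n → ℝ) (c : Rn n) (r : ℝ) : ℝ := ⨍ y in ball c r, b y

def NB (b : Rn n → ℝ) : Prop := Measurable b ∧
  ∀ c r, 0 < r → ∫⁻ y in ball c r, ‖b y - mb b c r‖ₑ ≤ volume (ball c r)

def mQ (b : Rn n → ℝ) (k : ℤ) (x : Rn n) : ℝ := mb b (ctr k x) (4 * rad n k)

lemma mQ_eq (b : Rn n → ℝ) {k : ℤ} {x y : Rn n} (h : y ∈ dy k x) : mQ b k y = mQ b k x := by
  rw [mQ, mQ, ctr_eq h]

lemma NB.bb [NeZero n] {b : Rn n → ℝ} (h : NB b) (k : ℤ) (x : Rn n) :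
    ∫⁻ y in BB k x, ‖b y - mQ b k x‖ₑ ≤ cB n * volume (dy k x) := by
  rw [← vol_BB]; exact h.2 _ _ (by linarith [rad_pos (n := n) k])

lemma enorm_tri (a b c : ℝ) : ‖a - c‖ₑ ≤ ‖b - a‖ₑ + ‖b - c‖ₑ := by
  rw [show a - c = (b - c) - (b - a) by ring, add_comm]; exact enorm_sub_le

lemma avg_diff {b : Rn n → ℝ} (hb : Measurable b) {E : Set (Rn n)} (hE0 : volume E ≠ 0)
    (hEt : volume E ≠ ⊤) {a c : ℝ} {L M : ℝ≥0∞} (h1 : ∫⁻ y in E, ‖b y - a‖ₑ ≤ L * volume E)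
    (h2 : ∫⁻ y in E, ‖b y - c‖ₑ ≤ M * volume E) : ‖a - c‖ₑ ≤ L + M := by
  refine (ENNReal.mul_le_mul_iff_left hE0 hEt).1 ?_
  rw [← setLIntegral_const, add_mul]
  refine le_trans ?_ (add_le_add h1 h2)
  rw [← lintegral_add_left (by fun_prop)]
  exact lintegral_mono fun y => enorm_tri a (b y) c

lemma NB.sub {b : Rn n → ℝ} (h : NB b) {c c' : Rn n} {r r' : ℝ} (hr : 0 < r) (hr' : 0 < r')
    (hs : ball c r ⊆ ball c' r') {L : ℝ≥0∞} (hL : volume (ball c' r') ≤ L * volume (ball c r)) :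
    ‖mb b c r - mb b c' r'‖ₑ ≤ 1 + L := by
  refine avg_diff h.1 (measure_ball_pos volume c hr).ne' measure_ball_lt_top.ne ?_ ?_
  · rw [one_mul]; exact h.2 c r hr
  · exact (lintegral_mono_set hs).trans ((h.2 c' r' hr').trans hL)

lemma AI.small [NeZero n] {μ : Measure (Rn n)} (h : AI μ) : ∃ κ C : ℝ≥0, κ < 1 ∧ ∀ k x (U : Set (Rn n)),
    MeasurableSet U → U ⊆ dy k x → 2 * volume U ≤ volume (dy k x) →
      μ U ≤ κ * μ (dy k x) ∧ μ (BB k x) ≤ C * μ (dy k x \ U) := by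
  obtain ⟨C, hC⟩ := h.2 (2 * (cB n).toNNReal)
  refine ⟨C / (C + 1), C, by rw [div_lt_one (by positivity)]; simp, fun k x U hU hs hv => ?_⟩
  have hQt := vol_dy_top k x
  have hBt : μ (BB k x) ≠ ⊤ := h.1 _ _
  have hQmt : μ (dy k x) ≠ ⊤ := ((measure_mono (dy_sub_BB k x)).trans_lt hBt.lt_top).ne
  have h1 : volume (dy k x) ≤ 2 * volume (dy k x \ U) := by
    have e : volume (dy k x) = volume U + volume (dy k x \ U) := by
      rw [← measure_inter_add_sdiff (dy k x) hU, inter_eq_self_of_subset_right hs]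
    have hUt : volume U ≠ ⊤ := ((measure_mono hs).trans_lt hQt.lt_top).ne
    have h3 : volume U ≤ volume (dy k x \ U) := by
      rw [e, two_mul] at hv
      exact (ENNReal.add_le_add_iff_left hUt).1 hv
    rw [e, two_mul]
    exact add_le_add_left h3 _
  have h2 : μ (BB k x) ≤ C * μ (dy k x \ U) := by
    refine hC _ _ (by linarith [rad_pos (n := n) k]) _ (sdiff_subset.trans (dy_sub_BB k x)) ((dy_meas k x).diff hU) ?_
    rw [show ball (ctr k x) (4 * rad n k) = BB k x from rfl, vol_BB, ENNReal.coe_mul, ENNReal.coe_toNNReal cB_top]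
    calc _ ≤ cB n * (2 * volume (dy k x \ U)) := by gcongr
      _ = _ := by push_cast; ring
  refine ⟨?_, h2⟩
  have e : μ (dy k x) = μ U + μ (dy k x \ U) := by
    rw [← measure_inter_add_sdiff (dy k x) hU, inter_eq_self_of_subset_right hs]
  have h3 : (C + 1 : ℝ≥0∞) * μ U ≤ C * μ (dy k x) := by
    calc (C + 1 : ℝ≥0∞) * μ U = C * μ U + μ U := by ring
      _ ≤ C * μ U + C * μ (dy k x \ U) := by
        gcongr
        exact (measure_mono (hs.trans (dy_sub_BB k x))).trans h2
      _ = _ := by rw [e]; ring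
  rw [ENNReal.coe_div (by positivity), ENNReal.coe_add, ENNReal.coe_one]
  have hc0 : (C + 1 : ℝ≥0∞) ≠ 0 := by simp
  have hct : (C + 1 : ℝ≥0∞) ≠ ⊤ := by finiteness
  refine (ENNReal.mul_le_mul_iff_right hc0 hct).1 (h3.trans (le_of_eq ?_))
  rw [← mul_assoc, ENNReal.mul_div_cancel hc0 hct]

lemma cB_pos [NeZero n] : cB n ≠ 0 := by
  intro h
  have := vol_BB (n := n) 0 0
  rw [h, zero_mul] at this
  exact vol_dy_pos (n := n) 0 0 (measure_mono_null (dy_sub_BB 0 0) this)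

lemma JN1 [NeZero n] {μ : Measure (Rn n)} (h : AI μ) (hac : μ ≪ volume) : ∃ κ A : ℝ≥0, κ < 1 ∧ ∀ b : Rn n → ℝ, NB b →
    ∀ (j : ℕ) k x, μ (dy k x ∩ {y | (j * A : ℝ≥0∞) < ‖b y - mQ b k x‖ₑ}) ≤ κ ^ j * μ (dy k x) := by
  obtain ⟨κ, C, hκ, hsm⟩ := h.small
  refine ⟨κ, ((1 + 2 ^ n * 2) * cB n).toNNReal, hκ, fun b hb j => ?_⟩
  have hAt : (1 + 2 ^ n * 2) * cB n ≠ ⊤ := by have := cB_top (n := n); finiteness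
  rw [ENNReal.coe_toNNReal hAt]
  set A := (1 + 2 ^ n * 2) * cB n with hA
  induction j with
  | zero => intro k x; rw [pow_zero, one_mul]; exact measure_mono inter_subset_left
  | succ j ih =>
    intro k x
    set g := (dy k x).indicator fun y => ‖b y - mQ b k x‖ₑ with hg
    have hgm : Measurable g := by
      refine Measurable.indicator ?_ (dy_meas k x)
      have := hb.1; fun_prop
    have hgi : ∫⁻ y, g y ≤ cB n * volume (dy k x) := by
      rw [hg, lintegral_indicator (dy_meas k x)]
      exact (lintegral_mono_set (dy_sub_BB k x)).trans (hb.bb k x)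
    have hgt : ∫⁻ y, g y ≠ ⊤ := (hgi.trans_lt (by have := cB_top (n := n); have := vol_dy_top k x; finiteness)).ne
    obtain ⟨S, hSc, hSd, hSP, hSm, hSv, hSa⟩ := stopping (dy k x) k g hgm hgt (2 * cB n) (fun y hy => by
      rw [dy_eq hy]
      refine (setLIntegral_le_lintegral _ _).trans (hgi.trans ?_)
      gcongr; exact le_mul_of_one_le_left zero_le (by norm_num))
    have hSs : ∀ P ∈ S, P ⊆ dy k x := by
      intro P hP
      obtain ⟨l, z, hl, hz, rfl, -⟩ := hSP P hP
      rw [← dy_eq hz]; exact dy_anti hl.le z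
    have hU : MeasurableSet (⋃₀ S) := MeasurableSet.sUnion hSc hSm
    have hUs : ⋃₀ S ⊆ dy k x := sUnion_subset hSs
    have hv : 2 * volume (⋃₀ S) ≤ volume (dy k x) := by
      refine (ENNReal.mul_le_mul_iff_right (cB_pos (n := n)) cB_top).1 ?_
      calc _ = 2 * cB n * volume (⋃₀ S) := by ring
        _ ≤ _ := hSv.trans ((setLIntegral_le_lintegral _ _).trans hgi)
    obtain ⟨hκU, -⟩ := hsm k x _ hU hUs hv
    have hsub : μ (dy k x ∩ {y | ((j+1 : ℕ) * A : ℝ≥0∞) < ‖b y - mQ b k x‖ₑ}) ≤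
        ∑' P : S, μ (P ∩ (⋃₀ S ∩ {y | ((j+1 : ℕ) * A : ℝ≥0∞) < ‖b y - mQ b k x‖ₑ})) := by
      calc _ ≤ μ (⋃ P : S, (P ∩ (⋃₀ S ∩ {y | ((j+1 : ℕ) * A : ℝ≥0∞) < ‖b y - mQ b k x‖ₑ}))) := by
            refine measure_mono_ae ?_
            filter_upwards [hac.ae_le hSa] with y hy hyQ
            have h1 : y ∈ dy k x := hyQ.1
            have h2 : ((j+1 : ℕ) * A : ℝ≥0∞) < ‖b y - mQ b k x‖ₑ := hyQ.2
            have hyU : y ∈ ⋃₀ S := by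
              by_contra hcon
              have h3 := hy h1 hcon
              rw [hg, indicator_of_mem h1] at h3
              refine absurd (h2.trans_le h3) (not_lt.2 ?_)
              calc 2 * cB n ≤ A := by
                    rw [hA]; gcongr
                    refine le_trans ?_ le_add_self
                    exact le_mul_of_one_le_left zero_le (one_le_pow₀ (by norm_num))
                _ ≤ _ := le_mul_of_one_le_left zero_le (by exact_mod_cast Nat.succ_pos j)
            obtain ⟨P, hP, hyP⟩ := hyU
            exact mem_iUnion.2 ⟨⟨P, hP⟩, hyP, ⟨P, hP, hyP⟩, h2⟩
        _ ≤ _ := by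
          have := hSc.to_subtype
          exact measure_iUnion_le _
    refine hsub.trans ?_
    calc _ ≤ ∑' P : S, κ ^ j * μ P := by
          refine ENNReal.tsum_le_tsum ?_
          rintro ⟨P, hP⟩
          obtain ⟨l, z, hl, hz, rfl, hint⟩ := hSP P hP
          refine le_trans (measure_mono ?_) (ih l z)
          rintro y ⟨hy, -, hy2⟩
          refine ⟨hy, ?_⟩
          have hy2 : ((j+1 : ℕ) * A : ℝ≥0∞) < ‖b y - mQ b k x‖ₑ := hy2
          have hd : ‖mQ b l z - mQ b k x‖ₑ ≤ A := by
            refine (avg_diff hb.1 (vol_dy_pos l z) (vol_dy_top l z) (L := cB n) (M := 2 ^ n * (2 * cB n)) ?_ ?_).trans (le_of_eq ?_)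
            · exact (lintegral_mono_set (dy_sub_BB l z)).trans (hb.bb l z)
            · refine le_trans (le_of_eq ?_) hint
              refine setLIntegral_congr_fun (dy_meas l z) fun u hu => ?_
              rw [hg, indicator_of_mem (hSs _ hP hu)]
            · rw [hA]; ring
          change (j * A : ℝ≥0∞) < ‖b y - mQ b l z‖ₑ
          by_contra hcon
          refine absurd hy2 (not_lt.2 ?_)
          calc ‖b y - mQ b k x‖ₑ = ‖(b y - mQ b l z) + (mQ b l z - mQ b k x)‖ₑ := by congr 1; ring
            _ ≤ j * A + A := (enorm_add_le _ _).trans (add_le_add (not_lt.1 hcon) hd)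
            _ = _ := by push_cast; ring
      _ = κ ^ j * μ (⋃₀ S) := by
          rw [ENNReal.tsum_mul_left, measure_sUnion hSc (fun a ha b hb => hSd ha hb) hSm]
      _ ≤ κ ^ j * (κ * μ (dy k x)) := by gcongr
      _ = _ := by ring

lemma JN2 [NeZero n] {μ : Measure (Rn n)} (h : AI μ) (hac : μ ≪ volume) (q : ℕ) : ∃ C : ℝ≥0, ∀ b : Rn n → ℝ, NB b →
    ∀ k x, ∫⁻ y in dy k x, (1 + ‖b y - mQ b k x‖ₑ) ^ q ∂μ ≤ C * μ (dy k x) := by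
  obtain ⟨κ, A, hκ, hJ⟩ := JN1 h hac
  have hs : Summable fun j : ℕ => (1 + (j + 1) * (A + 1)) ^ q * κ ^ j := by
    have h1 : Summable fun j : ℕ => ((1 + (j + 1) * (A + 1)) ^ q * κ ^ j : ℝ) := by
      have h2 := (summable_pow_mul_geometric_of_norm_lt_one q (r := (κ:ℝ)) (by simpa using hκ))
      have h3 := (summable_nat_add_iff 1).2 h2
      by_cases hk0 : (κ:ℝ) = 0
      · refine summable_of_ne_finset_zero (s := {0}) fun j hj => ?_
        have : j ≠ 0 := by simpa using hj
        simp [hk0, this]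
      · have h5 : Summable fun j : ℕ => ((1 + (A + 1)) ^ q * (κ:ℝ)⁻¹ : ℝ) * (((j + 1 : ℕ):ℝ) ^ q * (κ:ℝ) ^ (j+1)) := h3.mul_left _
        refine Summable.of_nonneg_of_le (fun j => by positivity) (fun j => ?_) h5
        have e : ((1 + (A + 1)) ^ q * (κ:ℝ)⁻¹ : ℝ) * (((j + 1 : ℕ):ℝ) ^ q * (κ:ℝ) ^ (j+1)) = ((1 + (A + 1)) * (j+1)) ^ q * (κ:ℝ) ^ j := by
          rw [mul_pow]; push_cast; field_simp; ring
        rw [e]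
        gcongr
        nlinarith [A.2, (Nat.cast_nonneg j : (0:ℝ) ≤ j)]
    exact_mod_cast h1
  refine ⟨∑' j : ℕ, (1 + (j + 1) * (A + 1)) ^ q * κ ^ j, fun b hb k x => ?_⟩
  have hbm := hb.1
  rw [ENNReal.coe_tsum hs, ← ENNReal.tsum_mul_right]
  set g := fun y => ‖b y - mQ b k x‖ₑ with hg
  have hgm : Measurable g := by fun_prop
  have hsetm : ∀ j : ℕ, MeasurableSet {y | (j * A : ℝ≥0∞) < g y} := fun j => measurableSet_lt measurable_const hgm
  have hpt : ∀ y, (1 + g y) ^ q ≤ ∑' j : ℕ, ((1 + (j + 1) * (A + 1)) ^ q : ℝ≥0∞) * (({y | (j * A : ℝ≥0∞) < g y} ∪ (if j = 0 then univ else ∅)).indicator 1 y) := by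
    intro y
    have hex : ∃ j : ℕ, g y ≤ (j + 1) * (A + 1) := by
      have : g y ≠ ⊤ := enorm_ne_top
      obtain ⟨j, hj⟩ := ENNReal.exists_nat_gt this
      refine ⟨j, hj.le.trans ?_⟩
      calc (j:ℝ≥0∞) ≤ (j + 1) * 1 := by rw [mul_one]; exact le_self_add
        _ ≤ _ := by gcongr; exact le_add_self
    classical
    let j := Nat.find hex
    have hj := Nat.find_spec hex
    refine le_trans ?_ (ENNReal.le_tsum j)
    have hmem : y ∈ {y | (j * A : ℝ≥0∞) < g y} ∪ (if j = 0 then univ else ∅) := by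
      rcases Nat.eq_zero_or_pos j with h0 | h0
      · right; simp [h0]
      · left
        change (j * A : ℝ≥0∞) < g y
        have h1 := Nat.find_min hex (m := j - 1) (by omega)
        rw [not_le] at h1
        refine lt_of_le_of_lt ?_ h1
        have : ((j - 1 : ℕ) : ℝ≥0∞) + 1 = j := by
          have : j - 1 + 1 = j := by omega
          exact_mod_cast this
        rw [this]; gcongr; exact le_self_add
    rw [indicator_of_mem hmem, Pi.one_apply, mul_one]
    gcongr
  calc ∫⁻ y in dy k x, (1 + g y) ^ q ∂μ ≤ ∫⁻ y in dy k x, ∑' j : ℕ, ((1 + (j + 1) * (A + 1)) ^ q : ℝ≥0∞) * (({y | (j * A : ℝ≥0∞) < g y} ∪ (if j = 0 then univ else ∅)).indicator 1 y) ∂μ :=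
        lintegral_mono hpt
    _ = ∑' j : ℕ, ∫⁻ y in dy k x, ((1 + (j + 1) * (A + 1)) ^ q : ℝ≥0∞) * (({y | (j * A : ℝ≥0∞) < g y} ∪ (if j = 0 then univ else ∅)).indicator 1 y) ∂μ := by
        refine lintegral_tsum fun j => ?_
        refine (Measurable.const_mul (measurable_one.indicator ((hsetm j).union ?_)) _).aemeasurable
        split_ifs <;> simp
    _ ≤ _ := by
        refine ENNReal.tsum_le_tsum fun j => ?_
        have hm : MeasurableSet ({y | (j * A : ℝ≥0∞) < g y} ∪ (if j = 0 then univ else ∅)) := by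
          refine (hsetm j).union ?_
          split_ifs <;> simp
        rw [lintegral_const_mul _ (measurable_one.indicator hm), lintegral_indicator_one hm, Measure.restrict_apply hm]
        push_cast
        rw [mul_assoc]
        gcongr
        rcases Nat.eq_zero_or_pos j with h0 | h0
        · subst h0; simp
        · rw [if_neg (by omega), union_empty, inter_comm]; exact hJ b hb j k x

lemma NB.near [NeZero n] {b : Rn n → ℝ} (hb : NB b) {k : ℤ} {x y : Rn n} (hy : y ∈ BB k x) :
    ‖mQ b k y - mQ b k x‖ₑ ≤ 2 * (1 + 3 ^ n) := by
  have hr := rad_pos (n := n) k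
  have hv : ∀ z : Rn n, volume (ball (ctr k x) (12 * rad n k)) ≤ 3 ^ n * volume (ball (ctr k z) (4 * rad n k)) := by
    intro z
    rw [vol_ball (ctr k x) (by positivity), vol_ball (ctr k z) (by positivity), ← mul_assoc, ← mul_pow,
      show (12:ℝ) * rad n k = 3 * (4 * rad n k) by ring, ENNReal.ofReal_mul (by norm_num), ENNReal.ofReal_ofNat]
  have hy' : dist y (ctr k x) < 4 * rad n k := hy
  have h1 := hb.sub (c := ctr k y) (c' := ctr k x) (r := 4 * rad n k) (r' := 12 * rad n k) (by positivity) (by positivity)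
    (ball_subset_ball' (by linarith [dist_triangle_left (ctr k y) (ctr k x) y, dist_ctr k y])) (hv y)
  have h2 := hb.sub (c := ctr k x) (c' := ctr k x) (r := 4 * rad n k) (r' := 12 * rad n k) (by positivity) (by positivity)
    (ball_subset_ball (by linarith)) (hv x)
  rw [show mQ b k y - mQ b k x = (mQ b k y - mb b (ctr k x) (12 * rad n k)) - (mQ b k x - mb b (ctr k x) (12 * rad n k)) by ring, two_mul]
  exact enorm_sub_le.trans (add_le_add h1 h2)

lemma JN3 [NeZero n] {μ : Measure (Rn n)} (h : AI μ) (hac : μ ≪ volume) (q : ℕ) : ∃ C : ℝ≥0, ∀ b : Rn n → ℝ, NB b →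
    ∀ k x, ∫⁻ y in BB k x, (1 + ‖b y - mQ b k x‖ₑ) ^ q ∂μ ≤ C * μ (dy k x) := by
  obtain ⟨C, hC⟩ := JN2 h hac q
  obtain ⟨κ, C2, -, hsm⟩ := h.small
  obtain ⟨C3, hC3⟩ := h.dbl 3 (by norm_num)
  refine ⟨(1 + 2 * (1 + 3 ^ n)) ^ q * C * (C3 * C2), fun b hb k x => ?_⟩
  have hr := rad_pos (n := n) k
  let S : Set (Set (Rn n)) := {R | ∃ y, y ∈ BB k x ∧ R = dy k y}
  have hSc : S.Countable := dy_countable.mono (by rintro P ⟨y, -, h⟩; exact ⟨k, y, h⟩)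
  have hSm : ∀ P ∈ S, MeasurableSet P := by
    rintro P ⟨y, -, rfl⟩; exact dy_meas _ _
  have hSd : S.PairwiseDisjoint id := by
    rintro P ⟨y, hy, rfl⟩ P' ⟨y', hy', rfl⟩ hne
    by_contra hcon
    obtain ⟨z, hz, hz'⟩ := Set.not_disjoint_iff.1 hcon
    exact hne (by rw [← dy_eq hz, ← dy_eq hz'])
  have hcov : BB k x ⊆ ⋃₀ S := fun y hy => ⟨dy k y, ⟨y, hy, rfl⟩, mem_dy _ _⟩
  have hin : ⋃₀ S ⊆ ball (ctr k x) (((3:ℝ≥0):ℝ) * (4 * rad n k)) := by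
    rintro z ⟨P, ⟨y, hy, rfl⟩, hz⟩
    have hy' : dist y (ctr k x) < 4 * rad n k := hy
    rw [mem_ball]
    push_cast
    linarith [dist_dy hz, dist_triangle z y (ctr k x)]
  calc _ ≤ ∫⁻ y in ⋃₀ S, (1 + ‖b y - mQ b k x‖ₑ) ^ q ∂μ := lintegral_mono_set hcov
    _ = ∑' P : S, ∫⁻ y in (P : Set (Rn n)), (1 + ‖b y - mQ b k x‖ₑ) ^ q ∂μ := lintegral_sUnion' hSc hSm hSd _
    _ ≤ ∑' P : S, (1 + 2 * (1 + 3 ^ n)) ^ q * C * μ P := by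
        refine ENNReal.tsum_le_tsum ?_
        rintro ⟨P, y, hy, rfl⟩
        calc _ ≤ ∫⁻ u in dy k y, (1 + 2 * (1 + 3 ^ n)) ^ q * (1 + ‖b u - mQ b k y‖ₑ) ^ q ∂μ := by
              refine lintegral_mono fun u => ?_
              rw [← mul_pow]
              gcongr
              calc 1 + ‖b u - mQ b k x‖ₑ = 1 + ‖(b u - mQ b k y) + (mQ b k y - mQ b k x)‖ₑ := by congr 2; ring
                _ ≤ 1 + (‖b u - mQ b k y‖ₑ + 2 * (1 + 3 ^ n)) := by
                  gcongr
                  exact (enorm_add_le _ _).trans (by gcongr; exact hb.near hy)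
                _ ≤ 1 + (‖b u - mQ b k y‖ₑ + 2 * (1 + 3 ^ n)) + 2 * (1 + 3 ^ n) * ‖b u - mQ b k y‖ₑ := le_self_add
                _ = _ := by ring
          _ = (1 + 2 * (1 + 3 ^ n)) ^ q * ∫⁻ u in dy k y, (1 + ‖b u - mQ b k y‖ₑ) ^ q ∂μ :=
              lintegral_const_mul' _ _ (by finiteness)
          _ ≤ _ := by rw [mul_assoc]; gcongr; exact hC b hb k y
    _ = (1 + 2 * (1 + 3 ^ n)) ^ q * C * μ (⋃₀ S) := by
          rw [ENNReal.tsum_mul_left, measure_sUnion hSc (fun a ha b hb => hSd ha hb) hSm]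
    _ ≤ (1 + 2 * (1 + 3 ^ n)) ^ q * C * (C3 * (C2 * μ (dy k x))) := by
          gcongr
          refine (measure_mono hin).trans ((hC3 _ _ (by positivity)).trans ?_)
          gcongr
          have := (hsm k x ∅ MeasurableSet.empty (empty_subset _) (by simp)).2
          rwa [sdiff_empty] at this
    _ = _ := by push_cast; ring

end P8

section P9
open scoped NNReal
variable {n : ℕ}

lemma wm_slint {w : Rn n → ℝ≥0} (hw : Measurable w) (g : Rn n → ℝ≥0∞) {E : Set (Rn n)} (hE : MeasurableSet E) :
    ∫⁻ x in E, g x ∂(wm w) = ∫⁻ x in E, w x * g x := by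
  rw [wm, restrict_withDensity hE, lintegral_withDensity_eq_lintegral_mul_non_measurable _ hw.coe_nnreal_ennreal
    (Eventually.of_forall fun x => ENNReal.coe_lt_top)]
  rfl

lemma hol [NeZero n] {μ : Measure (Rn n)} (h : AI μ) (hac : μ ≪ volume) (q : ℕ) {r : ℝ} (hqr : (q:ℝ).HolderConjugate r) :
    ∃ C : ℝ≥0, ∀ b : Rn n → ℝ, NB b → ∀ g : Rn n → ℝ≥0∞, Measurable g → ∀ k x u, u ∈ BB k x →
      ∫⁻ y in BB k x, (1 + ‖b y - mQ b k x‖ₑ) * g y ∂μ ≤ C * μ (BB k x) * (MM μ (fun y => g y ^ r) u) ^ (1/r) := by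
  obtain ⟨C, hC⟩ := JN3 h hac q
  have hq0 : (0:ℝ) < q := hqr.pos
  have hr0 : 0 < r := hqr.symm.pos
  refine ⟨C ^ (1/(q:ℝ)), fun b hb g hg k x u hu => ?_⟩
  have hbm := hb.1
  have h1 := ENNReal.lintegral_mul_le_Lp_mul_Lq (μ.restrict (BB k x)) hqr
    (f := fun y => 1 + ‖b y - mQ b k x‖ₑ) (g := g) (by fun_prop) hg.aemeasurable
  refine h1.trans ?_
  simp only [ENNReal.rpow_natCast]
  have hB0t : μ (BB k x) ≠ ⊤ := h.1 _ _
  calc _ ≤ (C * μ (BB k x)) ^ (1/(q:ℝ)) * (μ (BB k x) * MM μ (fun y => g y ^ r) u) ^ (1/r) := by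
        refine mul_le_mul' ?_ ?_
        · refine ENNReal.rpow_le_rpow ((hC b hb k x).trans ?_) (by positivity)
          gcongr; exact dy_sub_BB k x
        · refine ENNReal.rpow_le_rpow (setI_le_MM h.1 _ hu) (by positivity)
    _ = C ^ (1/(q:ℝ)) * (μ (BB k x) ^ (1/(q:ℝ)) * μ (BB k x) ^ (1/r)) * (MM μ (fun y => g y ^ r) u) ^ (1/r) := by
        rw [ENNReal.mul_rpow_of_nonneg _ _ (by positivity), ENNReal.mul_rpow_of_nonneg _ _ (by positivity)]; ring
    _ = _ := by
        rw [← ENNReal.rpow_add_of_nonneg _ _ (by positivity) (by positivity), one_div, one_div, hqr.inv_add_inv_eq_one, ENNReal.rpow_one,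
          ENNReal.coe_rpow_of_nonneg _ (by positivity)]

lemma Wt.pw1 {p : ℝ} {A : ℝ≥0} {w : Rn n → ℝ≥0} (h : Wt p A w) (x : Rn n) :
    (w x : ℝ≥0∞) * ((w x : ℝ≥0∞)⁻¹) ^ (p/(p-1)) = wd p w x := by
  have h0 : (w x : ℝ≥0∞) ≠ 0 := by exact_mod_cast (h.pos x).ne'
  rw [ENNReal.inv_rpow, ← ENNReal.rpow_neg, wd, ENNReal.coe_rpow_of_ne_zero (h.pos x).ne']
  nth_rewrite 1 [← ENNReal.rpow_one (w x : ℝ≥0∞)]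
  rw [← ENNReal.rpow_add _ _ h0 ENNReal.coe_ne_top]; rfl

lemma Wt.pw2 {p : ℝ} {A : ℝ≥0} {w : Rn n → ℝ≥0} (h : Wt p A w) (x : Rn n) :
    (wd p w x : ℝ≥0∞) * ((wd p w x : ℝ≥0∞)⁻¹) ^ p = w x := by
  have h0 : (wd p w x : ℝ≥0∞) ≠ 0 := by exact_mod_cast (h.wdp x).ne'
  rw [ENNReal.inv_rpow, ← ENNReal.rpow_neg]
  nth_rewrite 1 [← ENNReal.rpow_one (wd p w x : ℝ≥0∞)]
  rw [← ENNReal.rpow_add _ _ h0 ENNReal.coe_ne_top, wd, ENNReal.coe_rpow_of_ne_zero (h.pos x).ne', ← ENNReal.rpow_mul]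
  have : (1 - p / (p-1)) * (1 + -p) = 1 := by
    have : p - 1 ≠ 0 := by linarith [h.hp]
    field_simp; ring
  rw [this, ENNReal.rpow_one]

lemma GG [NeZero n] {p : ℝ} {A : ℝ≥0} {w : Rn n → ℝ≥0} (h : Wt p A w) (q : ℕ) {r : ℝ} (hqr : (q:ℝ).HolderConjugate r)
    (hrp : r < p) : ∃ C : ℝ≥0, ∀ F : Rn n → ℝ≥0∞, Measurable F → ∃ G : Rn n → ℝ≥0∞, Measurable G ∧
      (∫⁻ x, G x ^ p ∂(wm w) ≤ C * ∫⁻ x, F x ^ p ∂(wm w)) ∧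
      ∀ b, NB b → ∀ k x z, z ∈ BB k x →
        ∫⁻ y in BB k x, (1 + ‖b y - mQ b k x‖ₑ) * F y ≤ C * volume (BB k x) * G z := by
  have hp1 : 0 < p - 1 := by linarith [h.hp]
  have hp0 : 0 < p := by linarith [h.hp]
  have hr0 : 0 < r := hqr.symm.pos
  obtain ⟨C1, hC1⟩ := MM_strong h.ai (p/(p-1)) (by rw [lt_div_iff₀ hp1]; linarith)
  obtain ⟨C2, hC2⟩ := MM_strong h.ai' (p/r) (by rw [lt_div_iff₀ hr0]; linarith)
  obtain ⟨C3, hC3⟩ := hol h.ai' (wm_ac _) q hqr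
  set s := wd p w with hs
  have hs0 : ∀ x, (s x : ℝ≥0∞) ≠ 0 := fun x => by exact_mod_cast (h.wdp x).ne'
  have hw0 : ∀ x, (w x : ℝ≥0∞) ≠ 0 := fun x => by exact_mod_cast (h.pos x).ne'
  refine ⟨C1 * C2 + (C3 ^ (p-1) * A) ^ (1/(p-1)), fun F hF => ?_⟩
  set hh : Rn n → ℝ≥0∞ := fun x => F x * (s x : ℝ≥0∞)⁻¹ with hhd
  have hhm : Measurable hh := hF.mul h.wdm.coe_nnreal_ennreal.inv
  set H : Rn n → ℝ≥0∞ := fun x => MM (wm s) (fun y => hh y ^ r) x ^ (1/r) with hHd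
  have hHm : Measurable H := (MM_meas _ _).pow_const _
  set g : Rn n → ℝ≥0∞ := fun x => H x ^ (p-1) * (w x : ℝ≥0∞)⁻¹ with hgd
  have hgm : Measurable g := (hHm.pow_const _).mul h.meas.coe_nnreal_ennreal.inv
  refine ⟨fun x => MM (wm w) g x ^ (1/(p-1)), (MM_meas _ _).pow_const _, ?_, ?_⟩
  · calc _ = ∫⁻ x, MM (wm w) g x ^ (p/(p-1)) ∂(wm w) := by
          refine lintegral_congr fun x => ?_
          rw [← ENNReal.rpow_mul, one_div_mul_eq_div]
      _ ≤ C1 * ∫⁻ x, g x ^ (p/(p-1)) ∂(wm w) := hC1 g hgm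
      _ = C1 * ∫⁻ x, MM (wm s) (fun y => hh y ^ r) x ^ (p/r) ∂(wm s) := by
          rw [wm_lint h.meas, wm_lint h.wdm]
          congr 1
          refine lintegral_congr fun x => ?_
          rw [hgd, ENNReal.mul_rpow_of_nonneg _ _ (by positivity), mul_left_comm, h.pw1, mul_comm, ← ENNReal.rpow_mul, hHd,
            ← ENNReal.rpow_mul]
          congr 2; field_simp
      _ ≤ C1 * (C2 * ∫⁻ x, (hh x ^ r) ^ (p/r) ∂(wm s)) := by gcongr; exact hC2 _ (hhm.pow_const _)
      _ = C1 * C2 * ∫⁻ x, F x ^ p ∂(wm w) := by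
          rw [wm_lint h.meas, wm_lint h.wdm, mul_assoc]
          congr 2
          refine lintegral_congr fun x => ?_
          rw [← ENNReal.rpow_mul, mul_div_cancel₀ _ hr0.ne', hhd, ENNReal.mul_rpow_of_nonneg _ _ hp0.le, mul_left_comm, h.pw2, mul_comm]
      _ ≤ _ := by gcongr; push_cast; exact le_self_add
  · intro b hb k x z hz
    set B := BB k x with hB
    have hBm : MeasurableSet B := measurableSet_ball
    have hr4 : 0 < 4 * rad n k := by linarith [rad_pos (n := n) k]
    have hB0 : volume B ≠ 0 := (measure_ball_pos volume _ hr4).ne'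
    have hBt : volume B ≠ ⊤ := measure_ball_lt_top.ne
    have hwB0 : wm w B ≠ 0 := wm_pos h.meas h.pos hBm hB0
    have hwBt : wm w B ≠ ⊤ := h.fb _ _
    set I := ∫⁻ y in B, (1 + ‖b y - mQ b k x‖ₑ) * F y with hI
    have h1 : ∀ u ∈ B, I ≤ C3 * wm s B * H u := by
      intro u hu
      refine le_trans (le_of_eq ?_) (hC3 b hb hh hhm k x u hu)
      rw [wm_slint h.wdm _ hBm, hI]
      refine lintegral_congr fun y => ?_
      rw [hhd, show (s y : ℝ≥0∞) * ((1 + ‖b y - mQ b k x‖ₑ) * (F y * (s y : ℝ≥0∞)⁻¹)) =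
        (s y * (s y : ℝ≥0∞)⁻¹) * ((1 + ‖b y - mQ b k x‖ₑ) * F y) by ring, ENNReal.mul_inv_cancel (hs0 y) ENNReal.coe_ne_top, one_mul]
    have h2 : volume B * (wm w B * I ^ (p-1)) ≤ C3 ^ (p-1) * (wm w B * wm s B ^ (p-1)) * ∫⁻ u in B, H u ^ (p-1) := by
      rw [mul_comm, ← setLIntegral_const, ← lintegral_const_mul _ (hHm.pow_const _)]
      refine setLIntegral_mono (by fun_prop) fun u hu => ?_
      calc _ ≤ wm w B * (C3 * wm s B * H u) ^ (p-1) := by gcongr; exact h1 u hu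
        _ = _ := by
          rw [ENNReal.mul_rpow_of_nonneg _ _ hp1.le, ENNReal.mul_rpow_of_nonneg _ _ hp1.le]; ring
    have h3 : ∫⁻ u in B, H u ^ (p-1) ≤ wm w B * MM (wm w) g z := by
      refine le_trans (le_of_eq ?_) (setI_le_MM h.ai.1 g hz)
      rw [wm_slint h.meas _ measurableSet_ball]
      refine lintegral_congr fun y => ?_
      rw [hgd, mul_left_comm, ENNReal.mul_inv_cancel (hw0 y) ENNReal.coe_ne_top, mul_one]
    have h4 : wm w B * (volume B * I ^ (p-1)) ≤ wm w B * (volume B * (C3 ^ (p-1) * A * volume B ^ (p-1) * MM (wm w) g z)) := by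
      calc _ = volume B * (wm w B * I ^ (p-1)) := by ring
        _ ≤ C3 ^ (p-1) * (A * volume B ^ p) * (wm w B * MM (wm w) g z) := by
          refine h2.trans ?_
          exact mul_le_mul' (mul_le_mul_right (h.ap' _ hr4) _) h3
        _ = _ := by
          have : volume B ^ p = volume B * volume B ^ (p-1) := by
            nth_rewrite 2 [← ENNReal.rpow_one (volume B)]
            rw [← ENNReal.rpow_add _ _ hB0 hBt]; congr 1; ring
          rw [this]; ring
    have h5 := (ENNReal.mul_le_mul_iff_right hB0 hBt).1 ((ENNReal.mul_le_mul_iff_right hwB0 hwBt).1 h4)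
    have h6 := ENNReal.rpow_le_rpow h5 (show 0 ≤ 1/(p-1) by positivity)
    rw [← ENNReal.rpow_mul, mul_one_div_cancel hp1.ne', ENNReal.rpow_one, ENNReal.mul_rpow_of_nonneg _ _ (by positivity),
      ENNReal.mul_rpow_of_nonneg _ _ (by positivity), ← ENNReal.rpow_mul (volume B), mul_one_div_cancel hp1.ne', ENNReal.rpow_one] at h6
    refine h6.trans ?_
    gcongr
    rw [← ENNReal.coe_rpow_of_nonneg _ hp1.le, ← ENNReal.coe_mul, ← ENNReal.coe_rpow_of_nonneg _ (by positivity)]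
    push_cast
    exact le_add_self

end P9

section P10
open scoped NNReal
variable {n : ℕ} {T : Lp ℝ 2 (volume : Measure (Rn n)) →L[ℝ] Lp ℝ 2 (volume : Measure (Rn n))}
  {K : Rn n → Rn n → ℝ} {C₀ : ℝ} {Cr : ℝ≥0}

lemma K_on (hK : GK C₀ Cr K) {g : Rn n → ℝ} (hg : Integrable g) (y : Rn n) {ε : ℝ} (hε : 0 < ε) :
    IntegrableOn (fun u => K y u * g u) {u | ε ≤ dist y u} := by
  have := K_int hK (z := y) hε (hg.indicator (tr_meas y ε)) (fun u hu => by
    by_contra h; exact hu (indicator_of_notMem (show u ∉ {u | ε ≤ dist y u} from h) _))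
  rw [← integrable_indicator_iff (tr_meas y ε)]
  refine this.congr (Eventually.of_forall fun u => ?_)
  by_cases h : ε ≤ dist y u <;> simp [indicator, h]

lemma mc_int (hK : GK C₀ Cr K) {b g : Rn n → ℝ} {m : ℝ} (hg : Integrable g) (hg2 : Integrable fun u => (b u - m) * g u)
    (y : Rn n) {ε : ℝ} (hε : 0 < ε) : IntegrableOn (fun u => (b y - b u) * K y u * g u) {u | ε ≤ dist y u} := by
  have h := ((K_on hK hg y hε).const_mul (b y - m)).sub (K_on hK hg2 y hε)
  refine h.congr (Eventually.of_forall fun u => ?_)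
  simp only [Pi.sub_apply]; ring

lemma mc_le (hK : GK C₀ Cr K) {b g : Rn n → ℝ} {m : ℝ} (hg : Integrable g) (hg2 : Integrable fun u => (b u - m) * g u)
    (y : Rn n) : maxComm K b g y ≤ ‖b y - m‖ₑ * truncT K g y + truncT K (fun u => (b u - m) * g u) y := by
  refine iSup₂_le fun ε hε => ?_
  have e : ∫ u in {u | ε ≤ dist y u}, (b y - b u) * K y u * g u = (b y - m) * (∫ u in {u | ε ≤ dist y u}, K y u * g u) -
      ∫ u in {u | ε ≤ dist y u}, K y u * ((b u - m) * g u) := by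
    rw [← integral_const_mul, ← integral_sub ((K_on hK hg y hε).const_mul _) (K_on hK hg2 y hε)]
    refine integral_congr_ae (Eventually.of_forall fun u => ?_)
    ring
  rw [e, ← Real.norm_eq_abs, ofReal_norm]
  refine enorm_sub_le.trans (add_le_add ?_ ?_)
  · rw [enorm_mul]
    refine mul_le_mul_right ?_ _
    rw [← ofReal_norm, Real.norm_eq_abs]
    exact le_iSup₂_of_le (f := fun ε (_ : 0 < ε) => ENNReal.ofReal |∫ u in {u | ε ≤ dist y u}, K y u * g u|) ε hε le_rfl
  · rw [← ofReal_norm, Real.norm_eq_abs]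
    exact le_iSup₂_of_le (f := fun ε (_ : 0 < ε) => ENNReal.ofReal |∫ u in {u | ε ≤ dist y u}, K y u * ((b u - m) * g u)|) ε hε le_rfl

lemma mc_add (hK : GK C₀ Cr K) {b g g' : Rn n → ℝ} {m : ℝ} (hg : Integrable g) (hg2 : Integrable fun u => (b u - m) * g u)
    (hg' : Integrable g') (hg2' : Integrable fun u => (b u - m) * g' u)
    (y : Rn n) : maxComm K b (fun u => g u + g' u) y ≤ maxComm K b g y + maxComm K b g' y := by
  refine iSup₂_le fun ε hε => ?_
  have e : ∫ u in {u | ε ≤ dist y u}, (b y - b u) * K y u * (g u + g' u) = (∫ u in {u | ε ≤ dist y u}, (b y - b u) * K y u * g u) +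
      ∫ u in {u | ε ≤ dist y u}, (b y - b u) * K y u * g' u := by
    rw [← integral_add (mc_int hK hg hg2 y hε) (mc_int hK hg' hg2' y hε)]
    refine integral_congr_ae (Eventually.of_forall fun u => ?_)
    ring
  rw [e, ← Real.norm_eq_abs, ofReal_norm]
  refine (enorm_add_le _ _).trans (add_le_add ?_ ?_)
  · rw [← ofReal_norm, Real.norm_eq_abs]
    exact le_iSup₂_of_le (f := fun ε (_ : 0 < ε) => ENNReal.ofReal |∫ u in {u | ε ≤ dist y u}, (b y - b u) * K y u * g u|) ε hε le_rfl
  · rw [← ofReal_norm, Real.norm_eq_abs]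
    exact le_iSup₂_of_le (f := fun ε (_ : 0 < ε) => ENNReal.ofReal |∫ u in {u | ε ≤ dist y u}, (b y - b u) * K y u * g' u|) ε hε le_rfl

/-- average with oscillation -/
def aQ (b f : Rn n → ℝ) (k : ℤ) (x : Rn n) : ℝ≥0∞ :=
  (∫⁻ y in BB k x, (1 + ‖b y - mQ b k x‖ₑ) * ‖f y‖ₑ) / volume (dy k x)

def UQ (K : Rn n → Rn n → ℝ) (b f : Rn n → ℝ) (k : ℤ) (x : Rn n) (y : Rn n) : ℝ≥0∞ :=
  maxComm K b ((BB k x).indicator f) y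

lemma onestep [NeZero n] (hK : GK C₀ Cr K) (hT : IsCZO n K T) : ∃ C : ℝ≥0, ∀ b f : Rn n → ℝ, NB b → Measurable f →
    ∀ k x, aQ b f k x ≠ ⊤ → ∃ S : Set (Set (Rn n)), S.Countable ∧ S.PairwiseDisjoint id ∧
      (∀ P ∈ S, ∃ l z, k < l ∧ z ∈ dy k x ∧ P = dy l z ∧
        ∀ y ∈ P, UQ K b f k x y ≤ C * aQ b f k x * (1 + ‖b y - mQ b k x‖ₑ) + UQ K b f l z y) ∧
      2 * volume (⋃₀ S) ≤ volume (dy k x) ∧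
      ∀ᵐ y, y ∈ dy k x → y ∉ ⋃₀ S → UQ K b f k x y ≤ C * aQ b f k x * (1 + ‖b y - mQ b k x‖ₑ) := by
  obtain ⟨C1, hC1⟩ := weakTs hK hT
  obtain ⟨C2, hC2⟩ := MM_weak (AI_vol (n := n))
  obtain ⟨C3, hC3⟩ := grand hK
  let A : ℝ≥0 := 2 ^ (n+2) * (2 * C1 + 2 * C2 + 1)
  refine ⟨(4 + C3) * A, fun b f hb hf k x ha => ?_⟩
  have hQ0 := vol_dy_pos k x
  have hQt := vol_dy_top k x
  have hbm := hb.1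
  set m := mQ b k x with hm
  set a := aQ b f k x with haQ
  have hI : ∫⁻ y in BB k x, (1 + ‖b y - m‖ₑ) * ‖f y‖ₑ = a * volume (dy k x) := by
    rw [haQ, aQ, ENNReal.div_mul_cancel hQ0 hQt]
  have hBm : MeasurableSet (BB k x) := measurableSet_ball
  rcases eq_or_ne a 0 with ha0 | ha0
  · refine ⟨∅, countable_empty, by simp, by simp, by simp, Eventually.of_forall fun y _ _ => ?_⟩
    rw [ha0, zero_mul, lintegral_eq_zero_iff (by fun_prop)] at hI
    have hz : ∀ᵐ u, (BB k x).indicator f u = 0 := by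
      rw [Filter.EventuallyEq, ae_restrict_iff' hBm] at hI
      filter_upwards [hI] with u hu
      by_cases h : u ∈ BB k x
      · have := hu h
        simp only [Pi.zero_apply, mul_eq_zero] at this
        rw [indicator_of_mem h]
        rcases this with h1 | h1
        · simp at h1
        · simpa using h1
      · exact indicator_of_notMem h _
    refine le_trans (le_of_eq ?_) zero_le
    rw [UQ, maxComm]
    simp only [ENNReal.iSup_eq_zero]
    intro ε hε
    rw [integral_congr_ae (g := fun _ => (0:ℝ)) (ae_restrict_of_ae (hz.mono fun u hu => by simp only [hu, mul_zero]))]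
    simp
  set g1 := (BB k x).indicator f with hg1
  set g2 : Rn n → ℝ := fun u => (b u - m) * g1 u with hg2
  have hg1m : Measurable g1 := hf.indicator hBm
  have hg2m : Measurable g2 := (hbm.sub_const m).mul hg1m
  have hI1 : ∫⁻ u, ‖g1 u‖ₑ ≤ a * volume (dy k x) := by
    rw [← hI, ← lintegral_indicator hBm]
    refine lintegral_mono fun u => ?_
    by_cases h : u ∈ BB k x
    · rw [hg1, indicator_of_mem h, indicator_of_mem h]
      exact le_mul_of_one_le_left zero_le le_self_add
    · simp [hg1, h]
  have hI2 : ∫⁻ u, ‖g2 u‖ₑ ≤ a * volume (dy k x) := by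
    rw [← hI, ← lintegral_indicator hBm]
    refine lintegral_mono fun u => ?_
    by_cases h : u ∈ BB k x
    · simp only [hg2]
      rw [enorm_mul, hg1, indicator_of_mem h, indicator_of_mem h]
      gcongr; exact le_add_self
    · simp [hg2, hg1, h]
  have hat : a * volume (dy k x) < ⊤ := ENNReal.mul_lt_top ha.lt_top hQt.lt_top
  have hg1i : Integrable g1 := ⟨hg1m.aestronglyMeasurable, hI1.trans_lt hat⟩
  have hg2i : Integrable g2 := ⟨hg2m.aestronglyMeasurable, hI2.trans_lt hat⟩
  have hA0 : (A : ℝ≥0∞) ≠ 0 := by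
    have : 0 < A := by positivity
    exact_mod_cast this.ne'
  set l : ℝ≥0∞ := A * a with hl
  have hl0 : l ≠ 0 := mul_ne_zero hA0 ha0
  have hlt : l ≠ ⊤ := ENNReal.mul_ne_top ENNReal.coe_ne_top ha
  let E0 : Set (Rn n) := ({z | 4 * l < truncT K g1 z} ∪ {z | l < MM volume (fun y => ‖g1 y‖ₑ) z}) ∪
    ({z | 4 * l < truncT K g2 z} ∪ {z | l < MM volume (fun y => ‖g2 y‖ₑ) z})
  have hE0 : l * volume E0 ≤ (2 * C1 + 2 * C2) * (a * volume (dy k x)) := by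
    calc _ ≤ l * ((volume {z | 4 * l < truncT K g1 z} + volume {z | l < MM volume (fun y => ‖g1 y‖ₑ) z}) +
          (volume {z | 4 * l < truncT K g2 z} + volume {z | l < MM volume (fun y => ‖g2 y‖ₑ) z})) := by
            refine mul_le_mul_right ?_ _
            exact (measure_union_le _ _).trans (add_le_add (measure_union_le _ _) (measure_union_le _ _))
      _ = (l * volume {z | 4 * l < truncT K g1 z} + l * volume {z | l < MM volume (fun y => ‖g1 y‖ₑ) z}) +
          (l * volume {z | 4 * l < truncT K g2 z} + l * volume {z | l < MM volume (fun y => ‖g2 y‖ₑ) z}) := by ring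
      _ ≤ (C1 * (a * volume (dy k x)) + C2 * (a * volume (dy k x))) + (C1 * (a * volume (dy k x)) + C2 * (a * volume (dy k x))) := by
          refine add_le_add (add_le_add ?_ ?_) (add_le_add ?_ ?_)
          · exact (hC1 g1 hg1m hg1i l hl0 hlt).trans (by gcongr)
          · exact (hC2 _ l).trans (by gcongr)
          · exact (hC1 g2 hg2m hg2i l hl0 hlt).trans (by gcongr)
          · exact (hC2 _ l).trans (by gcongr)
      _ = _ := by ring
  have hvE0 : 2 ^ (n+2) * volume E0 ≤ volume (dy k x) := by
    set D : ℝ≥0∞ := 2 * C1 + 2 * C2 + 1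
    have hD0 : a * D ≠ 0 := mul_ne_zero ha0 (by simp [D])
    have hDt : a * D ≠ ⊤ := ENNReal.mul_ne_top ha (by simp only [D]; finiteness)
    refine (ENNReal.mul_le_mul_iff_right hD0 hDt).1 ?_
    calc _ = l * volume E0 := by simp only [hl, A, D]; push_cast; ring
      _ ≤ _ := hE0
      _ ≤ D * (a * volume (dy k x)) := by gcongr; exact le_self_add
      _ = _ := by ring
  set E := toMeasurable volume E0
  have hEm : MeasurableSet E := measurableSet_toMeasurable _ _
  have hvE : 2 ^ (n+2) * volume E ≤ volume (dy k x) := by rw [measure_toMeasurable]; exact hvE0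
  have hEt : volume E ≠ ⊤ := by
    intro h
    rw [h, ENNReal.mul_top (by positivity), top_le_iff] at hvE
    exact hQt hvE
  have hp0 : (2:ℝ≥0∞) ^ (n+1) ≠ 0 := by positivity
  have hpt : (2:ℝ≥0∞) ^ (n+1) ≠ ⊤ := by finiteness
  set l0 : ℝ≥0∞ := (2 ^ (n+1))⁻¹ with hl0d
  have hl02 : 2 ^ (n+1) * l0 = 1 := ENNReal.mul_inv_cancel hp0 hpt
  have hvE' : 2 * volume E ≤ l0 * volume (dy k x) := by
    calc 2 * volume E = (2 ^ (n+1) * l0) * (2 * volume E) := by rw [hl02, one_mul]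
      _ = l0 * (2 ^ (n+2) * volume E) := by ring
      _ ≤ _ := by gcongr
  obtain ⟨S, hSc, hSd, hSP, hSm, hSv, hSa⟩ := stopping (dy k x) k (E.indicator 1) (measurable_one.indicator hEm)
    (by rw [lintegral_indicator_one hEm]; exact hEt) l0 (fun y hy => by
      rw [dy_eq hy, lintegral_indicator_one hEm, Measure.restrict_apply hEm]
      refine (measure_mono inter_subset_left).trans (le_trans ?_ hvE')
      exact le_mul_of_one_le_left zero_le (by norm_num))
  have hnot : ∀ z, z ∉ E → truncT K g1 z ≤ 4 * l ∧ MM volume (fun y => ‖g1 y‖ₑ) z ≤ l ∧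
      truncT K g2 z ≤ 4 * l ∧ MM volume (fun y => ‖g2 y‖ₑ) z ≤ l := by
    intro z hz
    have hz0 : z ∉ E0 := fun h => hz (subset_toMeasurable _ _ h)
    simp only [E0, mem_union, mem_ofPred_eq, not_or, not_lt] at hz0
    exact ⟨hz0.1.1, hz0.1.2, hz0.2.1, hz0.2.2⟩
  refine ⟨S, hSc, hSd, ?_, ?_, ?_⟩
  · intro P hP
    obtain ⟨j, z, hj, hz, rfl, hint⟩ := hSP P hP
    refine ⟨j, z, hj, hz, rfl, fun y hy => ?_⟩
    obtain ⟨z', hz'P, hz'E⟩ : ∃ z' ∈ dy j z, z' ∉ E := by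
      by_contra hcon
      push Not at hcon
      rw [lintegral_indicator_one hEm, Measure.restrict_apply hEm, inter_eq_self_of_subset_right hcon] at hint
      have h2 : 2 * volume (dy j z) ≤ 1 * volume (dy j z) := by
        calc _ ≤ 2 * (2 ^ n * l0 * volume (dy j z)) := by gcongr
          _ = 2 ^ (n+1) * l0 * volume (dy j z) := by ring
          _ = _ := by rw [hl02]
      have := (ENNReal.mul_le_mul_iff_left (vol_dy_pos j z) (vol_dy_top j z)).1 h2
      norm_num at this
    obtain ⟨e1, e2, e3, e4⟩ := hnot z' hz'E
    have hyQ : y ∈ dy k x := by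
      have := dy_anti hj.le z hy
      rwa [dy_eq hz] at this
    have hz'y : z' ∈ dy j y := by rw [dy_eq hy]; exact hz'P
    have hBsub : BB j y ⊆ BB k x := BB_sub hj hyQ
    have hBjm : MeasurableSet (BB j y) := measurableSet_ball
    set h1 := (BB j y)ᶜ.indicator g1 with hh1
    set h2 := (BB j y).indicator f with hh2
    have hsum : (BB k x).indicator f = fun u => h1 u + h2 u := by
      ext u
      by_cases hu : u ∈ BB j y
      · simp [hh1, hh2, hu, hBsub hu]
      · simp [hh1, hh2, hu, hg1]
    have hgrow : ∀ i, (BB j y)ᶜ.indicator g1 i * (b i - m) = (BB j y)ᶜ.indicator g2 i := by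
      intro u; by_cases hu : u ∈ BB j y <;> simp [hu, hg2, mul_comm]
    have hh1i : Integrable h1 := hg1i.indicator hBjm.compl
    have e5 : (fun u => (b u - m) * h1 u) = (BB j y)ᶜ.indicator g2 := by
      ext u; rw [mul_comm]; exact hgrow u
    have hh1i2 : Integrable fun u => (b u - m) * h1 u := by rw [e5]; exact hg2i.indicator hBjm.compl
    have hh2e : h2 = (BB j y).indicator g1 := by
      ext u
      by_cases hu : u ∈ BB j y
      · simp [hh2, hu, hg1, hBsub hu]
      · simp [hh2, hu]
    have hh2i : Integrable h2 := by rw [hh2e]; exact hg1i.indicator hBjm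
    have hh2i2 : Integrable fun u => (b u - m) * h2 u := by
      have : (fun u => (b u - m) * h2 u) = (BB j y).indicator g2 := by
        ext u; rw [hh2e]; by_cases hu : u ∈ BB j y <;> simp [hu, hg2]
      rw [this]; exact hg2i.indicator hBjm
    rw [UQ, hsum]
    refine (mc_add hK hh1i hh1i2 hh2i hh2i2 y).trans (add_le_add ?_ (le_of_eq ?_))
    · refine (mc_le hK hh1i hh1i2 y).trans ?_
      have f1 : truncT K h1 y ≤ (4 + C3) * l := by
        refine (hC3 g1 hg1m hg1i j y z' hz'y).trans ?_
        rw [add_mul]; exact add_le_add e1 (by gcongr)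
      have f2 : truncT K (fun u => (b u - m) * h1 u) y ≤ (4 + C3) * l := by
        rw [e5]
        refine (hC3 g2 hg2m hg2i j y z' hz'y).trans ?_
        rw [add_mul]; exact add_le_add e3 (by gcongr)
      calc _ ≤ ‖b y - m‖ₑ * ((4 + C3) * l) + (4 + C3) * l := by gcongr
        _ = _ := by rw [hl]; push_cast; ring
    · rw [UQ, hh2, BB_eq hy]
  · refine (ENNReal.mul_le_mul_iff_right (a := l0) (ENNReal.inv_ne_zero.2 hpt) (ENNReal.inv_ne_top.2 hp0)).1 ?_
    calc l0 * (2 * volume (⋃₀ S)) = 2 * (l0 * volume (⋃₀ S)) := by ring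
      _ ≤ 2 * volume E := by
        gcongr
        refine hSv.trans ((setLIntegral_le_lintegral _ _).trans ?_)
        rw [lintegral_indicator_one hEm]
      _ ≤ _ := hvE'
  · filter_upwards [hSa] with y hy hyQ hyS
    have hyE : y ∉ E := by
      intro h
      have := hy hyQ hyS
      rw [indicator_of_mem h, Pi.one_apply, hl0d, ENNReal.one_le_inv] at this
      refine absurd this (not_le.2 ?_)
      exact one_lt_pow₀ (by norm_num) (by omega)
    obtain ⟨e1, e2, e3, e4⟩ := hnot y hyE
    refine (mc_le hK hg1i hg2i y).trans ?_
    calc _ ≤ ‖b y - m‖ₑ * (4 * l) + 4 * l := by gcongr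
      _ = 4 * l * (1 + ‖b y - m‖ₑ) := by ring
      _ ≤ (4 + C3) * l * (1 + ‖b y - m‖ₑ) := by gcongr; exact le_self_add
      _ = _ := by rw [hl]; push_cast; ring

end P10

section P11
open scoped NNReal
variable {n : ℕ} {T : Lp ℝ 2 (volume : Measure (Rn n)) →L[ℝ] Lp ℝ 2 (volume : Measure (Rn n))}
  {K : Rn n → Rn n → ℝ} {C₀ : ℝ} {Cr : ℝ≥0}

lemma induct [NeZero n] (hK : GK C₀ Cr K) (hT : IsCZO n K T) {μ : Measure (Rn n)} (h : AI μ) (hac : μ ≪ volume)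
    (q : ℕ) {r : ℝ} (hqr : (q:ℝ).HolderConjugate r) : ∃ C κ : ℝ≥0, κ < 1 ∧ ∀ b f : Rn n → ℝ, NB b → Measurable f →
    ∀ G : Rn n → ℝ≥0∞, Measurable G → (∀ k x, aQ b f k x ≠ ⊤) → (∀ k x z, z ∈ dy k x → aQ b f k x ≤ G z) →
    ∀ g : Rn n → ℝ≥0∞, Measurable g → ∀ N N' : ℝ≥0, (∀ y, g y ≤ N') → ∀ (m : ℕ) k x,
      ∫⁻ y in dy k x, min (UQ K b f k x y) N * g y ∂μ ≤
        C * (∫⁻ y in dy k x, G y * (MM μ (fun y => g y ^ r) y) ^ (1/r) ∂μ) + κ ^ m * (N * N') * μ (dy k x) := by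
  obtain ⟨C1, hC1⟩ := onestep hK hT
  obtain ⟨C2, hC2⟩ := hol h hac q hqr
  obtain ⟨κ, C3, hκ, hC3⟩ := h.small
  refine ⟨C1 * C2 * C3, κ, hκ, fun b f hb hf G hG hat haG g hg N N' hgN m => ?_⟩
  set Kk : Rn n → ℝ≥0∞ := fun y => (MM μ (fun y => g y ^ r) y) ^ (1/r) with hKk
  have hKm : Measurable Kk := (MM_meas _ _).pow_const _
  induction m with
  | zero =>
    intro k x
    refine le_add_left ?_
    rw [pow_zero, one_mul, ← setLIntegral_const]
    exact lintegral_mono fun y => mul_le_mul' (min_le_right _ _) (hgN y)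
  | succ m ih =>
    intro k x
    obtain ⟨S, hSc, hSd, hS, hSv, hae⟩ := hC1 b f hb hf k x (hat k x)
    have hPm : ∀ P ∈ S, MeasurableSet P := fun P hP => by
      obtain ⟨l, z, -, -, rfl, -⟩ := hS P hP; exact dy_meas l z
    set U := ⋃₀ S with hU
    have hUm : MeasurableSet U := MeasurableSet.sUnion hSc hPm
    have hUQ : U ⊆ dy k x := sUnion_subset fun P hP => by
      obtain ⟨l, z, hl, hz, rfl, -⟩ := hS P hP
      exact (dy_anti hl.le z).trans (dy_eq hz).le
    obtain ⟨s1, s2⟩ := hC3 k x U hUm hUQ hSv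
    set D : Rn n → ℝ≥0∞ := fun y => C1 * aQ b f k x * ((1 + ‖b y - mQ b k x‖ₑ) * g y) with hD
    have hbm := hb.1
    have hDm : Measurable D := by fun_prop
    have split : ∀ F : Rn n → ℝ≥0∞, ∫⁻ y in dy k x, F y ∂μ = (∫⁻ y in U, F y ∂μ) + ∫⁻ y in dy k x \ U, F y ∂μ := fun F => by
      rw [← lintegral_inter_add_sdiff F (dy k x) hUm, inter_eq_right.2 hUQ]
    have pU : ∫⁻ y in U, min (UQ K b f k x y) N * g y ∂μ ≤ (∫⁻ y in U, D y ∂μ) +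
        ((C1 * C2 * C3 : ℝ≥0) * (∫⁻ y in U, G y * Kk y ∂μ) + κ ^ m * (N * N') * μ U) := by
      rw [← setLIntegral_const U (κ ^ m * (N * N')), hU, lintegral_sUnion' hSc hPm hSd, lintegral_sUnion' hSc hPm hSd,
        lintegral_sUnion' hSc hPm hSd, lintegral_sUnion' hSc hPm hSd, ← ENNReal.tsum_mul_left,
        ← ENNReal.tsum_add, ← ENNReal.tsum_add]
      refine ENNReal.tsum_le_tsum fun P => ?_
      obtain ⟨l, z, hl, hz, hP, hPU⟩ := hS P.1 P.2
      refine le_trans ?_ (add_le_add_right (a := ∫⁻ y in (P:Set (Rn n)), D y ∂μ) (b := ∫⁻ y in dy l z, min (UQ K b f l z y) N * g y ∂μ) ?_)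
      · rw [← hP, ← lintegral_add_left hDm]
        refine setLIntegral_mono_ae' (hPm P.1 P.2) (Eventually.of_forall fun y hy => ?_)
        calc min (UQ K b f k x y) N * g y
            ≤ (C1 * aQ b f k x * (1 + ‖b y - mQ b k x‖ₑ) + min (UQ K b f l z y) N) * g y := by
              refine mul_le_mul_left ?_ _
              refine (min_le_min_right _ (hPU y hy)).trans ?_
              rcases le_total (UQ K b f l z y) N with h' | h'
              · rw [min_eq_left h']; exact min_le_left _ _
              · rw [min_eq_right h']; exact (min_le_right _ _).trans le_add_self
          _ = _ := by rw [hD]; ring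
      · rw [setLIntegral_const, hP]; exact ih l z
    have pV : ∫⁻ y in dy k x \ U, min (UQ K b f k x y) N * g y ∂μ ≤ ∫⁻ y in dy k x \ U, D y ∂μ := by
      refine setLIntegral_mono_ae' ((dy_meas k x).diff hUm) ?_
      filter_upwards [hac.ae_le hae] with y hy hyQ
      calc _ ≤ C1 * aQ b f k x * (1 + ‖b y - mQ b k x‖ₑ) * g y :=
            mul_le_mul_left ((min_le_left _ _).trans (hy hyQ.1 hyQ.2)) _
        _ = _ := by rw [hD]; ring
    have pD : ∫⁻ y in dy k x, D y ∂μ ≤ (C1 * C2 * C3 : ℝ≥0) * ∫⁻ y in dy k x \ U, G y * Kk y ∂μ := by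
      set V := dy k x \ U with hV
      set I := ∫⁻ y in BB k x, (1 + ‖b y - mQ b k x‖ₑ) * g y ∂μ with hI
      have e1 : ∫⁻ y in dy k x, D y ∂μ ≤ C1 * (aQ b f k x * I) := by
        rw [hD, lintegral_const_mul _ (by fun_prop), mul_assoc, hI]
        gcongr; exact dy_sub_BB k x
      have hVt : μ V ≠ ⊤ := ((measure_mono (sdiff_subset.trans (dy_sub_BB k x))).trans_lt (h.1 _ _).lt_top).ne
      refine e1.trans ?_
      rcases eq_or_ne (μ V) 0 with h0 | h0
      · have : I = 0 := by
          rw [hI, Measure.restrict_eq_zero.2 (by rw [h0] at s2; simpa using s2)]; simp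
        rw [this]; simp
      refine (ENNReal.mul_le_mul_iff_right h0 hVt).1 ?_
      calc μ V * (C1 * (aQ b f k x * I)) = C1 * (aQ b f k x * I * μ V) := by ring
        _ ≤ C1 * ∫⁻ y in V, C2 * μ (BB k x) * (G y * Kk y) ∂μ := by
          gcongr
          rw [← setLIntegral_const]
          refine setLIntegral_mono_ae' ((dy_meas k x).diff hUm) (Eventually.of_forall fun y hy => ?_)
          calc _ ≤ G y * (C2 * μ (BB k x) * Kk y) :=
                mul_le_mul' (haG k x y hy.1) (hC2 b hb g hg k x y (dy_sub_BB k x hy.1))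
            _ = _ := by ring
        _ = C1 * (C2 * μ (BB k x) * ∫⁻ y in V, G y * Kk y ∂μ) := by
          rw [lintegral_const_mul _ (by fun_prop)]
        _ ≤ C1 * (C2 * (C3 * μ V) * ∫⁻ y in V, G y * Kk y ∂μ) := by gcongr
        _ = _ := by push_cast; ring
    rw [split]
    calc _ ≤ ((∫⁻ y in U, D y ∂μ) + ((C1 * C2 * C3 : ℝ≥0) * (∫⁻ y in U, G y * Kk y ∂μ) + κ ^ m * (N * N') * μ U)) +
          ∫⁻ y in dy k x \ U, D y ∂μ := add_le_add pU pV
      _ = (∫⁻ y in dy k x, D y ∂μ) + ((C1 * C2 * C3 : ℝ≥0) * (∫⁻ y in U, G y * Kk y ∂μ) + κ ^ m * (N * N') * μ U) := by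
        rw [split D]; ring
      _ ≤ (C1 * C2 * C3 : ℝ≥0) * (∫⁻ y in dy k x \ U, G y * Kk y ∂μ) +
          ((C1 * C2 * C3 : ℝ≥0) * (∫⁻ y in U, G y * Kk y ∂μ) + κ ^ m * (N * N') * (κ * μ (dy k x))) := by
        gcongr
      _ = _ := by rw [split (fun y => G y * Kk y)]; ring

end P11

section P12
open scoped NNReal
variable {n : ℕ} {T : Lp ℝ 2 (volume : Measure (Rn n)) →L[ℝ] Lp ℝ 2 (volume : Measure (Rn n))}
  {K : Rn n → Rn n → ℝ} {C₀ : ℝ} {Cr : ℝ≥0}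

lemma local_est [NeZero n] (hK : GK C₀ Cr K) (hT : IsCZO n K T) {p : ℝ} {A : ℝ≥0} {w : Rn n → ℝ≥0} (h : Wt p A w) :
    ∃ C : ℝ≥0, ∀ b f : Rn n → ℝ, NB b → Measurable f → ∫⁻ x, ‖f x‖ₑ ^ p ∂(wm w) ≠ ⊤ → ∀ k x, aQ b f k x ≠ ⊤ ∧
      ∫⁻ y in dy k x, UQ K b f k x y ^ p ∂(wm w) ≤ C * ∫⁻ x, ‖f x‖ₑ ^ p ∂(wm w) := by
  have hp := h.hp
  have hp0 : 0 < p := by linarith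
  set s := p / (p-1) with hs
  have hps : p.HolderConjugate s := Real.HolderConjugate.conjExponent hp
  have hs0 : 0 < s := hps.symm.pos
  have hs1 : 1 < s := hps.symm.lt
  obtain ⟨q, hq⟩ := exists_nat_gt (max p s)
  have hqp : p < q := (le_max_left _ _).trans_lt hq
  have hqs : s < q := (le_max_right _ _).trans_lt hq
  have hq1 : (1:ℝ) < q := hp.trans hqp
  set r := (q:ℝ) / (q-1) with hr
  have hqr : (q:ℝ).HolderConjugate r := Real.HolderConjugate.conjExponent hq1
  have hr0 : 0 < r := hqr.symm.pos
  have hrp : r < p := by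
    rw [hr, div_lt_iff₀ (by linarith)]
    rw [hs, div_lt_iff₀ (by linarith)] at hqs
    linarith
  have hrs : r < s := by
    rw [hr, hs, div_lt_div_iff₀ (by linarith) (by linarith)]; linarith
  obtain ⟨C0, hC0⟩ := GG h q hqr hrp
  obtain ⟨C1, κ, hκ, hC1⟩ := induct hK hT h.ai (wm_ac w) q hqr
  obtain ⟨C2, hC2⟩ := MM_strong h.ai (s/r) (by rwa [one_lt_div hr0])
  set cc : ℝ≥0 := C0 * (cB n).toNNReal with hcc
  have hcc' : (cc : ℝ≥0∞) = C0 * cB n := by rw [hcc]; push_cast; rw [ENNReal.coe_toNNReal cB_top]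
  refine ⟨(C1 * C2 ^ (1/s)) ^ p * (cc ^ p * C0), fun b f hb hf hfin k x => ?_⟩
  obtain ⟨G0, hG0m, hG0, hG0b⟩ := hC0 (fun y => ‖f y‖ₑ) hf.enorm
  set G : Rn n → ℝ≥0∞ := fun z => cc * G0 z with hG
  have hGm : Measurable G := by fun_prop
  have hGp : ∫⁻ x, G x ^ p ∂(wm w) ≤ cc ^ p * C0 * ∫⁻ x, ‖f x‖ₑ ^ p ∂(wm w) := by
    simp only [hG, ENNReal.mul_rpow_of_nonneg _ _ hp0.le]
    rw [lintegral_const_mul _ (by fun_prop), mul_assoc]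
    gcongr
  have haG : ∀ k x z, z ∈ dy k x → aQ b f k x ≤ G z := fun k x z hz => by
    refine (ENNReal.div_le_div_right (hG0b b hb k x z (dy_sub_BB k x hz)) _).trans ?_
    rw [vol_BB, hG]
    simp only
    rw [hcc', show (C0:ℝ≥0∞) * (cB n * volume (dy k x)) * G0 z = C0 * cB n * G0 z * volume (dy k x) by ring,
      mul_div_assoc, ENNReal.div_self (vol_dy_pos k x) (vol_dy_top k x), mul_one]
  have hGt : ∀ᵐ z ∂(wm w), G z < ⊤ := by
    have := ae_lt_top (μ := wm w) (f := fun z => G z ^ p) (by fun_prop) (ne_top_of_le_ne_top (by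
      refine ENNReal.mul_ne_top (ENNReal.mul_ne_top ?_ ENNReal.coe_ne_top) hfin
      exact ENNReal.rpow_ne_top_of_nonneg hp0.le ENNReal.coe_ne_top) hGp)
    filter_upwards [this] with z hz
    by_contra h'
    rw [not_lt_top_iff.1 h', ENNReal.top_rpow_of_pos hp0] at hz
    exact lt_irrefl _ hz
  have hat : ∀ k x, aQ b f k x ≠ ⊤ := fun k x => by
    by_contra h'
    refine wm_pos h.meas h.pos (dy_meas k x) (vol_dy_pos k x) (measure_mono_null (fun z hz => ?_) hGt)
    simp only [mem_compl_iff, mem_ofPred_eq]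
    have := haG k x z hz
    rw [h', top_le_iff] at this
    simp [this]
  refine ⟨hat k x, ?_⟩
  have hQt : wm w (dy k x) ≠ ⊤ := ((measure_mono (dy_sub_BB k x)).trans_lt (h.fb _ _).lt_top).ne
  obtain ⟨φ, hφm, hφ, hφe⟩ := exists_measurable_le_lintegral_eq (μ := (wm w).restrict (dy k x)) (fun y => UQ K b f k x y ^ p)
  have hsup : ∀ y, φ y = ⨆ N : ℕ, min (φ y) (N:ℝ≥0∞) := fun y => by
    rw [show (⨆ N : ℕ, min (φ y) (N:ℝ≥0∞)) = φ y ⊓ ⨆ N : ℕ, (N:ℝ≥0∞) from inf_iSup_eq .. |>.symm, ENNReal.iSup_natCast]; simp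
  rw [hφe, lintegral_congr hsup, lintegral_iSup (fun N => by fun_prop) (fun N M hNM y => by
    dsimp only; gcongr)]
  refine iSup_le fun N => ?_
  set X := ∫⁻ y in dy k x, min (φ y) (N:ℝ≥0∞) ∂(wm w) with hX
  have hXt : X ≠ ⊤ := by
    refine ne_top_of_le_ne_top (b := N * wm w (dy k x)) (by finiteness) ?_
    rw [← setLIntegral_const]; exact lintegral_mono fun y => min_le_right _ _
  set g : Rn n → ℝ≥0∞ := (dy k x).indicator fun y => min (φ y) (N:ℝ≥0∞) ^ (1/s) with hg
  have hgm : Measurable g := Measurable.indicator (by fun_prop) (dy_meas k x)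
  have hgs : ∫⁻ y, g y ^ s ∂(wm w) = X := by
    rw [hX, ← lintegral_indicator (dy_meas k x)]
    refine lintegral_congr fun y => ?_
    by_cases hy : y ∈ dy k x
    · rw [hg, indicator_of_mem hy, indicator_of_mem hy, ← ENNReal.rpow_mul, one_div_mul_cancel hs0.ne', ENNReal.rpow_one]
    · rw [hg, indicator_of_notMem hy, indicator_of_notMem hy, ENNReal.zero_rpow_of_pos hs0]
  have hgN : ∀ y, g y ≤ ((N:ℝ≥0) ^ (1/s) : ℝ≥0) := fun y => by
    refine (indicator_le_self' (fun _ _ => zero_le) _).trans ?_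
    rw [ENNReal.coe_rpow_of_nonneg _ (by positivity)]
    exact ENNReal.rpow_le_rpow (by simp) (by positivity)
  set Kk : Rn n → ℝ≥0∞ := fun y => (MM (wm w) (fun y => g y ^ r) y) ^ (1/r) with hKk
  have hKm : Measurable Kk := (MM_meas _ _).pow_const _
  have hKs : ∫⁻ y, Kk y ^ s ∂(wm w) ≤ C2 * X := by
    have := hC2 (fun y => g y ^ r) (by fun_prop)
    refine le_trans (le_of_eq ?_) (this.trans (le_of_eq ?_))
    · refine lintegral_congr fun y => ?_
      rw [hKk, ← ENNReal.rpow_mul]; congr 1; ring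
    · rw [← hgs]; congr 1
      refine lintegral_congr fun y => ?_
      rw [← ENNReal.rpow_mul]; congr 1; field_simp
  have hlim : ∫⁻ y in dy k x, min (UQ K b f k x y) (((N:ℝ≥0) ^ (1/p) : ℝ≥0) : ℝ≥0∞) * g y ∂(wm w) ≤
      C1 * ∫⁻ y in dy k x, G y * Kk y ∂(wm w) := by
    have hc := hC1 b f hb hf G hGm hat haG g hgm ((N:ℝ≥0) ^ (1/p)) ((N:ℝ≥0) ^ (1/s)) hgN
    have t : Tendsto (fun m : ℕ => C1 * (∫⁻ y in dy k x, G y * Kk y ∂(wm w)) +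
        (κ:ℝ≥0∞) ^ m * ((((N:ℝ≥0) ^ (1/p) : ℝ≥0) : ℝ≥0∞) * (((N:ℝ≥0) ^ (1/s) : ℝ≥0) : ℝ≥0∞)) * wm w (dy k x)) atTop
        (𝓝 (C1 * (∫⁻ y in dy k x, G y * Kk y ∂(wm w)) + 0)) := by
      refine Tendsto.const_add _ ?_
      have t0 := ENNReal.tendsto_pow_atTop_nhds_zero_of_lt_one (r := (κ:ℝ≥0∞)) (by exact_mod_cast hκ)
      have t1 := ENNReal.Tendsto.mul_const (b := (((N:ℝ≥0) ^ (1/p) : ℝ≥0) : ℝ≥0∞) * (((N:ℝ≥0) ^ (1/s) : ℝ≥0) : ℝ≥0∞) * wm w (dy k x)) t0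
        (Or.inr (by finiteness))
      simpa only [zero_mul, mul_assoc] using t1
    rw [add_zero] at t
    exact ge_of_tendsto' t fun m => hc m k x
  have hX1 : X ≤ C1 * ((∫⁻ y, G y ^ p ∂(wm w)) ^ (1/p) * (C2 * X) ^ (1/s)) := by
    refine le_trans ?_ (hlim.trans ?_)
    · refine setLIntegral_mono_ae' (dy_meas k x) (Eventually.of_forall fun y hy => ?_)
      rw [hg, indicator_of_mem hy]
      calc min (φ y) (N:ℝ≥0∞) = min (φ y) (N:ℝ≥0∞) ^ (1/p) * min (φ y) (N:ℝ≥0∞) ^ (1/s) := by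
            rw [← ENNReal.rpow_add_of_nonneg _ _ (by positivity) (by positivity), one_div, one_div, hps.inv_add_inv_eq_one, ENNReal.rpow_one]
        _ ≤ _ := by
          refine mul_le_mul_left (le_min ?_ ?_) _
          · refine (ENNReal.rpow_le_rpow ((min_le_left _ _).trans (hφ y)) (by positivity)).trans ?_
            rw [← ENNReal.rpow_mul, mul_one_div_cancel hp0.ne', ENNReal.rpow_one]
          · rw [ENNReal.coe_rpow_of_nonneg _ (by positivity)]
            exact ENNReal.rpow_le_rpow (by simp) (by positivity)
    · refine mul_le_mul_right ((setLIntegral_le_lintegral _ _).trans ?_) _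
      refine (ENNReal.lintegral_mul_le_Lp_mul_Lq (wm w) hps hGm.aemeasurable hKm.aemeasurable).trans ?_
      gcongr
  rcases eq_or_ne X 0 with h0 | h0
  · rw [h0]; exact zero_le
  have hX2 : X ^ (1/p) ≤ C1 * C2 ^ (1/s) * (∫⁻ y, G y ^ p ∂(wm w)) ^ (1/p) := by
    refine (ENNReal.mul_le_mul_iff_left (c := X ^ (1/s)) (by simp [h0, hXt]) (by finiteness)).1 ?_
    rw [← ENNReal.rpow_add_of_nonneg _ _ (by positivity) (by positivity), one_div, one_div, hps.inv_add_inv_eq_one, ENNReal.rpow_one]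
    refine hX1.trans (le_of_eq ?_)
    rw [ENNReal.mul_rpow_of_nonneg _ _ (by positivity), one_div, one_div]; ring
  calc X = (X ^ (1/p)) ^ p := by rw [← ENNReal.rpow_mul, one_div_mul_cancel hp0.ne', ENNReal.rpow_one]
    _ ≤ (C1 * C2 ^ (1/s) * (∫⁻ y, G y ^ p ∂(wm w)) ^ (1/p)) ^ p := ENNReal.rpow_le_rpow hX2 hp0.le
    _ = (C1 * C2 ^ (1/s)) ^ p * ∫⁻ y, G y ^ p ∂(wm w) := by
      rw [ENNReal.mul_rpow_of_nonneg _ _ hp0.le, ← ENNReal.rpow_mul _ (1/p), one_div_mul_cancel hp0.ne', ENNReal.rpow_one]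
    _ ≤ (C1 * C2 ^ (1/s)) ^ p * (cc ^ p * C0 * ∫⁻ x, ‖f x‖ₑ ^ p ∂(wm w)) := by gcongr
    _ = _ := by
      push_cast [ENNReal.coe_rpow_of_nonneg _ hp0.le, ENNReal.coe_rpow_of_nonneg _ (show 0 ≤ 1/s by positivity)]
      ring

end P12

section P13
open scoped NNReal
variable {n : ℕ} {T : Lp ℝ 2 (volume : Measure (Rn n)) →L[ℝ] Lp ℝ 2 (volume : Measure (Rn n))}
  {K : Rn n → Rn n → ℝ} {C₀ : ℝ} {Cr : ℝ≥0}

lemma aQ_int {b f : Rn n → ℝ} (hb : Measurable b) (hf : Measurable f) {k : ℤ} {x : Rn n} (ha : aQ b f k x ≠ ⊤) :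
    Integrable ((BB k x).indicator f) ∧ Integrable fun u => (b u - mQ b k x) * (BB k x).indicator f u := by
  have hQ0 := vol_dy_pos k x
  have hQt := vol_dy_top k x
  have hBm : MeasurableSet (BB k x) := measurableSet_ball
  have hI : ∫⁻ y in BB k x, (1 + ‖b y - mQ b k x‖ₑ) * ‖f y‖ₑ < ⊤ := by
    have : ∫⁻ y in BB k x, (1 + ‖b y - mQ b k x‖ₑ) * ‖f y‖ₑ = aQ b f k x * volume (dy k x) := by
      rw [aQ, ENNReal.div_mul_cancel hQ0 hQt]
    rw [this]; exact ENNReal.mul_lt_top ha.lt_top hQt.lt_top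
  rw [← lintegral_indicator hBm] at hI
  have hm := hf.indicator hBm
  refine ⟨⟨hm.aestronglyMeasurable, lt_of_le_of_lt (lintegral_mono fun u => ?_) hI⟩,
    ⟨((hb.sub_const _).mul hm).aestronglyMeasurable, lt_of_le_of_lt (lintegral_mono fun u => ?_) hI⟩⟩
  · by_cases h : u ∈ BB k x
    · rw [indicator_of_mem h, indicator_of_mem h]
      exact le_mul_of_one_le_left zero_le le_self_add
    · simp [h]
  · by_cases h : u ∈ BB k x
    · rw [enorm_mul, indicator_of_mem h, indicator_of_mem h]
      gcongr; exact le_add_self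
    · simp [h]

lemma mc_meas (hK : GK C₀ Cr K) {b g : Rn n → ℝ} {m : ℝ} (hb : Measurable b) (hgm : Measurable g) (hg : Integrable g)
    (hg2 : Integrable fun u => (b u - m) * g u) : Measurable (maxComm K b g) := by
  have e : maxComm K b g = fun x => ⨆ (ε : ℚ) (_ : 0 < ε),
      ENNReal.ofReal |∫ y in {y : Rn n | (ε:ℝ) ≤ dist x y}, (b x - b y) * K x y * g y| := by
    funext x
    refine le_antisymm (iSup₂_le fun ε hε => ?_) (iSup₂_le fun ε hε => ?_)
    · obtain ⟨u, hu, hlt, ht⟩ := Real.exists_seq_rat_strictMono_tendsto ε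
      obtain ⟨N, hN⟩ := (ht.eventually (lt_mem_nhds hε)).exists
      have hpos : ∀ j, (0:ℝ) < u (j + N) := fun j => hN.trans_le (by exact_mod_cast hu.monotone (Nat.le_add_left _ _))
      have hint : (⋂ j, {y : Rn n | (u (j+N) : ℝ) ≤ dist x y}) = {y | ε ≤ dist x y} := by
        ext y
        simp only [mem_iInter, mem_ofPred_eq]
        exact ⟨fun h => le_of_tendsto' ((tendsto_add_atTop_iff_nat N).2 ht) h, fun h j => (hlt _).le.trans h⟩
      have t := tendsto_setIntegral_of_antitone (μ := volume) (f := fun y => (b x - b y) * K x y * g y)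
        (s := fun j : ℕ => {y : Rn n | (u (j+N) : ℝ) ≤ dist x y}) (fun j => tr_meas x _)
        (fun i j hij y hy => by
          have hy : (u (j+N) : ℝ) ≤ dist x y := hy
          have : (u (i+N) : ℝ) ≤ u (j+N) := by exact_mod_cast hu.monotone (by omega)
          exact this.trans hy) ⟨0, mc_int hK hg hg2 x (hpos 0)⟩
      rw [hint] at t
      refine le_of_tendsto' (ENNReal.continuous_ofReal.continuousAt.tendsto.comp t.abs) fun j => ?_
      exact le_iSup₂_of_le (f := fun (ε : ℚ) (_ : 0 < ε) => ENNReal.ofReal |∫ y in {y : Rn n | (ε:ℝ) ≤ dist x y}, (b x - b y) * K x y * g y|)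
        (u (j+N)) (by exact_mod_cast hpos j) le_rfl
    · exact le_iSup₂_of_le (f := fun (ε : ℝ) (_ : 0 < ε) => ENNReal.ofReal |∫ y in {y : Rn n | ε ≤ dist x y}, (b x - b y) * K x y * g y|)
        (ε:ℝ) (by exact_mod_cast hε) le_rfl
  rw [e]
  refine Measurable.iSup fun ε => Measurable.iSup fun _ => Measurable.ennreal_ofReal ?_
  have e2 : (fun x => ∫ y in {y : Rn n | (ε:ℝ) ≤ dist x y}, (b x - b y) * K x y * g y) =
      fun x => ∫ y, if (ε:ℝ) ≤ dist x y then (b x - b y) * K x y * g y else 0 := by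
    funext x
    rw [← integral_indicator (tr_meas x _)]; rfl
  have hm : StronglyMeasurable fun z : Rn n × Rn n => if (ε:ℝ) ≤ dist z.1 z.2 then (b z.1 - b z.2) * K z.1 z.2 * g z.2 else 0 := by
    have := hK.meas
    refine (Measurable.ite (measurableSet_le measurable_const (measurable_fst.dist measurable_snd)) (by fun_prop) measurable_const).stronglyMeasurable
  have := hm.integral_prod_right' (ν := (volume : Measure (Rn n)))
  have h3 : Measurable (fun x => ∫ y in {y : Rn n | (ε:ℝ) ≤ dist x y}, (b x - b y) * K x y * g y) := by
    rw [e2]; exact this.measurable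
  exact measurable_norm.comp h3

lemma ev_BB [NeZero n] (z u : Rn n) : ∀ᶠ j : ℕ in atTop, u ∈ BB (-(j:ℤ)) z := by
  have hn : (1:ℝ) ≤ √n := by
    rw [Real.one_le_sqrt]; exact_mod_cast Nat.one_le_iff_ne_zero.2 (NeZero.ne n)
  have t := tendsto_pow_atTop_atTop_of_one_lt (r := (2:ℝ)) (by norm_num)
  filter_upwards [t.eventually_gt_atTop (dist u z)] with j hj
  rw [BB, mem_ball]
  have h1 := dist_ctr (-(j:ℤ)) z
  have h2 : (2:ℝ) ^ j ≤ rad n (-(j:ℤ)) := by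
    rw [rad, neg_neg, zpow_natCast]; nlinarith [pow_pos (show (0:ℝ) < 2 by norm_num) j]
  have := dist_triangle u z (ctr (-(j:ℤ)) z)
  have := rad_pos (n := n) (-(j:ℤ))
  linarith

def zz (e : Finset (Fin n)) : Rn n := WithLp.toLp 2 (fun i => if i ∈ e then -1 else 0)

lemma ev_dy (y : Rn n) : ∃ e : Finset (Fin n), ∀ᶠ j : ℕ in atTop, y ∈ dy (-(j:ℤ)) (zz e) := by
  classical
  refine ⟨Finset.univ.filter fun i => y i < 0, ?_⟩
  have t := tendsto_pow_atTop_atTop_of_one_lt (r := (2:ℝ)) (by norm_num)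
  have : ∀ᶠ j : ℕ in atTop, ∀ i, |y i| < (2:ℝ) ^ j := by
    rw [eventually_all]; exact fun i => t.eventually_gt_atTop _
  filter_upwards [this] with j hj i
  have hp : (0:ℝ) < 2 ^ j := by positivity
  have hp1 : (1:ℝ) ≤ 2 ^ j := one_le_pow₀ (by norm_num)
  have h1 := abs_lt.1 (hj i)
  rw [zpow_neg, zpow_natCast]
  simp only [zz, Finset.mem_filter, Finset.mem_univ, true_and]
  by_cases hy : y i < 0
  · rw [if_pos hy]
    have a1 : ⌊((2:ℝ) ^ j)⁻¹ * y i⌋ = -1 := by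
      rw [Int.floor_eq_iff, inv_mul_eq_div]; push_cast
      rw [le_div_iff₀ hp, div_lt_iff₀ hp]; constructor <;> linarith
    have a2 : ⌊((2:ℝ) ^ j)⁻¹ * (-1)⌋ = -1 := by
      rw [Int.floor_eq_iff, inv_mul_eq_div]; push_cast
      rw [le_div_iff₀ hp, div_lt_iff₀ hp]; constructor <;> linarith
    rw [a1, a2]
  · rw [if_neg hy, mul_zero, Int.floor_zero, Int.floor_eq_iff, inv_mul_eq_div]; push_cast
    push Not at hy
    rw [le_div_iff₀ hp, div_lt_iff₀ hp]; constructor <;> linarith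

lemma mc_liminf [NeZero n] {b f : Rn n → ℝ} {p : ℝ} (hp : 0 < p) (z y : Rn n) (hy : ∀ᶠ j : ℕ in atTop, y ∈ dy (-(j:ℤ)) z) :
    maxComm K b f y ^ p ≤ liminf (fun j : ℕ => (dy (-(j:ℤ)) z).indicator (fun y => UQ K b f (-(j:ℤ)) z y ^ p) y) atTop := by
  set L := liminf (fun j : ℕ => (dy (-(j:ℤ)) z).indicator (fun y => UQ K b f (-(j:ℤ)) z y ^ p) y) atTop with hL
  rw [← ENNReal.le_rpow_inv_iff hp]
  refine iSup₂_le fun ε hε => ?_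
  rw [ENNReal.le_rpow_inv_iff hp]
  by_cases hi : IntegrableOn (fun u => (b y - b u) * K y u * f u) {u | ε ≤ dist y u}
  swap
  · rw [integral_undef hi]; simp [hp]
  have t : Tendsto (fun j : ℕ => ∫ u in {u | ε ≤ dist y u}, (b y - b u) * K y u * (BB (-(j:ℤ)) z).indicator f u) atTop
      (𝓝 (∫ u in {u | ε ≤ dist y u}, (b y - b u) * K y u * f u)) := by
    have e : ∀ j : ℕ, (fun u => (b y - b u) * K y u * (BB (-(j:ℤ)) z).indicator f u) =
        (BB (-(j:ℤ)) z).indicator fun u => (b y - b u) * K y u * f u := fun j => by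
      funext u; by_cases h : u ∈ BB (-(j:ℤ)) z <;> simp [h]
    refine tendsto_integral_of_dominated_convergence _ (fun j => ?_) hi.norm (fun j => ?_) ?_
    · rw [e]; exact hi.1.indicator measurableSet_ball
    · refine Eventually.of_forall fun u => ?_
      rw [show (b y - b u) * K y u * (BB (-(j:ℤ)) z).indicator f u = (BB (-(j:ℤ)) z).indicator (fun u => (b y - b u) * K y u * f u) u from congrFun (e j) u]
      exact norm_indicator_le_norm_self _ _
    · refine Eventually.of_forall fun u => tendsto_const_nhds.congr' ?_
      filter_upwards [ev_BB z u] with j hj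
      rw [indicator_of_mem hj]
  have t2 := ((ENNReal.continuous_rpow_const (y := p)).continuousAt.tendsto.comp
    (ENNReal.continuous_ofReal.continuousAt.tendsto.comp t.abs))
  rw [← t2.liminf_eq, hL]
  refine liminf_le_liminf ?_
  filter_upwards [hy] with j hj
  rw [indicator_of_mem hj]
  refine ENNReal.rpow_le_rpow ?_ hp.le
  exact le_iSup₂_of_le (f := fun ε (_ : 0 < ε) => ENNReal.ofReal |∫ u in {u | ε ≤ dist y u}, (b y - b u) * K y u * (BB (-(j:ℤ)) z).indicator f u|) ε hε le_rfl

lemma global_est [NeZero n] (hK : GK C₀ Cr K) (hT : IsCZO n K T) {p : ℝ} {A : ℝ≥0} {w : Rn n → ℝ≥0} (h : Wt p A w) :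
    ∃ C : ℝ≥0, ∀ b f : Rn n → ℝ, NB b → Measurable f → ∫⁻ x, ‖f x‖ₑ ^ p ∂(wm w) ≠ ⊤ →
      ∫⁻ y, maxComm K b f y ^ p ∂(wm w) ≤ C * ∫⁻ x, ‖f x‖ₑ ^ p ∂(wm w) := by
  obtain ⟨C, hC⟩ := local_est hK hT h
  have hp0 : 0 < p := by linarith [h.hp]
  refine ⟨Fintype.card (Finset (Fin n)) * C, fun b f hb hf hfin => ?_⟩
  let F : Finset (Fin n) → ℕ → Rn n → ℝ≥0∞ := fun e j => (dy (-(j:ℤ)) (zz e)).indicator (fun y => UQ K b f (-(j:ℤ)) (zz e) y ^ p)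
  have hFm : ∀ e j, Measurable (F e j) := fun e j => by
    obtain ⟨i1, i2⟩ := aQ_int hb.1 hf (hC b f hb hf hfin (-(j:ℤ)) (zz e)).1
    exact Measurable.indicator ((mc_meas hK hb.1 (hf.indicator measurableSet_ball) i1 i2).pow_const p) (dy_meas _ _)
  calc _ ≤ ∫⁻ y, ∑ e : Finset (Fin n), liminf (fun j => F e j y) atTop ∂(wm w) := by
        refine lintegral_mono fun y => ?_
        obtain ⟨e, he⟩ := ev_dy y
        exact (mc_liminf hp0 _ y he).trans (Finset.single_le_sum (f := fun e => liminf (fun j => F e j y) atTop) (fun _ _ => zero_le) (Finset.mem_univ e))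
    _ = ∑ e : Finset (Fin n), ∫⁻ y, liminf (fun j => F e j y) atTop ∂(wm w) :=
        lintegral_finsetSum _ fun e _ => Measurable.liminf (hFm e)
    _ ≤ ∑ e : Finset (Fin n), C * ∫⁻ x, ‖f x‖ₑ ^ p ∂(wm w) := by
        refine Finset.sum_le_sum fun e _ => (lintegral_liminf_le (hFm e)).trans ?_
        refine (liminf_le_liminf (v := fun _ : ℕ => C * ∫⁻ x, ‖f x‖ₑ ^ p ∂(wm w)) (Eventually.of_forall fun j => ?_)).trans (by simp)
        rw [lintegral_indicator (dy_meas _ _)]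
        exact (hC b f hb hf hfin _ _).2
    _ = _ := by rw [Finset.sum_const, Finset.card_univ, nsmul_eq_mul]; push_cast; ring

end P13

section P14
open scoped NNReal
variable {n : ℕ} {T : Lp ℝ 2 (volume : Measure (Rn n)) →L[ℝ] Lp ℝ 2 (volume : Measure (Rn n))}
  {K : Rn n → Rn n → ℝ}

lemma czo_diag [NeZero n] (hT : IsCZO n K T) : IsCZO n (fun x y => if x = y then 0 else K x y) T := by
  intro f hf hs hc
  filter_upwards [hT f hf hs hc] with x hx hxs
  rw [hx hxs]
  have : ∀ᵐ y : Rn n, y ≠ x := by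
    rw [ae_iff]; simp
  refine integral_congr_ae (this.mono fun y hy => ?_)
  simp only [if_neg hy.symm]

lemma mc_diag (b f : Rn n → ℝ) : maxComm (fun x y => if x = y then 0 else K x y) b f = maxComm K b f := by
  funext x
  refine iSup_congr fun ε => iSup_congr fun hε => ?_
  congr 2
  refine setIntegral_congr_fun (tr_meas x ε) fun y hy => ?_
  have hy : ε ≤ dist x y := hy
  have : x ≠ y := fun h => by rw [h, dist_self] at hy; linarith
  simp only [if_neg this]

lemma mc_congr {b b' f f' : Rn n → ℝ} (hb : b =ᵐ[volume] b') (hf : f =ᵐ[volume] f') :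
    maxComm K b f =ᵐ[volume] maxComm K b' f' := by
  filter_upwards [hb] with x hx
  refine iSup_congr fun ε => iSup_congr fun hε => ?_
  congr 2
  refine integral_congr_ae (ae_restrict_of_ae ?_)
  filter_upwards [hb, hf] with y h1 h2
  rw [hx, h1, h2]

lemma mc_scale (b f : Rn n → ℝ) {β : ℝ} (hβ : 0 < β) (x : Rn n) :
    maxComm K b f x = ENNReal.ofReal β * maxComm K (fun y => β⁻¹ * b y) f x := by
  rw [maxComm, maxComm]
  simp only [ENNReal.mul_iSup]
  refine iSup_congr fun ε => iSup_congr fun hε => ?_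
  rw [← ENNReal.ofReal_mul hβ.le]
  congr 1
  rw [← abs_of_pos hβ, ← abs_mul, ← integral_const_mul, abs_of_pos hβ]
  congr 2
  funext y
  field_simp

lemma osc_le {b : Rn n → ℝ} (hb : IsBMO b) (c : Rn n) {r : ℝ} (hr : 0 < r) : oscBall b c r ≤ bmoNorm b := by
  obtain ⟨-, C, hC⟩ := hb
  have : Nonempty {r : ℝ // 0 < r} := ⟨⟨r, hr⟩⟩
  have h1 : ∀ c, BddAbove (range fun r : {r : ℝ // 0 < r} => oscBall b c r.1) := fun c =>
    ⟨C, by rintro _ ⟨r, rfl⟩; exact hC c r.1 r.2⟩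
  have h2 : BddAbove (range fun c : Rn n => ⨆ r : {r : ℝ // 0 < r}, oscBall b c r.1) :=
    ⟨C, by rintro _ ⟨c, rfl⟩; exact ciSup_le fun r => hC c r.1 r.2⟩
  exact (le_ciSup (h1 c) ⟨r, hr⟩).trans (le_ciSup h2 c)

lemma bmo_nonneg {b : Rn n → ℝ} (hb : IsBMO b) : 0 ≤ bmoNorm b := by
  refine le_trans ?_ (osc_le hb 0 one_pos)
  rw [oscBall, setAverage_eq]
  exact smul_nonneg (by positivity) (integral_nonneg fun _ => abs_nonneg _)

lemma nb_of {b b' : Rn n → ℝ} (hb : IsBMO b) (hbb : b =ᵐ[volume] b') (hm : Measurable b') {β : ℝ} (hβ : bmoNorm b < β) :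
    NB (fun y => β⁻¹ * b' y) := by
  have hβ0 : 0 < β := (bmo_nonneg hb).trans_lt hβ
  refine ⟨by fun_prop, fun c r hr => ?_⟩
  set m := ⨍ y in ball c r, b y with hmm
  have e1 : mb (fun y => β⁻¹ * b' y) c r = β⁻¹ * m := by
    rw [mb, hmm, setAverage_eq, setAverage_eq, integral_const_mul,
      integral_congr_ae (ae_restrict_of_ae hbb)]
    simp only [smul_eq_mul]; ring
  have hint : IntegrableOn (fun y => b y - m) (ball c r) := by
    have h1 : IntegrableOn b (ball c r) :=
      (hb.1.integrableOn_isCompact (isCompact_closedBall c r)).mono_set ball_subset_closedBall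
    exact h1.sub (integrableOn_const (by exact measure_ball_lt_top.ne))
  have hv : 0 < volume.real (ball c r) := by
    rw [Measure.real]; exact ENNReal.toReal_pos (measure_ball_pos volume c hr).ne' measure_ball_lt_top.ne
  have h2 : ∫ y in ball c r, |b y - m| ≤ β * volume.real (ball c r) := by
    have := (osc_le hb c hr).trans hβ.le
    rw [oscBall, setAverage_eq, smul_eq_mul, inv_mul_le_iff₀ hv, mul_comm] at this
    exact this
  calc ∫⁻ y in ball c r, ‖β⁻¹ * b' y - mb (fun y => β⁻¹ * b' y) c r‖ₑ
      = ∫⁻ y in ball c r, ENNReal.ofReal β⁻¹ * ‖b y - m‖ₑ := by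
        refine lintegral_congr_ae (ae_restrict_of_ae (hbb.mono fun y hy => ?_))
        simp only
        rw [e1, ← hy, ← mul_sub, enorm_mul, Real.enorm_of_nonneg (by positivity)]
    _ = ENNReal.ofReal β⁻¹ * ENNReal.ofReal (∫ y in ball c r, |b y - m|) := by
        rw [lintegral_const_mul' _ _ (by finiteness)]
        congr 1
        exact (ofReal_integral_norm_eq_lintegral_enorm hint).symm
    _ ≤ ENNReal.ofReal β⁻¹ * ENNReal.ofReal (β * volume.real (ball c r)) := by gcongr
    _ = volume (ball c r) := by
        rw [← ENNReal.ofReal_mul (by positivity), ← mul_assoc, inv_mul_cancel₀ hβ0.ne', one_mul, Measure.real,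
          ENNReal.ofReal_toReal measure_ball_lt_top.ne]

lemma wm_ac' {w : Rn n → ℝ≥0} (hw : Measurable w) (h : ∀ x, 0 < w x) : volume ≪ wm w :=
  withDensity_absolutelyContinuous' hw.coe_nnreal_ennreal.aemeasurable
    (Eventually.of_forall fun x => by exact_mod_cast (h x).ne')

end P14

/-- For `1 < p < ∞`, `ω ∈ A_p`, `T` a θ-type Calderón–Zygmund operator
with Dini modulus, there is `C` (independent of `b` and `f`) such that for every
`b ∈ BMO(ℝⁿ)` and `f ∈ L^p(ω)`: `‖[b,T*]f‖_{L^p(ω)} ≤ C ‖b‖_BMO ‖f‖_{L^p(ω)}`. -/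
theorem statement11 {n : ℕ} (p : ℝ) (hp : 1 < p)
    (ω : Rn n → ℝ) (hω : IsAp n p ω)
    (θ : ℝ → ℝ) (hθ : IsModulus θ) (hDini : DiniCondition θ)
    (C₀ : ℝ) (K : Rn n → Rn n → ℝ) (hK : IsThetaKernel n θ C₀ K)
    (T : Lp ℝ 2 (volume : Measure (Rn n)) →L[ℝ] Lp ℝ 2 (volume : Measure (Rn n)))
    (hT : IsCZO n K T) :
    ∃ C : ℝ, 0 < C ∧
      ∀ b : Rn n → ℝ, IsBMO b →
      ∀ f : Rn n → ℝ, MemLp f (ENNReal.ofReal p) (wMeasure n ω) →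
        wLpNorm p (wMeasure n ω) (maxComm K b f) ≤
          ENNReal.ofReal (C * bmoNorm b) *
            eLpNorm f (ENNReal.ofReal p) (wMeasure n ω) := by
  rcases Nat.eq_zero_or_pos n with h0 | hn
  · subst h0
    refine ⟨1, one_pos, fun b _ f _ => ?_⟩
    have : ∀ x, maxComm K b f x = 0 := fun x => by
      rw [maxComm]
      simp only [ENNReal.iSup_eq_zero]
      intro ε hε
      have : {y : Rn 0 | ε ≤ dist x y} = ∅ := by
        ext y; rw [Subsingleton.elim y x]; simpa using hε
      rw [this]; simp
    rw [wLpNorm]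
    simp only [this]
    rw [ENNReal.zero_rpow_of_pos (by linarith), lintegral_zero, ENNReal.zero_rpow_of_pos (by positivity)]
    exact zero_le
  have : NeZero n := ⟨hn.ne'⟩
  have hp0 : 0 < p := by linarith
  obtain ⟨A, w, hw, hμ⟩ := exists_wt hp hω
  obtain ⟨Cr, hG⟩ := gk_of hθ hDini hK
  obtain ⟨C, hC⟩ := global_est hG (czo_diag hT) hw
  refine ⟨(C:ℝ) ^ (1/p) + 1, by positivity, fun b hb f hf => ?_⟩
  rw [hμ] at hf ⊢
  set f' := hf.1.mk f with hf'
  have hff : f =ᵐ[wm w] f' := hf.1.ae_eq_mk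
  have hfv : f =ᵐ[volume] f' := (wm_ac' hw.meas hw.pos).ae_le hff
  have hfm : Measurable f' := hf.1.stronglyMeasurable_mk.measurable
  have hbae := hb.1.aestronglyMeasurable
  set b' := hbae.mk b with hb'
  have hbv : b =ᵐ[volume] b' := hbae.ae_eq_mk
  have hbm : Measurable b' := hbae.stronglyMeasurable_mk.measurable
  set X := ∫⁻ x, ‖f' x‖ₑ ^ p ∂(wm w) with hX
  have hnorm : eLpNorm f (ENNReal.ofReal p) (wm w) = X ^ (1/p) := by
    rw [eLpNorm_congr_ae hff, eLpNorm_eq_lintegral_rpow_enorm_toReal (by simpa using hp0) ENNReal.ofReal_ne_top,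
      ENNReal.toReal_ofReal hp0.le]
  have hXt : X ≠ ⊤ := fun h => by
    have := hf.2
    rw [hnorm, h, ENNReal.top_rpow_of_pos (by positivity)] at this
    exact lt_irrefl _ this
  have key : ∀ β, bmoNorm b < β → wLpNorm p (wm w) (maxComm K b f) ≤
      ENNReal.ofReal (((C:ℝ) ^ (1/p) + 1) * β) * X ^ (1/p) := fun β hβ => by
    have hβ0 : 0 < β := (bmo_nonneg hb).trans_lt hβ
    have h1 := hC _ f' (nb_of hb hbv hbm hβ) hfm hXt
    rw [mc_diag] at h1
    rw [wLpNorm]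
    have h2 : ∫⁻ x, maxComm K b f x ^ p ∂(wm w) =
        ENNReal.ofReal β ^ p * ∫⁻ x, maxComm K (fun y => β⁻¹ * b' y) f' x ^ p ∂(wm w) := by
      rw [← lintegral_const_mul' _ _ (by finiteness)]
      refine lintegral_congr_ae ((wm_ac w).ae_le ?_)
      filter_upwards [mc_congr (K := K) hbv hfv] with x hx
      rw [hx, mc_scale b' f' hβ0, ENNReal.mul_rpow_of_nonneg _ _ hp0.le]
    rw [h2]
    calc _ ≤ (ENNReal.ofReal β ^ p * (C * X)) ^ (1/p) := by gcongr
      _ = (C:ℝ≥0∞) ^ (1/p) * ENNReal.ofReal β * X ^ (1/p) := by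
        rw [ENNReal.mul_rpow_of_nonneg _ _ (by positivity), ENNReal.mul_rpow_of_nonneg _ _ (by positivity), ← ENNReal.rpow_mul,
          mul_one_div_cancel hp0.ne', ENNReal.rpow_one]
        ring
      _ ≤ _ := by
        rw [ENNReal.ofReal_mul (by positivity)]
        gcongr
        rw [← ENNReal.ofReal_coe_nnreal, ENNReal.ofReal_rpow_of_nonneg (by positivity) (by positivity)]
        exact ENNReal.ofReal_le_ofReal (by linarith)
  rw [hnorm]
  have t : Tendsto (fun j : ℕ => bmoNorm b + 1 / ((j:ℝ) + 1)) atTop (𝓝 (bmoNorm b + 0)) :=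
    tendsto_one_div_add_atTop_nhds_zero_nat.const_add _
  rw [add_zero] at t
  refine ge_of_tendsto' (ENNReal.Tendsto.mul_const (ENNReal.continuous_ofReal.continuousAt.tendsto.comp (t.const_mul ((C:ℝ) ^ (1/p) + 1)))
    (Or.inr (by finiteness))) fun j => key _ ?_
  have : (0:ℝ) < 1 / ((j:ℝ) + 1) := by positivity
  linarith
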